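/- Let (G_i)_{i∈ℕ} be a recursively enumerated family of finitely generated groups with computable left orders: there are a computable function n : ℕ → ℕ, surjective homomorphisms π_i from the free group on n(i) generators onto G_i, left-invariant linear orders ≤_i on each G_i, and a computable two-variable function assigning to each pair (i, w), where w is a word over the n(i) generators and their inverses, the sign of π_i(w) relative to the identity of (G_i, ≤_i). Then there exists a finitely generated simple group H having a computable left order such that every G_i admits an embedding into H that is simultaneously quasi-isometric and Frattini. -/

import Mathlib

-- The sign (−1, 0, or 1) of a group element relative to the identity,
-- with respect to a linear order `l`.
open Classical in
noncomputable def orderSign {H : Type*} [Group H] (l : LinearOrder H) (h : H) : ℤ :=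
  if l.lt h 1 then -1 else if h = 1 then 0 else 1

/-- A group is left-orderable if it carries a left-invariant linear order. -/
def IsLeftOrderable (G : Type*) [Group G] : Prop :=
  ∃ l : LinearOrder G, ∀ a b c : G, l.le b c → l.le (a * b) (a * c)

/-- A Frattini embedding: an injective homomorphism preserving and reflecting conjugacy. -/
def IsFrattini {G H : Type*} [Group G] [Group H] (φ : G →* H) : Prop :=
  Function.Injective φ ∧ ∀ a b : G, IsConj a b ↔ IsConj (φ a) (φ b)

/-- `X` is a (finite) generating set of the group. -/
def Generates {G : Type*} [Group G] (X : Finset G) : Prop :=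
  Subgroup.closure (X : Set G) = ⊤

/-- Word length of `g` with respect to the finite set `X`: the least length of a word
over `X ∪ X⁻¹` representing `g`. -/
noncomputable def wordLength {G : Type*} [Group G] (X : Finset G) (g : G) : ℕ :=
  sInf {n | ∃ w : List G, w.length = n ∧ (∀ a ∈ w, a ∈ X ∨ a⁻¹ ∈ X) ∧ w.prod = g}

/-- Quasi-isometric embedding with respect to finite generating sets `X` and `Y`. -/
noncomputable def IsQIEmbedding {G H : Type*} [Group G] [Group H]
    (X : Finset G) (Y : Finset H) (φ : G →* H) : Prop :=
  Function.Injective φ ∧ ∃ C k : ℝ, 0 < C ∧ 0 < k ∧ ∀ g : G,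
    (1 / C) * (wordLength X g : ℝ) - k ≤ (wordLength Y (φ g) : ℝ) ∧
    (wordLength Y (φ g) : ℝ) ≤ C * (wordLength X g : ℝ) + k

/-- Evaluation of a formal word (list of pairs (index, sign)) over the
enumerated sequence `x : ℕ → G`. -/
def evalWord {G : Type*} [Group G] (x : ℕ → G) (w : List (ℕ × Bool)) : G :=
  (w.map (fun p => if p.2 then x p.1 else (x p.1)⁻¹)).prod

/-- A computable left order on a countable group with respect to an enumerated
generating sequence `x : ℕ → G`. -/
def ComputableLeftOrderWrt {G : Type*} [Group G] (x : ℕ → G) : Prop :=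
  ∃ l : LinearOrder G, (∀ a b c : G, l.le b c → l.le (a * b) (a * c)) ∧
    Computable (fun w : List (ℕ × Bool) => orderSign l (evalWord x w))

/-- A computable left order on a finitely generated group, presented by
a surjection `π` from a free group of finite rank. -/
def ComputableLeftOrderVia {H : Type*} [Group H] {m : ℕ}
    (π : FreeGroup (Fin m) →* H) : Prop :=
  ∃ l : LinearOrder H, (∀ a b c : H, l.le b c → l.le (a * b) (a * c)) ∧
    Computable (fun w : List (Fin m × Bool) => orderSign l (π (FreeGroup.mk w)))

/-- The embedding `φ` is computable: one can compute, for each `i`, a word over the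
generators of `H` representing `φ (x i)`. -/
def ComputableEmbedding {G H : Type*} [Group G] [Group H] (x : ℕ → G) {m : ℕ}
    (π : FreeGroup (Fin m) →* H) (φ : G →* H) : Prop :=
  ∃ f : ℕ → List (Fin m × Bool), Computable f ∧ ∀ i, π (FreeGroup.mk (f i)) = φ (x i)

/-- Decidable membership problem for the image of `φ` in `H`, presented via `π`. -/
def DecidableMembership {G H : Type*} [Group G] [Group H] {m : ℕ}
    (π : FreeGroup (Fin m) →* H) (φ : G →* H) : Prop :=
  ComputablePred (fun w : List (Fin m × Bool) => π (FreeGroup.mk w) ∈ φ.range)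

/-- Decidable word problem for `H`, presented via `π`. -/
def DecidableWordProblemVia {H : Type*} [Group H] {m : ℕ}
    (π : FreeGroup (Fin m) →* H) : Prop :=
  ComputablePred (fun w : List (Fin m × Bool) => π (FreeGroup.mk w) = 1)

/-- A group is finitely presented: quotient of a finite-rank free group by the
normal closure of finitely many relators. -/
def IsFinitelyPresented (K : Type*) [Group K] : Prop :=
  ∃ (m : ℕ) (π : FreeGroup (Fin m) →* K) (R : Finset (FreeGroup (Fin m))),
    Function.Surjective π ∧ π.ker = Subgroup.normalClosure (R : Set (FreeGroup (Fin m)))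

set_option linter.unusedSectionVars false

namespace SimpEmb

/-! ### Lifting permutations along injections -/

section Lift
variable {α β γ : Type*}

/-- Extension of a permutation along an injection (identity outside the range). -/
noncomputable def lft (ι : α → β) (h : Function.Injective ι) : Equiv.Perm α →* Equiv.Perm β :=
  Equiv.Perm.viaEmbeddingHom ⟨ι, h⟩

theorem lft_apply (ι : α → β) (h : Function.Injective ι) (e : Equiv.Perm α) (a : α) :
    lft ι h e (ι a) = ι (e a) :=
  Equiv.Perm.viaEmbedding_apply e ⟨ι, h⟩ a

theorem lft_notMem (ι : α → β) (h : Function.Injective ι) (e : Equiv.Perm α) (b : β)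
    (hb : ∀ a, ι a ≠ b) : lft ι h e b = b :=
  Equiv.Perm.viaEmbedding_apply_of_notMem e ⟨ι, h⟩ b (by rintro ⟨a, ha⟩; exact hb a ha)

theorem lft_ext (ι : α → β) (h : Function.Injective ι) (e : Equiv.Perm α) (f : Equiv.Perm β)
    (h1 : ∀ a, f (ι a) = ι (e a)) (h2 : ∀ b, (∀ a, ι a ≠ b) → f b = b) : f = lft ι h e := by
  ext b
  by_cases hb : ∃ a, ι a = b
  · obtain ⟨a, rfl⟩ := hb
    rw [h1, lft_apply]
  · push Not at hb
    rw [h2 b hb, lft_notMem ι h e b hb]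

theorem lft_conj (ι ι' : α → β) (h : Function.Injective ι) (h' : Function.Injective ι')
    (f : Equiv.Perm β) (hf : ∀ a, f (ι a) = ι' a) (e : Equiv.Perm α) :
    f * lft ι h e * f⁻¹ = lft ι' h' e := by
  apply lft_ext
  · intro a
    have : f⁻¹ (ι' a) = ι a := by rw [← hf]; simp
    simp only [Equiv.Perm.mul_apply, this, lft_apply, hf]
  · intro b hb
    have : lft ι h e (f⁻¹ b) = f⁻¹ b := by
      apply lft_notMem
      intro a ha
      apply hb a
      rw [← hf, ha]; simp
    simp only [Equiv.Perm.mul_apply, this]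
    simp

theorem lft_lft (κ : α → β) (hκ : Function.Injective κ) (ι : β → γ) (hι : Function.Injective ι)
    (e : Equiv.Perm α) : lft ι hι (lft κ hκ e) = lft (ι ∘ κ) (hι.comp hκ) e := by
  apply lft_ext
  · intro a
    simp only [Function.comp, lft_apply]
  · intro c hc
    by_cases hb : ∃ b, ι b = c
    · obtain ⟨b, rfl⟩ := hb
      rw [lft_apply, lft_notMem κ hκ e b]
      intro a ha
      exact hc a (by simp [ha])
    · push Not at hb
      exact lft_notMem ι hι _ _ hb

theorem lft_commute (ι : α → γ) (h : Function.Injective ι) (κ : β → γ)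
    (h' : Function.Injective κ) (hd : ∀ a b, ι a ≠ κ b) (e : Equiv.Perm α) (f : Equiv.Perm β) :
    Commute (lft ι h e) (lft κ h' f) := by
  ext c
  simp only [Equiv.Perm.mul_apply]
  by_cases hc : ∃ a, ι a = c
  · obtain ⟨a, rfl⟩ := hc
    rw [lft_apply, lft_notMem κ h' f _ (fun b hb => hd _ b hb.symm),
      lft_notMem κ h' f _ (fun b hb => hd _ b hb.symm), lft_apply]
  · push Not at hc
    rw [lft_notMem ι h e c hc]
    by_cases hb : ∃ b, κ b = c
    · obtain ⟨b, rfl⟩ := hb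
      rw [lft_apply, lft_notMem ι h e]
      intro a
      exact hd _ _
    · push Not at hb
      rw [lft_notMem κ h' f c hb, lft_notMem ι h e c hc]

theorem lft_congr {ι ι' : α → β} (h : Function.Injective ι) (h' : Function.Injective ι')
    (e : Equiv.Perm α) (hi : ∀ a, ι a = ι' a) : lft ι h e = lft ι' h' e := by
  have : ι = ι' := funext hi
  subst this
  rfl

theorem strictMono_of_fiber {J : Type*} [LinearOrder β] [LinearOrder J] (I : β → J)
    (hI : Monotone I) (f : β → β) (hf : ∀ b, I (f b) = I b)
    (hlt : ∀ b c, I b = I c → b < c → f b < f c) : StrictMono f := by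
  intro b c hbc
  rcases (hI hbc.le).lt_or_eq with h | h
  · by_contra hn
    push Not at hn
    have := hI hn
    rw [hf, hf] at this
    exact absurd h (not_lt.mpr this)
  · exact hlt b c h hbc

theorem lft_strictMono {J : Type*} [LinearOrder β] [LinearOrder J] (I : β → J)
    (hI : Monotone I) (ι : α → β) (h : Function.Injective ι) (e : Equiv.Perm α)
    (h1 : ∀ a, I (ι (e a)) = I (ι a))
    (h2 : ∀ a a', I (ι a) = I (ι a') → ι a < ι a' → ι (e a) < ι (e a'))
    (h3 : ∀ a b, I (ι a) = I b → ∃ a', ι a' = b) : StrictMono (lft ι h e) := by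
  apply strictMono_of_fiber I hI
  · intro b
    by_cases hb : ∃ a, ι a = b
    · obtain ⟨a, rfl⟩ := hb
      rw [lft_apply, h1]
    · push Not at hb
      rw [lft_notMem ι h e b hb]
  · intro b c hbc hlt
    by_cases hb : ∃ a, ι a = b
    · obtain ⟨a, rfl⟩ := hb
      obtain ⟨a', rfl⟩ := h3 a c hbc
      rw [lft_apply, lft_apply]
      exact h2 _ _ hbc hlt
    · have hc : ∀ a, ι a ≠ c := by
        rintro a rfl
        exact hb (h3 a b hbc.symm)
      push Not at hb
      rw [lft_notMem ι h e b hb, lft_notMem ι h e c hc]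
      exact hlt

theorem strictMono_inv [LinearOrder β] (f : Equiv.Perm β) (h : StrictMono f) :
    StrictMono (f⁻¹ : Equiv.Perm β) := by
  intro a b hab
  rw [← h.lt_iff_lt]
  simpa using hab

end Lift

/-! ### Infinite strings -/

section Strings
variable {S : Type*}

/-- Infinite strings with the lexicographic order. -/
def Str (S : Type*) : Type _ := Lex (ℕ → S)

noncomputable instance [LinearOrder S] : LinearOrder (Str S) :=
  inferInstanceAs (LinearOrder (Lex (ℕ → S)))

/-- Prepend a letter. -/
def cons (s : S) (u : Str S) : Str S := fun n => Nat.casesOn n s (fun m => u m)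

/-- First letter. -/
def hd (u : Str S) : S := u 0

/-- Remaining letters. -/
def tl (u : Str S) : Str S := fun n => u (n + 1)

@[simp] theorem hd_cons (s : S) (u : Str S) : hd (cons s u) = s := rfl
@[simp] theorem tl_cons (s : S) (u : Str S) : tl (cons s u) = u := rfl
@[simp] theorem cons_hd_tl (u : Str S) : cons (hd u) (tl u) = u := by
  funext n
  cases n <;> rfl

theorem exists_cons (u : Str S) : ∃ s v, u = cons s v := ⟨hd u, tl u, (cons_hd_tl u).symm⟩

@[simp] theorem cons_inj {s s' : S} {u u' : Str S} : cons s u = cons s' u' ↔ s = s' ∧ u = u' := by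
  constructor
  · intro h
    exact ⟨by simpa using congrArg hd h, by simpa using congrArg tl h⟩
  · rintro ⟨rfl, rfl⟩; rfl

theorem cons_injective (s : S) : Function.Injective (cons s) := fun _ _ h => (cons_inj.1 h).2

theorem cons_lt [LinearOrder S] {s s' : S} {u u' : Str S} :
    cons s u < cons s' u' ↔ s < s' ∨ s = s' ∧ u < u' := by
  constructor
  · rintro ⟨n, h1, h2⟩
    cases n with
    | zero => exact Or.inl h2
    | succ n =>
      refine Or.inr ⟨h1 0 (Nat.succ_pos n), n, fun j hj => h1 (j + 1) (by omega), h2⟩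
  · rintro (h | ⟨rfl, n, h1, h2⟩)
    · exact ⟨0, fun j hj => absurd hj (Nat.not_lt_zero j), h⟩
    · refine ⟨n + 1, fun j hj => ?_, h2⟩
      cases j with
      | zero => rfl
      | succ j => exact h1 j (Nat.lt_of_succ_lt_succ hj)

theorem hd_mono [LinearOrder S] : Monotone (hd : Str S → S) := by
  intro u v h
  obtain ⟨s, u, rfl⟩ := exists_cons u
  obtain ⟨s', v, rfl⟩ := exists_cons v
  rcases h.lt_or_eq with h | h
  · rcases cons_lt.1 h with h | h
    · exact h.le
    · exact h.1.le
  · rw [h]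

end Strings

/-! ### The Thompson-like permutation `x` -/

section X
variable {S : Type*} [LinearOrder S] [BoundedOrder S] [Nontrivial S]

open Classical in
/-- forward map of `x` -/
noncomputable def xfun (p : Str S) : Str S :=
  if hd p = ⊥ then
    (if hd (tl p) = ⊤ then cons ⊤ (cons ⊥ (tl (tl p))) else tl p)
  else cons ⊤ p

open Classical in
/-- inverse map of `x` -/
noncomputable def xinv (p : Str S) : Str S :=
  if hd p = ⊤ then
    (if hd (tl p) = ⊥ then cons ⊥ (cons ⊤ (tl (tl p))) else tl p)
  else cons ⊥ p

/-- the permutation `x` of strings -/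
noncomputable def xp (S : Type*) [LinearOrder S] [BoundedOrder S] [Nontrivial S] :
    Equiv.Perm (Str S) where
  toFun := xfun
  invFun := xinv
  left_inv := by
    intro p
    obtain ⟨a, p, rfl⟩ := exists_cons p
    obtain ⟨b, p, rfl⟩ := exists_cons p
    by_cases ha : a = ⊥
    · subst ha
      by_cases hb : b = ⊤
      · subst hb; simp [xfun, xinv]
      · simp [xfun, xinv, hb]
    · simp [xfun, xinv, ha]
  right_inv := by
    intro p
    obtain ⟨a, p, rfl⟩ := exists_cons p
    obtain ⟨b, p, rfl⟩ := exists_cons p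
    by_cases ha : a = ⊤
    · subst ha
      by_cases hb : b = ⊥
      · subst hb; simp [xfun, xinv]
      · simp [xfun, xinv, hb]
    · simp [xfun, xinv, ha]

theorem xp_bt (u : Str S) : xp S (cons ⊥ (cons ⊤ u)) = cons ⊤ (cons ⊥ u) := by
  simp [xp, xfun]
theorem xp_b {u : Str S} (h : hd u ≠ ⊤) : xp S (cons ⊥ u) = u := by
  simp [xp, xfun, h]
theorem xp_n {u : Str S} (h : hd u ≠ ⊥) : xp S u = cons ⊤ u := by
  simp [xp, xfun, h]
theorem xp_bb (u : Str S) : xp S (cons ⊥ (cons ⊥ u)) = cons ⊥ u := xp_b (by simp)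
theorem xp_t (u : Str S) : xp S (cons ⊤ u) = cons ⊤ (cons ⊤ u) := xp_n (by simp)

theorem xp_apply_cons (s : S) (hs : s ≠ ⊥) (u : Str S) :
    xp S (cons s u) = cons ⊤ (cons s u) := xp_n (by simpa)
theorem xp_apply_bcons (s : S) (hs : s ≠ ⊤) (u : Str S) :
    xp S (cons ⊥ (cons s u)) = cons s u := xp_b (by simpa)

theorem xp_inv_tb (u : Str S) : (xp S)⁻¹ (cons ⊤ (cons ⊥ u)) = cons ⊥ (cons ⊤ u) := by
  rw [Equiv.Perm.inv_eq_iff_eq, xp_bt]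
theorem xp_inv_t {s : S} (hs : s ≠ ⊥) (u : Str S) :
    (xp S)⁻¹ (cons ⊤ (cons s u)) = cons s u := by
  rw [Equiv.Perm.inv_eq_iff_eq, xp_apply_cons s hs]
theorem xp_inv_n {s : S} (hs : s ≠ ⊤) (u : Str S) :
    (xp S)⁻¹ (cons s u) = cons ⊥ (cons s u) := by
  rw [Equiv.Perm.inv_eq_iff_eq, xp_apply_bcons s hs]

theorem xp_strictMono : StrictMono (xp S) := by
  intro p q h
  obtain ⟨a, p, rfl⟩ := exists_cons p
  obtain ⟨b, p, rfl⟩ := exists_cons p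
  obtain ⟨c, q, rfl⟩ := exists_cons q
  obtain ⟨d, q, rfl⟩ := exists_cons q
  have hbt : (⊥ : S) < ⊤ := bot_lt_top
  by_cases ha : a = ⊥
  · subst ha
    by_cases hc : c = ⊥
    · subst hc
      by_cases hb : b = ⊤
      · subst hb
        by_cases hd' : d = ⊤
        · subst hd'
          rw [xp_bt, xp_bt]
          simpa [cons_lt] using h
        · exfalso
          have : d < ⊤ := lt_top_iff_ne_top.2 hd'
          simp [cons_lt, not_top_lt] at h
          exact hd' h.1.symm
      · by_cases hd' : d = ⊤
        · subst hd'
          rw [xp_bt, xp_apply_bcons b hb]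
          simp [cons_lt, lt_top_iff_ne_top.2 hb]
        · rw [xp_apply_bcons b hb, xp_apply_bcons d hd']
          simpa [cons_lt] using h
    · rw [xp_apply_cons c hc]
      have hc' : ⊥ < c := bot_lt_iff_ne_bot.2 hc
      by_cases hb : b = ⊤
      · subst hb; rw [xp_bt]; simp [cons_lt, hc']
      · rw [xp_apply_bcons b hb]
        simp [cons_lt, lt_top_iff_ne_top.2 hb]
  · have ha' : ⊥ < a := bot_lt_iff_ne_bot.2 ha
    have hc : c ≠ ⊥ := by
      rintro rfl
      simp [cons_lt] at h
      exact ha h.1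
    rw [xp_apply_cons a ha, xp_apply_cons c hc]
    simpa [cons_lt] using h

/-- action on the cone of `s` -/
noncomputable def sub (s : S) : Equiv.Perm (Str S) →* Equiv.Perm (Str S) :=
  lft (cons s) (cons_injective s)

theorem sub_cons (s : S) (g : Equiv.Perm (Str S)) (u : Str S) :
    sub s g (cons s u) = cons s (g u) := lft_apply _ _ _ _

theorem sub_ne {s t : S} (h : s ≠ t) (g : Equiv.Perm (Str S)) (u : Str S) :
    sub s g (cons t u) = cons t u :=
  lft_notMem _ _ _ _ (by intro a; simp [h])

theorem sub_strictMono (s : S) (g : Equiv.Perm (Str S)) (hg : StrictMono g) :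
    StrictMono (sub s g) := by
  apply lft_strictMono hd hd_mono
  · intro a; rfl
  · intro a b _ h
    rw [cons_lt] at h ⊢
    simpa [hg.lt_iff_lt] using h
  · intro a b h
    exact ⟨tl b, by rw [← cons_hd_tl b]; simp [← h]⟩

/-- pentagon-like relation -/
theorem pentagon : xp S * xp S = sub ⊤ (xp S) * xp S * sub ⊥ (xp S) := by
  have hbt : (⊥ : S) ≠ ⊤ := bot_ne_top
  ext p
  obtain ⟨a, p, rfl⟩ := exists_cons p
  simp only [Equiv.Perm.mul_apply]
  by_cases ha : a = ⊥
  · subst ha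
    rw [sub_cons]
    obtain ⟨b, p, rfl⟩ := exists_cons p
    by_cases hb : b = ⊥
    · subst hb
      obtain ⟨c, p, rfl⟩ := exists_cons p
      rw [xp_bb]
      by_cases hc : c = ⊤
      · subst hc
        rw [xp_bt, xp_bt, sub_cons, xp_bb]
      · rw [xp_apply_bcons c hc, xp_apply_bcons c hc, sub_ne (Ne.symm hc)]
    · rw [xp_apply_cons b hb, xp_bt, sub_cons]
      by_cases hb' : b = ⊤
      · subst hb'
        rw [xp_bt, xp_t]
      · rw [xp_apply_bcons b hb', xp_apply_cons b hb]
  · rw [sub_ne (Ne.symm ha), xp_apply_cons a ha, xp_t, sub_cons, xp_apply_cons a ha]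

end X
end SimpEmb

set_option linter.unusedSectionVars false
set_option linter.unusedSimpArgs false
namespace SimpEmb
/-! ### Cones -/
section Cones
variable {S : Type*} [LinearOrder S] [BoundedOrder S] [Nontrivial S]

/-- prepend a finite list -/
def pre (w : List S) (u : Str S) : Str S := w.foldr cons u

@[simp] theorem pre_nil (u : Str S) : pre [] u = u := rfl
@[simp] theorem pre_cons (s : S) (w : List S) (u : Str S) : pre (s :: w) u = cons s (pre w u) := rfl

theorem pre_injective (w : List S) : Function.Injective (pre w) := by
  induction w with
  | nil => intro a b h; exact h
  | cons s w ih => intro a b h; exact ih (cons_injective s h)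

/-- action of `g` on the cone `w` -/
noncomputable def sb (w : List S) : Equiv.Perm (Str S) →* Equiv.Perm (Str S) :=
  lft (pre w) (pre_injective w)

theorem sub_sb (s : S) (w : List S) (g : Equiv.Perm (Str S)) : sub s (sb w g) = sb (s :: w) g := by
  unfold sub sb
  rw [lft_lft]
  rfl

theorem sb_nil (g : Equiv.Perm (Str S)) : sb [] g = g :=
  Equiv.ext (fun u => lft_apply (pre ([] : List S)) (pre_injective []) g u)

theorem sb_sb (w w' : List S) (g : Equiv.Perm (Str S)) : sb w (sb w' g) = sb (w ++ w') g := by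
  unfold sb
  rw [lft_lft]
  exact lft_congr _ _ _ (fun a => by simp [pre, List.foldr_append])

theorem sb_one (s : S) (g : Equiv.Perm (Str S)) : sb [s] g = sub s g := by
  rw [← sub_sb, sb_nil]

theorem sb_pre (w : List S) (g : Equiv.Perm (Str S)) (u : Str S) :
    sb w g (pre w u) = pre w (g u) := lft_apply _ _ _ _

theorem sb_conj (f : Equiv.Perm (Str S)) (w w' : List S) (h : ∀ u, f (pre w u) = pre w' u)
    (g : Equiv.Perm (Str S)) : f * sb w g * f⁻¹ = sb w' g :=
  lft_conj _ _ _ _ f h g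

theorem sb_commute (w w' : List S) (h : ∀ u v, pre w u ≠ pre w' v) (g g' : Equiv.Perm (Str S)) :
    Commute (sb w g) (sb w' g') := lft_commute _ _ _ _ h _ _

theorem sb_strictMono (w : List S) (g : Equiv.Perm (Str S)) (hg : StrictMono g) :
    StrictMono (sb w g) := by
  induction w with
  | nil => rwa [sb_nil]
  | cons s w ih => rw [← sub_sb]; exact sub_strictMono s _ ih

/-- the element `β` -/
noncomputable def bet (g : Equiv.Perm (Str S)) : Equiv.Perm (Str S) :=
  sb [⊥, ⊤] g * sb [⊤, ⊤, ⊥] g⁻¹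

/-- the element `x` on the cone of `⊤` -/
noncomputable def xt (S : Type*) [LinearOrder S] [BoundedOrder S] [Nontrivial S] :
    Equiv.Perm (Str S) := sub ⊤ (xp S)

theorem xt_b (u : Str S) : xt S (cons ⊥ u) = cons ⊥ u := sub_ne top_ne_bot _ _
theorem xt_t (u : Str S) : xt S (cons ⊤ u) = cons ⊤ (xp S u) := sub_cons _ _ _
theorem xt_inv_t (u : Str S) : (xt S)⁻¹ (cons ⊤ u) = cons ⊤ ((xp S)⁻¹ u) := by
  rw [Equiv.Perm.inv_eq_iff_eq, xt_t]; simp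

theorem xx_bet (g : Equiv.Perm (Str S)) :
    xp S * xp S * bet g * (xp S * xp S)⁻¹ =
      sb [⊤, ⊤, ⊥] g * sb [⊤, ⊤, ⊤, ⊤, ⊥] g⁻¹ := by
  have e1 := sb_conj (xp S * xp S) [⊥, ⊤] [⊤, ⊤, ⊥]
    (fun u => by simp [Equiv.Perm.mul_apply, xp_bt, xp_t]) g
  have e2 := sb_conj (xp S * xp S) [⊤, ⊤, ⊥] [⊤, ⊤, ⊤, ⊤, ⊥]
    (fun u => by simp [Equiv.Perm.mul_apply, xp_t]) g⁻¹
  rw [← e1, ← e2, bet]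
  group

theorem tt_bet (g : Equiv.Perm (Str S)) :
    xt S * xt S * bet g * (xt S * xt S)⁻¹ =
      sb [⊥, ⊤] g * sb [⊤, ⊤, ⊤, ⊤, ⊥] g⁻¹ := by
  have e1 := sb_conj (xt S * xt S) [⊥, ⊤] [⊥, ⊤]
    (fun u => by simp [Equiv.Perm.mul_apply, xt_b]) g
  have e2 := sb_conj (xt S * xt S) [⊤, ⊤, ⊥] [⊤, ⊤, ⊤, ⊤, ⊥]
    (fun u => by simp [Equiv.Perm.mul_apply, xt_t, xp_t]) g⁻¹
  have e3 : xt S * xt S * bet g * (xt S * xt S)⁻¹ =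
      (xt S * xt S * sb [⊥, ⊤] g * (xt S * xt S)⁻¹) *
        (xt S * xt S * sb [⊤, ⊤, ⊥] g⁻¹ * (xt S * xt S)⁻¹) := by
    rw [bet]; group
  rw [e3, e1, e2]

theorem bet_commutator (g : Equiv.Perm (Str S)) :
    xp S * xp S * bet g * (xp S * xp S)⁻¹ =
      (bet g)⁻¹ * (xt S * xt S * bet g * (xt S * xt S)⁻¹) := by
  rw [eq_inv_mul_iff_mul_eq, xx_bet, tt_bet, bet, map_inv, map_inv]
  group

/-- the element `x` on the cone `⊥⊤` -/
noncomputable def xm (S : Type*) [LinearOrder S] [BoundedOrder S] [Nontrivial S] :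
    Equiv.Perm (Str S) := sb [⊥, ⊤] (xp S)

theorem xm_r : ((xp S)⁻¹ * (xt S)⁻¹ * xp S) * xm S * ((xp S)⁻¹ * (xt S)⁻¹ * xp S)⁻¹ =
    sb [⊥, ⊤, ⊥] (xp S) :=
  sb_conj _ _ _ (fun u => by
    simp [Equiv.Perm.mul_apply, xp_bt, xt_inv_t, xp_inv_n, xp_inv_tb]) _

theorem xm_s : ((xp S)⁻¹ * (xt S)⁻¹ * (xp S * xp S)) * xm S *
    ((xp S)⁻¹ * (xt S)⁻¹ * (xp S * xp S))⁻¹ = sb [⊥, ⊤, ⊤] (xp S) :=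
  sb_conj _ _ _ (fun u => by
    simp [Equiv.Perm.mul_apply, xp_bt, xp_t, xt_inv_t, xp_inv_n, xp_inv_tb]) _

theorem comm_of_pent {G : Type*} [Group G] (X s r A B : G) (hp : X * X = A * X * B)
    (hA : s * X * s⁻¹ = A) (hB : r * X * r⁻¹ = B) :
    X = (X * X)⁻¹ * (s * X * s⁻¹ * X⁻¹)⁻¹ * (X * X) * (X⁻¹ * r * X * r⁻¹)⁻¹ := by
  subst hA hB
  have h1 : X⁻¹ * (s * X * s⁻¹) * X * (r * X * r⁻¹) = X := by
    have : X⁻¹ * (s * X * s⁻¹ * X * (r * X * r⁻¹)) = X⁻¹ * (X * X) := by rw [hp]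
    rw [inv_mul_cancel_left] at this
    simp only [mul_assoc] at this ⊢
    exact this
  rw [eq_mul_inv_iff_mul_eq, mul_assoc _ _ (X * X), eq_comm, mul_assoc, inv_mul_eq_iff_eq_mul,
    inv_mul_eq_iff_eq_mul]
  calc X * X = X * (X⁻¹ * (s * X * s⁻¹) * X * (r * X * r⁻¹)) := by rw [h1]
    _ = s * X * s⁻¹ * X⁻¹ * (X * X * (r * X * r⁻¹)) := by group
    _ = _ := by group

theorem xm_comm (S : Type*) [LinearOrder S] [BoundedOrder S] [Nontrivial S] :
    ∃ s r : Equiv.Perm (Str S),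
    s = ((xp S)⁻¹ * (xt S)⁻¹ * (xp S * xp S)) ∧ r = ((xp S)⁻¹ * (xt S)⁻¹ * xp S) ∧
    xm S = (xm S * xm S)⁻¹ * (s * xm S * s⁻¹ * (xm S)⁻¹)⁻¹ * (xm S * xm S) *
      ((xm S)⁻¹ * r * xm S * r⁻¹)⁻¹ := by
  refine ⟨_, _, rfl, rfl, comm_of_pent _ _ _ _ _ ?_ xm_s xm_r⟩
  have h := congrArg (sb [⊥, ⊤]) (pentagon (S := S))
  simp only [map_mul] at h
  rw [← sb_one, ← sb_one] at h
  rw [sb_sb, sb_sb] at h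
  exact h

end Cones

/-! ### Letters -/
section Letters
variable (K : Type*) [Group K] [LinearOrder K]

/-- The alphabet: an interval of `Bool × K`. -/
def Ltr : Type _ :=
  {p : Bool ×ₗ K // ((ofLex p).1 = false → 1 ≤ (ofLex p).2) ∧ ((ofLex p).1 = true → (ofLex p).2 ≤ 1)}

noncomputable instance : LinearOrder (Ltr K) :=
  inferInstanceAs (LinearOrder (Subtype _))

variable {K}

/-- letter with given bit and (clamped) coordinate -/
noncomputable def ltr (b : Bool) (k : K) : Ltr K :=
  ⟨toLex (b, if b then min k 1 else max k 1), by
    cases b <;> simp⟩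

/-- bit of a letter -/
def bit (s : Ltr K) : Bool := (ofLex s.1).1
/-- coordinate of a letter -/
def kk (s : Ltr K) : K := (ofLex s.1).2

@[simp] theorem bit_ltr (b : Bool) (k : K) : bit (ltr b k) = b := rfl
theorem kk_ltr_f (k : K) : kk (ltr false k) = max k 1 := rfl
theorem kk_ltr_t (k : K) : kk (ltr true k) = min k 1 := rfl

theorem ltr_ext {s t : Ltr K} (h1 : bit s = bit t) (h2 : kk s = kk t) : s = t :=
  Subtype.ext (Prod.ext h1 h2)

theorem one_le_kk {s : Ltr K} (h : bit s = false) : 1 ≤ kk s := s.2.1 h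
theorem kk_le_one {s : Ltr K} (h : bit s = true) : kk s ≤ 1 := s.2.2 h

theorem ltr_bit_kk (s : Ltr K) : ltr (bit s) (kk s) = s := by
  apply ltr_ext
  · rfl
  · cases h : bit s
    · rw [kk_ltr_f, max_eq_left (one_le_kk h)]
    · rw [kk_ltr_t, min_eq_left (kk_le_one h)]

theorem ltr_lt {s t : Ltr K} : s < t ↔ bit s < bit t ∨ bit s = bit t ∧ kk s < kk t :=
  Prod.Lex.lt_iff

theorem ltr_le {s t : Ltr K} : s ≤ t ↔ bit s < bit t ∨ bit s = bit t ∧ kk s ≤ kk t :=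
  Prod.Lex.le_iff

noncomputable instance : BoundedOrder (Ltr K) where
  bot := ltr false 1
  bot_le s := by
    rw [ltr_le]
    cases h : bit s
    · right; simp [kk_ltr_f, one_le_kk h]
    · left; simp
  top := ltr true 1
  le_top s := by
    rw [ltr_le]
    cases h : bit s
    · left; simp
    · right; simp [kk_ltr_t, kk_le_one h]

theorem bot_def : (⊥ : Ltr K) = ltr false 1 := rfl
theorem top_def : (⊤ : Ltr K) = ltr true 1 := rfl
@[simp] theorem bit_bot : bit (⊥ : Ltr K) = false := rfl
@[simp] theorem bit_top : bit (⊤ : Ltr K) = true := rfl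
@[simp] theorem kk_bot : kk (⊥ : Ltr K) = 1 := by rw [bot_def, kk_ltr_f, max_self]
@[simp] theorem kk_top : kk (⊤ : Ltr K) = 1 := by rw [top_def, kk_ltr_t, min_self]

instance : Nontrivial (Ltr K) := ⟨⟨⊥, ⊤, by intro h; simpa using congrArg bit h⟩⟩

theorem ltr_f_of_le {k : K} (h : k ≤ 1) : ltr false k = ⊥ := by
  apply ltr_ext <;> simp [kk_ltr_f, h]
theorem ltr_t_of_le {k : K} (h : 1 ≤ k) : ltr true k = ⊤ := by
  apply ltr_ext <;> simp [kk_ltr_t, h]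
theorem ltr_f_ne {k : K} (h : 1 < k) : ltr false k ≠ ⊥ := by
  intro e
  have := congrArg kk e
  rw [kk_ltr_f, kk_bot, max_eq_left h.le] at this
  exact h.ne' this
theorem ltr_t_ne {k : K} (h : k < 1) : ltr true k ≠ ⊤ := by
  intro e
  have := congrArg kk e
  rw [kk_ltr_t, kk_top, min_eq_left h.le] at this
  exact h.ne this
theorem ltr_f_ne_top (k : K) : ltr false k ≠ ⊤ := fun e => by simpa using congrArg bit e
theorem ltr_t_ne_bot (k : K) : ltr true k ≠ ⊥ := fun e => by simpa using congrArg bit e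

/-- block embedding of `K × Str` into `Str` -/
noncomputable def bl (p : K × Str (Ltr K)) : Str (Ltr K) :=
  if p.1 < 1 then cons (ltr true p.1) p.2 else cons ⊤ (cons (ltr false p.1) p.2)

theorem bl_neg {k : K} (h : k < 1) (u : Str (Ltr K)) : bl (k, u) = cons (ltr true k) u := by
  simp [bl, h]
theorem bl_nonneg {k : K} (h : 1 ≤ k) (u : Str (Ltr K)) :
    bl (k, u) = cons ⊤ (cons (ltr false k) u) := by
  simp [bl, not_lt.2 h]

theorem bl_lt {p q : K × Str (Ltr K)} : bl p < bl q ↔ p.1 < q.1 ∨ p.1 = q.1 ∧ p.2 < q.2 := by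
  obtain ⟨k, u⟩ := p
  obtain ⟨k', u'⟩ := q
  rcases lt_or_ge k 1 with h | h <;> rcases lt_or_ge k' 1 with h' | h'
  · rw [bl_neg h, bl_neg h', cons_lt, ltr_lt]
    simp [kk_ltr_t, h.le, h'.le]
    constructor
    · rintro (a | ⟨a, b⟩)
      · exact Or.inl a
      · refine Or.inr ⟨?_, b⟩
        simpa [kk_ltr_t, h.le, h'.le] using congrArg kk a
    · rintro (a | ⟨rfl, b⟩)
      · exact Or.inl a
      · exact Or.inr ⟨rfl, b⟩
  · rw [bl_neg h, bl_nonneg h', cons_lt]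
    constructor
    · intro _; exact Or.inl (lt_of_lt_of_le h h')
    · intro _; exact Or.inl (lt_top_iff_ne_top.2 (ltr_t_ne h))
  · rw [bl_nonneg h, bl_neg h', cons_lt]
    constructor
    · rintro (a | ⟨a, _⟩)
      · exact absurd a not_top_lt
      · exact absurd a.symm (ltr_t_ne h')
    · rintro (a | ⟨a, _⟩)
      · exact absurd (lt_of_le_of_lt h a) (not_lt.2 h'.le)
      · simp only at a
        exact absurd (lt_of_le_of_lt (a ▸ h) h') (lt_irrefl _)
  · rw [bl_nonneg h, bl_nonneg h', cons_lt, cons_lt]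
    have hbb : ltr false k < ltr false k' ↔ k < k' := by
      rw [ltr_lt]
      simp [kk_ltr_f, h, h']
    simp only [lt_irrefl, hbb, true_and, false_or]
    constructor
    · rintro (a | ⟨a, b⟩)
      · exact Or.inl a
      · refine Or.inr ⟨?_, b⟩
        simpa [kk_ltr_f, h, h'] using congrArg kk a
    · rintro (a | ⟨rfl, b⟩)
      · exact Or.inl a
      · exact Or.inr ⟨rfl, b⟩

theorem bl_injective : Function.Injective (bl : K × Str (Ltr K) → Str (Ltr K)) := by
  intro p q h
  have h1 : ¬ bl p < bl q := by rw [h]; exact lt_irrefl _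
  have h2 : ¬ bl q < bl p := by rw [h]; exact lt_irrefl _
  rw [bl_lt] at h1 h2
  push Not at h1 h2
  have e1 : p.1 = q.1 := le_antisymm h2.1 h1.1
  exact Prod.ext e1 (le_antisymm (h2.2 e1.symm) (h1.2 e1))

/-- left translation on the first coordinate -/
def tra {U : Type*} : K →* Equiv.Perm (K × U) where
  toFun a := (Equiv.mulLeft a).prodCongr (Equiv.refl _)
  map_one' := by ext p <;> simp
  map_mul' a b := by ext p <;> simp [mul_assoc]

theorem tra_apply {U : Type*} (a k : K) (u : U) : tra a (k, u) = (a * k, u) := rfl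

/-- translations on blocks -/
noncomputable def TT : K →* Equiv.Perm (Str (Ltr K)) := (lft bl bl_injective).comp tra

theorem TT_bl (a k : K) (u : Str (Ltr K)) : TT a (bl (k, u)) = bl (a * k, u) :=
  lft_apply bl bl_injective _ _

theorem TT_notMem (a : K) (v : Str (Ltr K)) (h : ∀ p, bl p ≠ v) : TT a v = v :=
  lft_notMem bl bl_injective _ _ h

theorem bl_ne_left {v : Str (Ltr K)} (h : bit (hd v) = false) (p : K × Str (Ltr K)) : bl p ≠ v := by
  rintro rfl
  obtain ⟨k, u⟩ := p
  rcases lt_or_ge k 1 with h' | h'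
  · rw [bl_neg h'] at h; simp at h
  · rw [bl_nonneg h'] at h; simp at h

theorem bl_ne_right {v : Str (Ltr K)} (h : bit (hd v) = true) (p : K × Str (Ltr K)) :
    bl p ≠ cons ⊤ v := by
  intro e
  obtain ⟨k, u⟩ := p
  rcases lt_or_ge k 1 with h' | h'
  · rw [bl_neg h', cons_inj] at e; exact ltr_t_ne h' e.1
  · rw [bl_nonneg h', cons_inj] at e
    rw [← e.2] at h; simp at h

theorem bl_cases (v : Str (Ltr K)) : bit (hd v) = false ∨ (∃ p, bl p = v) ∨
    (∃ v', bit (hd v') = true ∧ v = cons ⊤ v') := by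
  obtain ⟨s, v, rfl⟩ := exists_cons v
  cases hs : bit s
  · left; simpa
  · right
    by_cases hs1 : kk s < 1
    · left
      refine ⟨(kk s, v), ?_⟩
      rw [bl_neg hs1, ← hs, ltr_bit_kk]
    · have hs' : s = ⊤ := ltr_ext (by simpa) (by
        rw [kk_top]; exact le_antisymm (kk_le_one hs) (not_lt.1 hs1))
      subst hs'
      obtain ⟨t, v, rfl⟩ := exists_cons v
      cases ht : bit t
      · left
        refine ⟨(kk t, v), ?_⟩
        rw [bl_nonneg (one_le_kk ht), ← ht, ltr_bit_kk]
      · right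
        exact ⟨_, by simpa, rfl⟩

open Classical in
/-- three-valued index, detecting blocks -/
noncomputable def blI (v : Str (Ltr K)) : ℕ :=
  if bit (hd v) = false then 0 else if ∃ p, bl p = v then 1 else 2

theorem blI_mono : Monotone (blI : Str (Ltr K) → ℕ) := by
  intro u v h
  unfold blI
  have hh := hd_mono h
  by_cases hu : bit (hd u) = false
  · simp [hu]
  · have hv : ¬ bit (hd v) = false := by
      intro e
      rw [ltr_le] at hh
      rw [e] at hh
      rcases hh with hh | hh
      · revert hh; cases bit (hd u) <;> simp
      · exact hu hh.1
    simp only [hu, hv, if_false]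
    by_cases hu' : ∃ p, bl p = u
    · simp [hu']; split_ifs <;> simp
    · by_cases hv' : ∃ p, bl p = v
      · exfalso
        rcases bl_cases u with h1 | h1 | ⟨u', h1, rfl⟩
        · exact hu h1
        · exact hu' h1
        · obtain ⟨⟨k, w⟩, rfl⟩ := hv'
          rcases lt_or_ge k 1 with h' | h'
          · rw [bl_neg h'] at hh
            simp at hh
            exact ltr_t_ne h' hh
          · rw [bl_nonneg h'] at h
            rcases h.lt_or_eq with h | h
            · rw [cons_lt] at h
              simp at h
              have := hd_mono h.le
              rw [hd_cons, ltr_le] at this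
              rw [h1, bit_ltr] at this
              revert this; simp
            · simp at h
              rw [h] at h1
              simp at h1
      · simp [hu', hv']

theorem TT_strictMono [MulLeftStrictMono K] (a : K) : StrictMono (TT a) := by
  have hb : ∀ p : K × Str (Ltr K), blI (bl p) = 1 := by
    intro p
    have : ¬ bit (hd (bl p)) = false := fun h => bl_ne_left h p rfl
    simp [blI, this]
  apply lft_strictMono blI blI_mono
  · intro p; rw [hb, hb]
  · rintro ⟨k, u⟩ ⟨k', u'⟩ _ h
    rw [bl_lt] at h ⊢
    simpa [tra] using h
  · intro p b h
    rw [hb] at h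
    unfold blI at h
    split_ifs at h with h1 h2
    · exact h2
    · omega

end Letters
end SimpEmb

set_option linter.unusedSectionVars false
set_option linter.unusedSimpArgs false
namespace SimpEmb
/-! ### The space `Om`, cells and windows -/
section Omega
variable (K : Type*) [Group K] [LinearOrder K]

/-- The ordered set on which the simple group acts. -/
def Om : Type _ := ℤ ×ₗ (K ×ₗ Str (Ltr K))

noncomputable instance : LinearOrder (Om K) :=
  inferInstanceAs (LinearOrder (ℤ ×ₗ (K ×ₗ Str (Ltr K))))

variable {K}

/-- points of `Om` -/
def pt (i : ℤ) (k : K) (u : Str (Ltr K)) : Om K := toLex (i, toLex (k, u))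

theorem pt_cases (p : Om K) : ∃ i k u, p = pt i k u := ⟨_, _, _, rfl⟩

theorem pt_inj {i i' : ℤ} {k k' : K} {u u' : Str (Ltr K)} :
    pt i k u = pt i' k' u' ↔ i = i' ∧ k = k' ∧ u = u' := by
  constructor
  · intro h
    have h1 := congrArg (fun p : Om K => (ofLex p).1) h
    have h2 := congrArg (fun p : Om K => (ofLex (ofLex p).2).1) h
    have h3 := congrArg (fun p : Om K => (ofLex (ofLex p).2).2) h
    exact ⟨h1, h2, h3⟩
  · rintro ⟨rfl, rfl, rfl⟩; rfl

theorem pt_lt {i i' : ℤ} {k k' : K} {u u' : Str (Ltr K)} :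
    pt i k u < pt i' k' u' ↔ i < i' ∨ i = i' ∧ (k < k' ∨ k = k' ∧ u < u') := by
  have h1 : pt i k u < pt i' k' u' ↔ i < i' ∨ i = i' ∧ (toLex (k, u) : K ×ₗ Str (Ltr K)) < toLex (k', u') :=
    Prod.Lex.lt_iff
  rw [h1, Prod.Lex.lt_iff]
  rfl

/-- cell embedding -/
def ce (E : Set ℤ) (p : E × Str (Ltr K)) : Om K := pt p.1 1 p.2

theorem ce_injective (E : Set ℤ) : Function.Injective (ce E : E × Str (Ltr K) → Om K) := by
  rintro ⟨a, u⟩ ⟨b, v⟩ h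
  simp only [ce, pt_inj] at h
  exact Prod.ext (Subtype.ext h.1) h.2.2

/-- act fibrewise in the second factor -/
def sndHom (A U : Type*) : Equiv.Perm U →* Equiv.Perm (A × U) where
  toFun g := (Equiv.refl A).prodCongr g
  map_one' := by ext p <;> simp
  map_mul' a b := by ext p <;> simp

theorem sndHom_apply {A U : Type*} (g : Equiv.Perm U) (a : A) (u : U) :
    sndHom A U g (a, u) = (a, g u) := rfl

/-- act by `g` on the cells with index in `E` -/
noncomputable def cell (E : Set ℤ) : Equiv.Perm (Str (Ltr K)) →* Equiv.Perm (Om K) :=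
  (lft (ce E) (ce_injective E)).comp (sndHom E _)

theorem cell_in {E : Set ℤ} (g : Equiv.Perm (Str (Ltr K))) {i : ℤ} (hi : i ∈ E) (u : Str (Ltr K)) :
    cell E g (pt i 1 u) = pt i 1 (g u) :=
  lft_apply (ce E) (ce_injective E) (sndHom E _ g) (⟨i, hi⟩, u)

theorem cell_out {E : Set ℤ} (g : Equiv.Perm (Str (Ltr K))) {i : ℤ} {k : K}
    (h : ¬ (i ∈ E ∧ k = 1)) (u : Str (Ltr K)) :
    cell E g (pt i k u) = pt i k u := by
  apply lft_notMem
  rintro ⟨⟨j, hj⟩, v⟩ e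
  simp only [ce, pt_inj] at e
  exact h ⟨e.1 ▸ hj, e.2.1.symm⟩

theorem cell_ext {E : Set ℤ} {g : Equiv.Perm (Str (Ltr K))} {f : Equiv.Perm (Om K)}
    (h1 : ∀ i ∈ E, ∀ u, f (pt i 1 u) = pt i 1 (g u))
    (h2 : ∀ i k u, ¬ (i ∈ E ∧ k = 1) → f (pt i k u) = pt i k u) : f = cell E g := by
  ext p
  obtain ⟨i, k, u, rfl⟩ := pt_cases p
  by_cases h : i ∈ E ∧ k = 1
  · obtain ⟨hi, rfl⟩ := h
    rw [h1 i hi, cell_in g hi]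
  · rw [h2 i k u h, cell_out g h]

theorem cell_conj {E E' : Set ℤ} (d : ℤ) (w : List (Ltr K)) (f : Equiv.Perm (Om K))
    (hE : ∀ j, j ∈ E' ↔ j - d ∈ E)
    (hf : ∀ i ∈ E, ∀ u, f (pt i 1 u) = pt (i + d) 1 (pre w u)) (g : Equiv.Perm (Str (Ltr K))) :
    f * cell E g * f⁻¹ = cell E' (sb w g) := by
  have hf' : ∀ i ∈ E', ∀ u, f⁻¹ (pt i 1 (pre w u)) = pt (i - d) 1 u := by
    intro i hi u
    rw [Equiv.Perm.inv_eq_iff_eq, hf _ ((hE i).1 hi), sub_add_cancel]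
  apply cell_ext
  · intro i hi u
    by_cases hu : ∃ v, pre w v = u
    · obtain ⟨v, rfl⟩ := hu
      rw [Equiv.Perm.mul_apply, Equiv.Perm.mul_apply, hf' i hi, cell_in _ ((hE i).1 hi),
        hf _ ((hE i).1 hi), sub_add_cancel, sb_pre]
    · have : sb w g u = u := lft_notMem _ _ _ _ (by intro a ha; exact hu ⟨a, ha⟩)
      rw [this]
      rw [Equiv.Perm.mul_apply, Equiv.Perm.mul_apply]
      rw [← Equiv.Perm.eq_inv_iff_eq]
      obtain ⟨j, k, v, hj⟩ := pt_cases (f⁻¹ (pt i 1 u))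
      rw [hj]
      apply cell_out
      rintro ⟨hjE, rfl⟩
      rw [Equiv.Perm.inv_eq_iff_eq, hf _ hjE, pt_inj] at hj
      exact hu ⟨v, hj.2.2.symm⟩
  · intro i k u hik
    rw [Equiv.Perm.mul_apply, Equiv.Perm.mul_apply, ← Equiv.Perm.eq_inv_iff_eq]
    obtain ⟨j, k', v, hj⟩ := pt_cases (f⁻¹ (pt i k u))
    rw [hj]
    apply cell_out
    rintro ⟨hjE, rfl⟩
    rw [Equiv.Perm.inv_eq_iff_eq, hf _ hjE, pt_inj] at hj
    apply hik
    refine ⟨(hE i).2 ?_, hj.2.1⟩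
    rw [hj.1, add_sub_cancel_right]; exact hjE

theorem cell_strictMono (E : Set ℤ) (g : Equiv.Perm (Str (Ltr K))) (hg : StrictMono g) :
    StrictMono (cell E g) := by
  have hI : Monotone (fun p : Om K => (toLex ((ofLex p).1, (ofLex (ofLex p).2).1) : ℤ ×ₗ K)) := by
    intro p q h
    obtain ⟨i, k, u, rfl⟩ := pt_cases p
    obtain ⟨i', k', u', rfl⟩ := pt_cases q
    rcases h.lt_or_eq with h | h
    · rw [pt_lt] at h
      show (toLex (i, k) : ℤ ×ₗ K) ≤ toLex (i', k')
      rw [Prod.Lex.le_iff]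
      rcases h with h | ⟨h, h' | h'⟩
      · exact Or.inl h
      · exact Or.inr ⟨h, h'.le⟩
      · exact Or.inr ⟨h, h'.1.le⟩
    · rw [h]
  apply lft_strictMono _ hI
  · rintro ⟨j, u⟩; rfl
  · rintro ⟨j, u⟩ ⟨j', u'⟩ _ h
    simp only [ce, pt_lt, sndHom_apply, hg.lt_iff_lt] at h ⊢
    exact h
  · rintro ⟨j, u⟩ b h
    obtain ⟨i', k', u', rfl⟩ := pt_cases b
    have h' : (j : ℤ) = i' ∧ 1 = k' := Prod.ext_iff.1 h
    obtain ⟨h1, rfl⟩ := h'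
    exact ⟨(j, u'), by simp [ce, h1]⟩

/-! Windows -/

/-- parity classes: `par false` are the even integers, `par true` the odd ones -/
def par (b : Bool) : Set ℤ := {j | j % 2 = if b then 1 else 0}

theorem mem_par_succ {b : Bool} {j : ℤ} : j + 1 ∈ par b ↔ j ∉ par b := by
  simp only [par, Set.mem_ofPred_eq]; cases b <;> simp <;> omega
theorem mem_par_not {b : Bool} {j : ℤ} : j ∈ par (!b) ↔ j ∉ par b := by
  simp only [par, Set.mem_ofPred_eq]; cases b <;> simp
theorem mem_par_succ' {b : Bool} {j : ℤ} : j + 1 ∈ par (!b) ↔ j ∈ par b := by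
  rw [mem_par_not, mem_par_succ, not_not]
theorem mem_par_pred {b : Bool} {j : ℤ} : j - 1 ∈ par b ↔ j ∉ par b := by
  simp only [par, Set.mem_ofPred_eq]; cases b <;> simp <;> omega

/-- window embedding -/
def wi (j : ℤ) (p : Str (Ltr K)) : Om K :=
  pt (j + if bit (hd p) then 1 else 0) (kk (hd p)) (tl p)

theorem wi_cons (j : ℤ) (s : Ltr K) (u : Str (Ltr K)) :
    wi j (cons s u) = pt (j + if bit s then 1 else 0) (kk s) u := rfl
theorem wi_f {k : K} (h : 1 ≤ k) (j : ℤ) (u : Str (Ltr K)) :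
    wi j (cons (ltr false k) u) = pt j k u := by
  simp [wi_cons, kk_ltr_f, h]
theorem wi_t {k : K} (h : k ≤ 1) (j : ℤ) (u : Str (Ltr K)) :
    wi j (cons (ltr true k) u) = pt (j + 1) k u := by
  simp [wi_cons, kk_ltr_t, h]
theorem wi_bot (j : ℤ) (u : Str (Ltr K)) : wi j (cons ⊥ u) = pt j 1 u := wi_f le_rfl j u
theorem wi_top (j : ℤ) (u : Str (Ltr K)) : wi j (cons ⊤ u) = pt (j + 1) 1 u := wi_t le_rfl j u

theorem wi_lt {j : ℤ} {p q : Str (Ltr K)} : wi j p < wi j q ↔ p < q := by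
  obtain ⟨s, u, rfl⟩ := exists_cons p
  obtain ⟨t, v, rfl⟩ := exists_cons q
  rw [wi_cons, wi_cons, pt_lt, cons_lt, ltr_lt]
  have hk : bit s = bit t → (kk s = kk t ↔ s = t) := fun h => ⟨ltr_ext h, fun h => by rw [h]⟩
  cases hs : bit s <;> cases ht : bit t <;> simp
  · rw [hk (hs.trans ht.symm)]
  · rintro rfl; rw [hs] at ht; cases ht
  · rw [hk (hs.trans ht.symm)]

theorem wi_inj {j : ℤ} {p q : Str (Ltr K)} (h : wi j p = wi j q) : p = q := by
  rcases lt_trichotomy p q with h' | h' | h'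
  · exact absurd (wi_lt.2 h') (by rw [h]; exact lt_irrefl _)
  · exact h'
  · exact absurd (wi_lt.2 h') (by rw [h]; exact lt_irrefl _)

/-- window embedding for all windows of given parity -/
def we (b : Bool) (p : par b × Str (Ltr K)) : Om K := wi p.1 p.2

open Classical in
/-- window index -/
noncomputable def wx (b : Bool) (p : Om K) : ℤ :=
  if 1 < (ofLex (ofLex p).2).1 then (ofLex p).1
  else if (ofLex (ofLex p).2).1 < 1 then (ofLex p).1 - 1
  else if (ofLex p).1 ∈ par b then (ofLex p).1 else (ofLex p).1 - 1

open Classical in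
theorem wx_pt (b : Bool) (i : ℤ) (k : K) (u : Str (Ltr K)) : wx b (pt i k u) =
    if 1 < k then i else if k < 1 then i - 1 else if i ∈ par b then i else i - 1 := rfl

theorem wx_wi {b : Bool} {j : ℤ} (hj : j ∈ par b) (p : Str (Ltr K)) : wx b (wi j p) = j := by
  obtain ⟨s, u, rfl⟩ := exists_cons p
  rw [wi_cons, wx_pt]
  cases hs : bit s
  · have := one_le_kk hs
    rcases this.lt_or_eq with h | h
    · simp [h]
    · simp [← h, hj]
  · have := kk_le_one hs
    have hj' : j + 1 ∉ par b := by rw [mem_par_succ]; simpa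
    rcases this.lt_or_eq with h | h
    · simp [h, h.le]
    · simp [h, hj']

theorem wx_mono (b : Bool) : Monotone (wx b : Om K → ℤ) := by
  intro p q h
  obtain ⟨i, k, u, rfl⟩ := pt_cases p
  obtain ⟨i', k', u', rfl⟩ := pt_cases q
  rcases h.lt_or_eq with h | h
  · rw [pt_lt] at h
    rw [wx_pt, wx_pt]
    rcases h with h | ⟨rfl, h2⟩
    · split_ifs <;> omega
    · have hk : k ≤ k' := by
        rcases h2 with h3 | h3
        · exact h3.le
        · exact h3.1.le
      split_ifs <;> first | omega | (exfalso; order)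
  · rw [h]

theorem exists_wi {b : Bool} (p : Om K) (h : wx b p ∈ par b) : ∃ q, wi (wx b p) q = p := by
  obtain ⟨i, k, u, rfl⟩ := pt_cases p
  rw [wx_pt] at *
  split_ifs at * with h1 h2 h3
  · exact ⟨_, wi_f h1.le i u⟩
  · exact ⟨_, by rw [wi_t h2.le, sub_add_cancel]⟩
  · have : k = 1 := by order
    subst this
    exact ⟨_, wi_bot i u⟩
  · have : k = 1 := by order
    subst this
    exact ⟨_, by rw [wi_top, sub_add_cancel]⟩

theorem we_injective (b : Bool) : Function.Injective (we b : par b × Str (Ltr K) → Om K) := by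
  rintro ⟨⟨j, hj⟩, p⟩ ⟨⟨j', hj'⟩, p'⟩ h
  simp only [we] at h
  have : j = j' := by rw [← wx_wi hj p, h, wx_wi hj' p']
  subst this
  rw [wi_inj h]

/-- act by `g` in all windows of parity `b` -/
noncomputable def win (b : Bool) : Equiv.Perm (Str (Ltr K)) →* Equiv.Perm (Om K) :=
  (lft (we b) (we_injective b)).comp (sndHom (par b) _)

theorem win_wi {b : Bool} {j : ℤ} (hj : j ∈ par b) (g : Equiv.Perm (Str (Ltr K)))
    (p : Str (Ltr K)) : win b g (wi j p) = wi j (g p) :=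
  lft_apply (we b) (we_injective b) (sndHom _ _ g) (⟨j, hj⟩, p)

theorem win_out {b : Bool} {p : Om K} (h : wx b p ∉ par b) (g : Equiv.Perm (Str (Ltr K))) :
    win b g p = p := by
  apply lft_notMem
  rintro ⟨⟨j, hj⟩, q⟩ rfl
  exact h (by rw [we, wx_wi hj]; exact hj)

theorem win_inv_wi {b : Bool} {j : ℤ} (hj : j ∈ par b) (g : Equiv.Perm (Str (Ltr K)))
    (p : Str (Ltr K)) : (win b g)⁻¹ (wi j p) = wi j (g⁻¹ p) := by
  rw [← map_inv, win_wi hj]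

theorem win_strictMono (b : Bool) (g : Equiv.Perm (Str (Ltr K))) (hg : StrictMono g) :
    StrictMono (win b g) := by
  apply lft_strictMono _ (wx_mono b)
  · rintro ⟨⟨j, hj⟩, p⟩
    simp only [we, sndHom_apply, wx_wi hj]
  · rintro ⟨⟨j, hj⟩, p⟩ ⟨⟨j', hj'⟩, p'⟩ h h'
    simp only [we, sndHom_apply, wx_wi hj, wx_wi hj'] at h h' ⊢
    subst h
    rw [wi_lt] at h' ⊢
    exact hg h'
  · rintro ⟨⟨j, hj⟩, p⟩ q h
    simp only [we, wx_wi hj] at h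
    obtain ⟨r, hr⟩ := exists_wi q (b := b) (by rw [← h]; exact hj)
    exact ⟨(⟨j, hj⟩, r), by simp only [we]; rw [h, hr]⟩

/-! the window maps -/

/-- window map of `x` -/
noncomputable def XX (K : Type*) [Group K] [LinearOrder K] (b : Bool) : Equiv.Perm (Om K) :=
  win b (xp (Ltr K))

theorem XX_inv_bot {b : Bool} {i : ℤ} (hi : i ∈ par b) (u : Str (Ltr K)) :
    (XX K b)⁻¹ (pt i 1 u) = pt i 1 (cons ⊥ u) := by
  rw [← wi_bot, ← wi_bot, XX, win_inv_wi hi, xp_inv_n bot_ne_top]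

theorem XX_bot {b : Bool} {i : ℤ} (hi : i ∈ par b) (u : Str (Ltr K)) :
    XX K b (pt i 1 (cons ⊥ u)) = pt i 1 u := by
  rw [← XX_inv_bot hi]; simp

theorem XX_top {b : Bool} {i : ℤ} (hi : i ∈ par b) (u : Str (Ltr K)) :
    XX K (!b) (pt i 1 u) = pt i 1 (cons ⊤ u) := by
  have hi' : i - 1 ∈ par (!b) := by rw [mem_par_pred, mem_par_not]; simpa
  have e : ∀ v : Str (Ltr K), pt i 1 v = wi (i - 1) (cons ⊤ v) := by
    intro v; rw [wi_top, sub_add_cancel]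
  rw [e, e, XX, win_wi hi', xp_t]

theorem XX_inv_top {b : Bool} {i : ℤ} (hi : i ∈ par b) (u : Str (Ltr K)) :
    (XX K (!b))⁻¹ (pt i 1 (cons ⊤ u)) = pt i 1 u := by
  rw [← XX_top hi]; simp

theorem XX_mid {b : Bool} {i : ℤ} (hi : i ∈ par b) {s : Ltr K} (hs : s ≠ ⊤) (u : Str (Ltr K)) :
    XX K b (pt i 1 (cons s u)) = pt (i + if bit s then 1 else 0) (kk s) u := by
  rw [← wi_bot, XX, win_wi hi, xp_apply_bcons s hs, wi_cons]

theorem XX_bt {b : Bool} {i : ℤ} (hi : i ∈ par b) (u : Str (Ltr K)) :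
    XX K b (pt i 1 (cons ⊤ u)) = pt (i + 1) 1 (cons ⊥ u) := by
  rw [← wi_bot, XX, win_wi hi, xp_bt, wi_top]

/-- shift element -/
noncomputable def shf (K : Type*) [Group K] [LinearOrder K] (b : Bool) : Equiv.Perm (Om K) :=
  XX K (!b) * XX K b * XX K (!b)

theorem shf_pt {b : Bool} {i : ℤ} (hi : i ∈ par b) (u : Str (Ltr K)) :
    shf K b (pt i 1 u) = pt (i + 1) 1 u := by
  rw [shf, Equiv.Perm.mul_apply, Equiv.Perm.mul_apply, XX_top hi, XX_bt hi,
    XX_bot (mem_par_succ'.2 hi)]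

theorem cell_conj_bot {b : Bool} {E : Set ℤ} (hE : E ⊆ par b) (g : Equiv.Perm (Str (Ltr K))) :
    (XX K b)⁻¹ * cell E g * XX K b = cell E (sub ⊥ g) := by
  have := cell_conj (E := E) (E' := E) 0 [⊥] (XX K b)⁻¹ (by simp)
    (fun i hi u => by rw [XX_inv_bot (hE hi)]; simp) g
  rwa [inv_inv, sb_one] at this

theorem cell_conj_top {b : Bool} {E : Set ℤ} (hE : E ⊆ par b) (g : Equiv.Perm (Str (Ltr K))) :
    XX K (!b) * cell E g * (XX K (!b))⁻¹ = cell E (sub ⊤ g) := by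
  have := cell_conj (E := E) (E' := E) 0 [⊤] (XX K (!b)) (by simp)
    (fun i hi u => by rw [XX_top (hE hi)]; simp) g
  rwa [sb_one] at this

theorem cell_conj_shf {b : Bool} {E E' : Set ℤ} (hE : E ⊆ par b) (h : ∀ j, j ∈ E' ↔ j - 1 ∈ E)
    (g : Equiv.Perm (Str (Ltr K))) :
    shf K b * cell E g * (shf K b)⁻¹ = cell E' g := by
  have := cell_conj (E := E) (E' := E') 1 [] (shf K b) h
    (fun i hi u => by rw [shf_pt (hE hi)]; simp) g
  rwa [sb_nil] at this

/-- unwrapping element for the translations -/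
noncomputable def phi (K : Type*) [Group K] [LinearOrder K] (b : Bool) : Equiv.Perm (Om K) :=
  XX K (!b) * XX K (!b) * XX K b * (XX K (!b))⁻¹ * XX K b

theorem phi_pt {b : Bool} {j : ℤ} (hj : j ∈ par b) (k : K) (u : Str (Ltr K)) :
    phi K b (pt j 1 (cons ⊥ (cons ⊤ (bl (k, u))))) = pt (j + 1) k u := by
  have hj1 : j + 1 ∈ par (!b) := mem_par_succ'.2 hj
  rw [phi]
  simp only [Equiv.Perm.mul_apply]
  rw [XX_bot hj, XX_inv_top hj]
  rcases lt_or_ge k 1 with h | h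
  · rw [bl_neg h, XX_mid hj (ltr_t_ne h)]
    have hw : wx (!b) (pt (j + 1) k u) ∉ par (!b) := by
      rw [wx_pt, if_neg (not_lt.2 h.le), if_pos h, add_sub_cancel_right, mem_par_not]
      simpa
    have e : XX K (!b) (pt (j + 1) k u) = pt (j + 1) k u := win_out hw _
    simp [kk_ltr_t, h.le, e]
  · rw [bl_nonneg h, XX_bt hj, XX_bot hj1, XX_mid hj1 (ltr_f_ne_top k)]
    simp [kk_ltr_f, h]

/-- translation embedding -/
def te (b : Bool) (p : par b × (K × Str (Ltr K))) : Om K := pt p.1 p.2.1 p.2.2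

theorem te_injective (b : Bool) : Function.Injective (te b : par b × (K × Str (Ltr K)) → Om K) := by
  rintro ⟨⟨i, hi⟩, k, u⟩ ⟨⟨j, hj⟩, l, v⟩ h
  simp only [te, pt_inj] at h
  obtain ⟨rfl, rfl, rfl⟩ := h
  rfl

/-- translations of all top-level coordinates of parity `b` -/
noncomputable def tau (b : Bool) : K →* Equiv.Perm (Om K) :=
  ((lft (te b) (te_injective b)).comp (sndHom _ _)).comp tra

theorem tau_in {b : Bool} {i : ℤ} (hi : i ∈ par b) (a k : K) (u : Str (Ltr K)) :
    tau b a (pt i k u) = pt i (a * k) u :=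
  lft_apply (te b) (te_injective b) (sndHom _ _ (tra a)) (⟨i, hi⟩, (k, u))

theorem tau_out {b : Bool} {i : ℤ} (hi : i ∉ par b) (a k : K) (u : Str (Ltr K)) :
    tau b a (pt i k u) = pt i k u := by
  apply lft_notMem
  rintro ⟨⟨j, hj⟩, l, v⟩ h
  simp only [te, pt_inj] at h
  exact hi (h.1 ▸ hj)

theorem phi_conj (b : Bool) (a : K) :
    phi K b * cell (par b) (sb [⊥, ⊤] (TT a)) * (phi K b)⁻¹ = tau (!b) a := by
  ext p
  obtain ⟨i, k, u, rfl⟩ := pt_cases p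
  by_cases hi : i ∈ par (!b)
  · have hj : i - 1 ∈ par b := by rw [mem_par_pred]; exact mem_par_not.1 hi
    have e : ∀ k, pt i k u = phi K b (pt (i - 1) 1 (cons ⊥ (cons ⊤ (bl (k, u))))) := by
      intro k; rw [phi_pt hj, sub_add_cancel]
    rw [tau_in hi, e, e]
    simp only [Equiv.Perm.mul_apply]
    rw [Equiv.Perm.inv_eq_iff_eq.2 rfl, cell_in _ hj]
    have := sb_pre [⊥, ⊤] (TT a) (bl (k, u))
    simp only [pre_cons, pre_nil] at this
    rw [this, TT_bl]
  · rw [tau_out hi]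
    simp only [Equiv.Perm.mul_apply]
    rw [← Equiv.Perm.eq_inv_iff_eq]
    obtain ⟨j, l, v, hj⟩ := pt_cases ((phi K b)⁻¹ (pt i k u))
    rw [hj]
    by_cases hjl : j ∈ par b ∧ l = 1
    · obtain ⟨hjb, rfl⟩ := hjl
      rw [cell_in _ hjb]
      congr 1
      by_cases hv : ∃ v', pre [⊥, ⊤] v' = v
      · obtain ⟨v', rfl⟩ := hv
        rw [sb_pre]
        congr 1
        apply TT_notMem
        rintro ⟨k', u'⟩ rfl
        simp only [pre_cons, pre_nil] at hj
        rw [Equiv.Perm.inv_eq_iff_eq, phi_pt hjb, pt_inj] at hj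
        exact hi (hj.1 ▸ mem_par_succ'.2 hjb)
      · exact lft_notMem _ _ _ _ (fun a ha => hv ⟨a, ha⟩)
    · rw [cell_out _ hjl]

end Omega
end SimpEmb

set_option linter.unusedSectionVars false
set_option linter.unusedSimpArgs false
namespace SimpEmb
/-! ### The group -/
section GroupH
variable {K : Type*} [Group K] [LinearOrder K]

/-- the generators, indexed by natural numbers -/
noncomputable def genN (Ap : Set ℤ) (y : ℕ → K) : ℕ → Equiv.Perm (Om K)
  | 0 => XX K false
  | 1 => XX K true
  | 2 => cell (par false) (xp (Ltr K))
  | 3 => cell (par true) (xp (Ltr K))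
  | 4 => cell Ap (xp (Ltr K))
  | n + 5 => cell (par false) (bet (TT (y n)))

/-- the group -/
noncomputable def HH (Ap : Set ℤ) (y : ℕ → K) (R : ℕ) : Subgroup (Equiv.Perm (Om K)) :=
  Subgroup.closure (Set.range (fun i : Fin (R + 5) => genN Ap y i))

variable {Ap : Set ℤ} {y : ℕ → K} {R : ℕ}

theorem genN_mem {n : ℕ} (h : n < R + 5) : genN Ap y n ∈ HH Ap y R :=
  Subgroup.subset_closure ⟨⟨n, h⟩, rfl⟩

theorem XX_mem (b : Bool) : XX K b ∈ HH Ap y R := by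
  cases b
  · exact genN_mem (n := 0) (by omega)
  · exact genN_mem (n := 1) (by omega)

theorem cpar_mem (b : Bool) : cell (par b) (xp (Ltr K)) ∈ HH Ap y R := by
  cases b
  · exact genN_mem (n := 2) (by omega)
  · exact genN_mem (n := 3) (by omega)

theorem cAp_mem : cell Ap (xp (Ltr K)) ∈ HH Ap y R := genN_mem (n := 4) (by omega)

theorem shf_mem (b : Bool) : shf K b ∈ HH Ap y R :=
  mul_mem (mul_mem (XX_mem _) (XX_mem _)) (XX_mem _)

theorem phi_mem (b : Bool) : phi K b ∈ HH Ap y R :=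
  mul_mem (mul_mem (mul_mem (mul_mem (XX_mem _) (XX_mem _)) (XX_mem _)) (inv_mem (XX_mem _)))
    (XX_mem _)

/-- `N` is normalized by the group -/
def Nrm (Ap : Set ℤ) (y : ℕ → K) (R : ℕ) (N : Subgroup (Equiv.Perm (Om K))) : Prop :=
  ∀ h ∈ HH Ap y R, ∀ n ∈ N, h * n * h⁻¹ ∈ N

theorem nrm_self : Nrm Ap y R (HH Ap y R) := fun _ hh _ hn => mul_mem (mul_mem hh hn) (inv_mem hh)

theorem Nrm.conj_iff {N : Subgroup (Equiv.Perm (Om K))} (hN : Nrm Ap y R N)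
    {h n : Equiv.Perm (Om K)} (hh : h ∈ HH Ap y R) : h * n * h⁻¹ ∈ N ↔ n ∈ N := by
  constructor
  · intro hn
    have := hN h⁻¹ (inv_mem hh) _ hn
    have e : h⁻¹ * (h * n * h⁻¹) * h⁻¹⁻¹ = n := by group
    rwa [e] at this
  · exact hN h hh n

theorem Nrm.conj_iff' {N : Subgroup (Equiv.Perm (Om K))} (hN : Nrm Ap y R N)
    {h n : Equiv.Perm (Om K)} (hh : h ∈ HH Ap y R) : h⁻¹ * n * h ∈ N ↔ n ∈ N := by
  have := hN.conj_iff (n := n) (inv_mem hh)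
  rwa [inv_inv] at this

theorem Nrm.comm_left {N : Subgroup (Equiv.Perm (Om K))} (hN : Nrm Ap y R N)
    {h n : Equiv.Perm (Om K)} (hh : h ∈ HH Ap y R) (hn : n ∈ N) : n * h * n⁻¹ * h⁻¹ ∈ N := by
  have := mul_mem hn (hN h hh _ (inv_mem hn))
  have e : n * (h * n⁻¹ * h⁻¹) = n * h * n⁻¹ * h⁻¹ := by group
  rwa [e] at this

section DD
variable {N : Subgroup (Equiv.Perm (Om K))} (hN : Nrm Ap y R N) {b : Bool} {E E' : Set ℤ}
include hN

theorem mem_sub_bot (hE : E ⊆ par b) (g : Equiv.Perm (Str (Ltr K))) :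
    cell E (sub ⊥ g) ∈ N ↔ cell E g ∈ N := by
  rw [← cell_conj_bot hE, hN.conj_iff' (XX_mem _)]

theorem mem_sub_top (hE : E ⊆ par b) (g : Equiv.Perm (Str (Ltr K))) :
    cell E (sub ⊤ g) ∈ N ↔ cell E g ∈ N := by
  rw [← cell_conj_top hE, hN.conj_iff (XX_mem _)]

theorem mem_xm (hE : E ⊆ par b) : cell E (xm (Ltr K)) ∈ N ↔ cell E (xp (Ltr K)) ∈ N := by
  rw [xm, ← sub_sb, ← sub_sb, sb_nil, mem_sub_bot hN hE, mem_sub_top hN hE]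

theorem mem_xt (hE : E ⊆ par b) : cell E (xt (Ltr K)) ∈ N ↔ cell E (xp (Ltr K)) ∈ N :=
  mem_sub_top hN hE _

/-- from commutators to `x` -/
theorem mem_of_comm (hE : E ⊆ par b) (hEH : cell E (xm (Ltr K)) ∈ HH Ap y R)
    (h1 : cell E (((xp (Ltr K))⁻¹ * (xt (Ltr K))⁻¹ * (xp (Ltr K) * xp (Ltr K))) * xm (Ltr K) *
      ((xp (Ltr K))⁻¹ * (xt (Ltr K))⁻¹ * (xp (Ltr K) * xp (Ltr K)))⁻¹ * (xm (Ltr K))⁻¹) ∈ N)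
    (h2 : cell E ((xm (Ltr K))⁻¹ * ((xp (Ltr K))⁻¹ * (xt (Ltr K))⁻¹ * xp (Ltr K)) *
      xm (Ltr K) * ((xp (Ltr K))⁻¹ * (xt (Ltr K))⁻¹ * xp (Ltr K))⁻¹) ∈ N) :
    cell E (xp (Ltr K)) ∈ N := by
  rw [← mem_xm hN hE]
  obtain ⟨s, r, hs, hr, h⟩ := xm_comm (Ltr K)
  rw [← hs] at h1
  rw [← hr] at h2
  rw [h, map_mul, map_inv (cell E) (_ * r * _ * _)]
  refine mul_mem ?_ (inv_mem h2)
  rw [map_mul, map_mul, map_inv, map_inv]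
  rw [hN.conj_iff']
  · exact inv_mem h1
  · rw [map_mul]; exact mul_mem hEH hEH

theorem mem_union_disj (h1 : cell E (xp (Ltr K)) ∈ N) (h2 : cell E' (xp (Ltr K)) ∈ N)
    (hd : Disjoint E E') : cell (E ∪ E') (xp (Ltr K)) ∈ N := by
  have : cell E (xp (Ltr K)) * cell E' (xp (Ltr K)) = cell (E ∪ E') (xp (Ltr K)) := by
    apply cell_ext
    · rintro i (hi | hi) u
      · have : i ∉ E' := fun h => Set.disjoint_left.1 hd hi h
        rw [Equiv.Perm.mul_apply, cell_out _ (by tauto), cell_in _ hi]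
      · have : i ∉ E := fun h => Set.disjoint_left.1 hd h hi
        rw [Equiv.Perm.mul_apply, cell_in _ hi, cell_out _ (by tauto)]
    · intro i k u h
      rw [Equiv.Perm.mul_apply, cell_out _ (by rw [Set.mem_union] at h; tauto),
        cell_out _ (by rw [Set.mem_union] at h; tauto)]
  rw [← this]
  exact mul_mem h1 h2

theorem mem_diff (h1 : cell E (xp (Ltr K)) ∈ N) (h2 : cell E' (xp (Ltr K)) ∈ N)
    (hd : E' ⊆ E) : cell (E \ E') (xp (Ltr K)) ∈ N := by
  have : cell E (xp (Ltr K)) * (cell E' (xp (Ltr K)))⁻¹ = cell (E \ E') (xp (Ltr K)) := by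
    rw [← map_inv]
    apply cell_ext
    · rintro i ⟨hi, hi'⟩ u
      rw [Equiv.Perm.mul_apply, cell_out _ (by tauto), cell_in _ hi]
    · intro i k u h
      rw [Equiv.Perm.mul_apply]
      by_cases hi : i ∈ E' ∧ k = 1
      · obtain ⟨hi, rfl⟩ := hi
        rw [cell_in _ hi, cell_in _ (hd hi)]; simp
      · rw [cell_out _ hi, cell_out _ (by rw [Set.mem_sdiff] at h; tauto)]
  rw [← this]
  exact mul_mem h1 (inv_mem h2)

theorem cell_comm_inter (g h : Equiv.Perm (Str (Ltr K))) :
    cell E g * cell E' h * (cell E g)⁻¹ * (cell E' h)⁻¹ = cell (E ∩ E') (g * h * g⁻¹ * h⁻¹) := by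
  rw [← map_inv, ← map_inv]
  apply cell_ext
  · rintro i ⟨hi, hi'⟩ u
    simp only [Equiv.Perm.mul_apply, cell_in _ hi, cell_in _ hi']
  · intro i k u h
    simp only [Equiv.Perm.mul_apply]
    by_cases hk : k = 1
    · subst hk
      by_cases h1 : i ∈ E
      · have h2 : ¬ (i ∈ E' ∧ (1 : K) = 1) := fun h2 => h ⟨⟨h1, h2.1⟩, rfl⟩
        rw [cell_out _ h2, cell_in _ h1, cell_out _ h2, cell_in _ h1]
        simp
      · have h1' : ¬ (i ∈ E ∧ (1 : K) = 1) := by tauto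
        by_cases h2 : i ∈ E'
        · rw [cell_in _ h2, cell_out _ h1', cell_in _ h2, cell_out _ h1']
          simp
        · have h2' : ¬ (i ∈ E' ∧ (1 : K) = 1) := by tauto
          rw [cell_out _ h2', cell_out _ h1', cell_out _ h2', cell_out _ h1']
    · have : ∀ E : Set ℤ, ¬ (i ∈ E ∧ k = 1) := by tauto
      rw [cell_out _ (this _), cell_out _ (this _), cell_out _ (this _), cell_out _ (this _)]

theorem mem_inter (hE : E ⊆ par b) (hE' : E' ⊆ par b) (h1 : cell E (xp (Ltr K)) ∈ N)
    (h2 : cell E' (xp (Ltr K)) ∈ HH Ap y R) : cell (E ∩ E') (xp (Ltr K)) ∈ N := by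
  have hH := nrm_self (Ap := Ap) (y := y) (R := R)
  have n1 := (mem_xm hN hE).2 h1
  have n2 := (mem_xt hN hE).2 h1
  have m1 := (mem_xm hH hE').2 h2
  have m2 := (mem_xt hH hE').2 h2
  have key : ∀ g h : Equiv.Perm (Str (Ltr K)), cell E g ∈ N → cell E' h ∈ HH Ap y R →
      cell (E ∩ E') (g * h * g⁻¹ * h⁻¹) ∈ N := by
    intro g h hg hh
    rw [← cell_comm_inter hN]
    exact hN.comm_left hh hg
  rw [← mem_xm hN (Set.inter_subset_left.trans hE)]
  obtain ⟨s, r, hs, hr, h⟩ := xm_comm (Ltr K)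
  have k1 := key s (xm (Ltr K)) (by
    rw [hs]; simp only [map_mul, map_inv]
    exact mul_mem (mul_mem (inv_mem h1) (inv_mem n2)) (mul_mem h1 h1)) m1
  have k2 := key (xm (Ltr K))⁻¹ r (by rw [map_inv]; exact inv_mem n1) (by
    rw [hr]; simp only [map_mul, map_inv]
    exact mul_mem (mul_mem (inv_mem h2) (inv_mem m2)) h2)
  rw [inv_inv] at k2
  rw [h, map_mul, map_inv (cell (E ∩ E')) (_ * r * _ * _)]
  refine mul_mem ?_ (inv_mem k2)
  have e : ∀ g, cell (E ∩ E') ((xm (Ltr K) * xm (Ltr K))⁻¹ * g * (xm (Ltr K) * xm (Ltr K))) =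
      (cell E' (xm (Ltr K) * xm (Ltr K)))⁻¹ * cell (E ∩ E') g *
        (cell E' (xm (Ltr K) * xm (Ltr K))) := by
    intro g
    symm
    rw [← map_inv]
    apply cell_ext
    · rintro i ⟨hi, hi'⟩ u
      simp only [Equiv.Perm.mul_apply, cell_in _ hi', cell_in _ (Set.mem_inter hi hi')]
    · intro i k u h
      simp only [Equiv.Perm.mul_apply]
      by_cases h2 : i ∈ E' ∧ k = 1
      · obtain ⟨h2, rfl⟩ := h2
        rw [cell_in _ h2, cell_out _ h, cell_in _ h2]; simp
      · rw [cell_out _ h2, cell_out _ h, cell_out _ h2]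
  rw [e, hN.conj_iff', map_inv]
  · exact inv_mem k1
  · rw [map_mul]; exact mul_mem m1 m1

theorem mem_shift_one (hE : E ⊆ par b) (h : ∀ j, j ∈ E' ↔ j - 1 ∈ E) (g : Equiv.Perm (Str (Ltr K))) :
    cell E' g ∈ N ↔ cell E g ∈ N := by
  rw [← cell_conj_shf hE h, hN.conj_iff (shf_mem _)]

theorem mem_empty (g : Equiv.Perm (Str (Ltr K))) : cell ∅ g ∈ N := by
  have : (1 : Equiv.Perm (Om K)) = cell ∅ g := cell_ext (by simp) (by simp)
  rw [← this]
  exact one_mem N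

/-- good sets: subsets of a parity class with `cell E x ∈ N` -/
theorem mem_shift (d : ℤ) (hE : E ⊆ par b) (h1 : cell E (xp (Ltr K)) ∈ N) :
    ∃ b', {j | j + d ∈ E} ⊆ par b' ∧ cell {j | j + d ∈ E} (xp (Ltr K)) ∈ N := by
  induction d using Int.induction_on with
  | zero => exact ⟨b, by simpa using hE, by simpa using h1⟩
  | succ i ih =>
    obtain ⟨b', h2, h3⟩ := ih
    have hs : {j | j + ((i : ℤ) + 1) ∈ E} ⊆ par (!b') := by
      intro j hj
      have : j + 1 ∈ par b' := h2 (by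
        show j + 1 + (i : ℤ) ∈ E
        have e : j + 1 + (i : ℤ) = j + ((i : ℤ) + 1) := by ring
        rw [e]; exact hj)
      rw [mem_par_not]; exact mem_par_succ.1 this
    refine ⟨!b', hs, (mem_shift_one hN hs ?_ _).1 h3⟩
    intro j
    show j + (i : ℤ) ∈ E ↔ j - 1 + ((i : ℤ) + 1) ∈ E
    have e : j - 1 + ((i : ℤ) + 1) = j + i := by ring
    rw [e]
  | pred i ih =>
    obtain ⟨b', h2, h3⟩ := ih
    have e' : ∀ j, j - 1 + (-(i : ℤ)) = j + (-(i : ℤ) - 1) := fun j => by ring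
    have hs : {j | j + (-(i : ℤ) - 1) ∈ E} ⊆ par (!b') := by
      intro j hj
      have : j - 1 ∈ par b' := h2 (by
        show j - 1 + (-(i : ℤ)) ∈ E
        rw [e']; exact hj)
      rw [mem_par_not]; exact mem_par_pred.1 this
    refine ⟨!b', hs, (mem_shift_one hN h2 ?_ _).2 h3⟩
    intro j
    show j + (-(i : ℤ) - 1) ∈ E ↔ j - 1 + (-(i : ℤ)) ∈ E
    rw [e']

end DD

/-! Translations -/

theorem w_comm (g g' : Equiv.Perm (Str (Ltr K))) :
    Commute (sb [⊥, ⊤] g) (sb [⊤, ⊤, ⊥] g') :=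
  sb_commute _ _ (by intro u v; simp [bot_ne_top]) _ _

theorem w_comm' (g g' : Equiv.Perm (Str (Ltr K))) :
    Commute (sb [⊥, ⊤] g) (sb [⊤, ⊤, ⊤, ⊥] g') :=
  sb_commute _ _ (by intro u v; simp [bot_ne_top]) _ _

theorem w_comm2 (g g' : Equiv.Perm (Str (Ltr K))) :
    Commute (sb [⊤, ⊤, ⊥] g) (sb [⊤, ⊤, ⊤, ⊥] g') :=
  sb_commute _ _ (by intro u v; simp [bot_ne_top]) _ _

theorem exists_partner (hy : Subgroup.closure (y '' {n | n < R}) = ⊤) (a : K) :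
    ∃ a', cell (par false) (sb [⊥, ⊤] (TT a) * sb [⊤, ⊤, ⊥] (TT a')) ∈ HH Ap y R := by
  have ha : a ∈ Subgroup.closure (y '' {n | n < R}) := by rw [hy]; trivial
  induction ha using Subgroup.closure_induction with
  | mem x hx =>
    obtain ⟨n, hn, rfl⟩ := hx
    refine ⟨(y n)⁻¹, ?_⟩
    have := genN_mem (Ap := Ap) (y := y) (R := R) (n := n + 5)
      (Nat.add_lt_add_right hn 5)
    rw [map_inv]
    exact this
  | one => exact ⟨1, by simp only [map_one, mul_one]; exact one_mem _⟩
  | mul a c _ _ iha ihc =>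
    obtain ⟨a', ha⟩ := iha
    obtain ⟨c', hc⟩ := ihc
    refine ⟨a' * c', ?_⟩
    have := mul_mem ha hc
    rw [← map_mul] at this
    have e : sb [⊥, ⊤] (TT a) * sb [⊤, ⊤, ⊥] (TT a') * (sb [⊥, ⊤] (TT c) * sb [⊤, ⊤, ⊥] (TT c')) =
      sb [⊥, ⊤] (TT (a * c)) * sb [⊤, ⊤, ⊥] (TT (a' * c')) := by
      simp only [map_mul]
      rw [mul_assoc, ← mul_assoc (sb [⊤, ⊤, ⊥] (TT a')), ← (w_comm (TT c) (TT a')).eq]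
      simp only [mul_assoc]
    rwa [e] at this
  | inv a _ iha =>
    obtain ⟨a', ha⟩ := iha
    refine ⟨a'⁻¹, ?_⟩
    have := inv_mem ha
    rw [← map_inv, (w_comm _ _).eq, mul_inv_rev] at this
    simpa only [map_inv] using this

theorem exists_partner_par (hy : Subgroup.closure (y '' {n | n < R}) = ⊤) (b : Bool) (a : K) :
    ∃ a', cell (par b) (sb [⊥, ⊤] (TT a) * sb [⊤, ⊤, ⊥] (TT a')) ∈ HH Ap y R := by
  obtain ⟨a', h⟩ := exists_partner (Ap := Ap) hy a
  refine ⟨a', ?_⟩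
  cases b
  · exact h
  · rw [mem_shift_one nrm_self (E := par false) (b := false) subset_rfl]
    · exact h
    · intro j
      rw [mem_par_pred]
      exact mem_par_not (b := false)

/-- translation elements -/
theorem exists_trans (hy : Subgroup.closure (y '' {n | n < R}) = ⊤) (b : Bool) (a : K) :
    ∃ h ∈ HH Ap y R, ∀ i ∈ par b, ∀ (k : K) u, h (pt i k u) = pt i (a * k) u := by
  obtain ⟨a', h⟩ := exists_partner_par (Ap := Ap) hy (!b) a
  refine ⟨_, nrm_self _ (phi_mem (!b)) _ h, ?_⟩
  intro i hi k u
  have hj : i - 1 ∈ par (!b) := by rw [mem_par_pred, mem_par_not]; simpa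
  have e : ∀ k, pt i k u = phi K (!b) (pt (i - 1) 1 (cons ⊥ (cons ⊤ (bl (k, u))))) := by
    intro k; rw [phi_pt hj, sub_add_cancel]
  rw [e, e]
  simp only [Equiv.Perm.mul_apply]
  rw [Equiv.Perm.inv_eq_iff_eq.2 rfl, cell_in _ hj]
  congr 2
  have h1 := sb_pre [⊥, ⊤] (TT a) (bl (k, u))
  simp only [pre_cons, pre_nil] at h1
  have h2 : sb [⊤, ⊤, ⊥] (TT a') (cons ⊥ (cons ⊤ (bl (k, u)))) = cons ⊥ (cons ⊤ (bl (k, u))) :=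
    lft_notMem _ _ _ _ (by intro v; simp)
  rw [Equiv.Perm.mul_apply, h2, h1, TT_bl]

/-- standardizing addresses -/
theorem exists_strip (hy : Subgroup.closure (y '' {n | n < R}) = ⊤) (v : List (Ltr K)) :
    ∀ (b : Bool) (k : K), ∃ f ∈ HH Ap y R, ∃ d : ℤ, ∀ j ∈ par b, ∀ u,
      f (pt j k (pre v u)) = pt (j + d) 1 u := by
  induction v with
  | nil =>
    intro b k
    obtain ⟨h, hh, h1⟩ := exists_trans (Ap := Ap) hy b k⁻¹
    refine ⟨h, hh, 0, fun j hj u => ?_⟩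
    rw [pre_nil, h1 j hj]; simp
  | cons s v ih =>
    intro b k
    obtain ⟨h, hh, h1⟩ := exists_trans (Ap := Ap) hy b k⁻¹
    by_cases hs : s = ⊤
    · subst hs
      obtain ⟨f, hf, d, h2⟩ := ih (!b) 1
      refine ⟨f * (XX K (!b) * XX K b * h), mul_mem hf (mul_mem (mul_mem (XX_mem _) (XX_mem _)) hh),
        1 + d, fun j hj u => ?_⟩
      have hj1 : j + 1 ∈ par (!b) := mem_par_succ'.2 hj
      simp only [Equiv.Perm.mul_apply]
      rw [pre_cons, h1 j hj, inv_mul_cancel, XX_bt hj, XX_bot hj1, h2 _ hj1, add_assoc]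
    · obtain ⟨f, hf, d, h2⟩ := ih (if bit s then !b else b) (kk s)
      refine ⟨f * (XX K b * h), mul_mem hf (mul_mem (XX_mem _) hh),
        (if bit s then 1 else 0) + d, fun j hj u => ?_⟩
      simp only [Equiv.Perm.mul_apply]
      rw [pre_cons, h1 j hj, inv_mul_cancel, XX_mid hj hs, h2, add_assoc]
      cases bit s
      · simpa using hj
      · exact mem_par_succ'.2 hj

/-- translations by commutators lie in the group -/
theorem tau_mem (hy : Subgroup.closure (y '' {n | n < R}) = ⊤) (a : K) (ha : a ∈ commutator K) :
    tau true a ∈ HH Ap y R := by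
  have key : commutator K ≤ (HH Ap y R).comap (tau true) := by
    rw [commutator_def, Subgroup.commutator_le]
    intro a _ c _
    rw [Subgroup.mem_comap, commutatorElement_def]
    have := phi_conj false (a * c * a⁻¹ * c⁻¹)
    rw [Bool.not_false] at this
    rw [← this]
    apply nrm_self _ (phi_mem false)
    obtain ⟨a', h1⟩ := exists_partner (Ap := Ap) hy a
    obtain ⟨c', h2⟩ := exists_partner (Ap := Ap) hy c
    have ht : cell (par false) (xt (Ltr K)) ∈ HH Ap y R :=
      (mem_xt nrm_self (b := false) subset_rfl).2 (cpar_mem false)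
    have h3 := nrm_self _ ht _ h2
    rw [← map_inv, ← map_mul, ← map_mul] at h3
    have e1 := sb_conj (xt (Ltr K)) [⊥, ⊤] [⊥, ⊤]
      (fun u => by simp [xt_b]) (TT c)
    have e2 := sb_conj (xt (Ltr K)) [⊤, ⊤, ⊥] [⊤, ⊤, ⊤, ⊥]
      (fun u => by simp [xt_t, xp_t]) (TT c')
    have e3 : xt (Ltr K) * (sb [⊥, ⊤] (TT c) * sb [⊤, ⊤, ⊥] (TT c')) * (xt (Ltr K))⁻¹ =
        sb [⊥, ⊤] (TT c) * sb [⊤, ⊤, ⊤, ⊥] (TT c') := by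
      rw [← e2]; nth_rw 2 [← e1]; group
    rw [e3] at h3
    have h4 := mul_mem (mul_mem (mul_mem h1 h3) (inv_mem h1)) (inv_mem h3)
    simp only [← map_inv, ← map_mul] at h4
    have c1 := w_comm (TT c) (TT a')
    have c2 := w_comm' (TT a) (TT c')
    have c3 := w_comm2 (TT a') (TT c')
    have c4 := w_comm (TT a) (TT a')
    have c5 := w_comm' (TT c) (TT c')
    have e4 : ∀ (A C A' C' : Equiv.Perm (Str (Ltr K))), Commute C A' → Commute A C' →
        Commute A' C' → Commute A A' → Commute C C' →
        A * A' * (C * C') * (A * A')⁻¹ * (C * C')⁻¹ = A * C * A⁻¹ * C⁻¹ := by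
      intro A C A' C' h1 h2 h3 h4 h5
      have f1 : A * A' * (C * C') = (A * C) * (C' * A') := by
        rw [mul_assoc, ← mul_assoc A' C C', ← h1.eq, mul_assoc C A' C', h3.eq]
        simp only [mul_assoc]
      have f2 : (A * A')⁻¹ = A'⁻¹ * A⁻¹ := mul_inv_rev _ _
      have f3 : (C * C')⁻¹ = C⁻¹ * C'⁻¹ := by rw [h5.eq, mul_inv_rev]
      rw [f1, f2, f3]
      have f4 : A * C * (C' * A') * (A'⁻¹ * A⁻¹) * (C⁻¹ * C'⁻¹) = A * C * (C' * A⁻¹) * C⁻¹ * C'⁻¹ := by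
        group
      rw [f4, ← (h2.inv_left).eq]
      have f5 : A * C * (A⁻¹ * C') * C⁻¹ * C'⁻¹ = A * C * A⁻¹ * (C' * C⁻¹) * C'⁻¹ := by group
      rw [f5, ← (h5.inv_left).eq]
      group
    have e5 := e4 _ _ _ _ c1 c2 c3 c4 c5
    rw [e5] at h4
    simp only [map_mul, map_inv] at h4 ⊢
    exact h4
  exact key ha

end GroupH
end SimpEmb

set_option linter.unusedSectionVars false
set_option linter.unusedSimpArgs false
namespace SimpEmb
/-! ### Finite descriptions of points and the action on them -/
section FP

/-- coordinate data: negativity and positivity tests, identity, left multiplication -/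
structure Cd (κ : Type*) where
  ng : κ → Bool
  ps : κ → Bool
  one : κ
  mu : ℕ × Bool → κ → κ

variable {κ κ' : Type*} (D : Cd κ) (D' : Cd κ')

/-- finite descriptions of points -/
abbrev FPt (κ : Type*) := ℤ × κ × List (Bool × κ)

/-- is the letter the least one -/
def isB (s : Bool × κ) : Bool := !s.1 && !D.ps s.2
/-- is the letter the greatest one -/
def isT (s : Bool × κ) : Bool := s.1 && !D.ng s.2
/-- clamped coordinate -/
def clp (s : Bool × κ) : κ :=
  bif s.1 then (bif D.ps s.2 then D.one else s.2) else (bif D.ng s.2 then D.one else s.2)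

/-- `x` on lists -/
def xG : List (Bool × κ) → List (Bool × κ)
  | [] => []
  | s :: V => bif isB D s then
      (match V with
        | [] => []
        | t :: W => bif isT D t then (true, D.one) :: (false, D.one) :: W else t :: W)
      else (true, D.one) :: s :: V

/-- inverse of `x` on lists -/
def xiG : List (Bool × κ) → List (Bool × κ)
  | [] => []
  | s :: V => bif isT D s then
      (match V with
        | [] => []
        | t :: W => bif isB D t then (false, D.one) :: (true, D.one) :: W else t :: W)
      else (false, D.one) :: s :: V

/-- block output -/
def emG (k : κ) (W : List (Bool × κ)) : List (Bool × κ) :=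
  bif D.ng k then (true, k) :: W else (true, D.one) :: (false, k) :: W

/-- translations of blocks on lists -/
def tG (r : ℕ × Bool) : List (Bool × κ) → List (Bool × κ)
  | [] => []
  | s :: V => bif s.1 then
      (bif D.ng s.2 then emG D (D.mu r s.2) V
        else (match V with
          | [] => []
          | t :: W => bif t.1 then s :: t :: W else emG D (D.mu r (clp D t)) W))
      else s :: V

/-- the maps `bet` on lists -/
def bG (r : ℕ × Bool) : List (Bool × κ) → List (Bool × κ)
  | [] => []
  | s :: V => (match V with
    | [] => []
    | t :: W => bif isB D s then (bif isT D t then s :: t :: tG D r W else s :: t :: W)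
        else bif isT D s && isT D t then
          (match W with
            | [] => []
            | q :: Z => bif isB D q then s :: t :: q :: tG D (r.1, !r.2) Z else s :: t :: q :: Z)
        else s :: t :: W)

/-- cell maps on descriptions -/
def cG (E : ℤ → Bool) (f : List (Bool × κ) → List (Bool × κ)) (p : FPt κ) : FPt κ :=
  bif E p.1 && !D.ng p.2.1 && !D.ps p.2.1 then (p.1, p.2.1, f p.2.2) else p

/-- parity test -/
def parB (b : Bool) (j : ℤ) : Bool := bif b then decide (j % 2 = 1) else decide (j % 2 = 0)

/-- window index -/
def wxG (b : Bool) (i : ℤ) (k : κ) : ℤ :=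
  bif D.ps k then i else bif D.ng k then i - 1 else bif parB b i then i else i - 1

/-- output of a window map -/
def woG (j : ℤ) (p : FPt κ) : List (Bool × κ) → FPt κ
  | [] => p
  | s :: V => (j + (bif s.1 then 1 else 0), clp D s, V)

/-- window maps on descriptions -/
def wG (b : Bool) (f : List (Bool × κ) → List (Bool × κ)) (p : FPt κ) : FPt κ :=
  bif parB b (wxG D b p.1 p.2.1) then
    woG D (wxG D b p.1 p.2.1) p (f ((!decide (wxG D b p.1 p.2.1 = p.1), p.2.1) :: p.2.2))
  else p

/-- choose between `x` and its inverse -/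
def xsG (e : Bool) (V : List (Bool × κ)) : List (Bool × κ) := bif e then xG D V else xiG D V

/-- action of the generators on descriptions -/
def aG (lab : ℤ → Bool) (g : ℕ × Bool) (p : FPt κ) : FPt κ :=
  match g.1 with
  | 0 => wG D false (xsG D g.2) p
  | 1 => wG D true (xsG D g.2) p
  | 2 => cG D (parB false) (xsG D g.2) p
  | 3 => cG D (parB true) (xsG D g.2) p
  | 4 => cG D lab (xsG D g.2) p
  | n + 5 => cG D (parB false) (bG D (n, g.2)) p

/-- action of words on descriptions -/
def aW (lab : ℤ → Bool) (w : List (ℕ × Bool)) (p : FPt κ) : FPt κ := w.foldr (aG D lab) p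

/-! transfer -/

/-- transfer data between coordinates -/
structure Tr (D : Cd κ) (D' : Cd κ') (Rel : ℕ → κ → κ' → Prop) : Prop where
  mono : ∀ n k k', Rel (n + 1) k k' → Rel n k k'
  ng : ∀ n k k', Rel n k k' → D.ng k = D'.ng k'
  ps : ∀ n k k', Rel n k k' → D.ps k = D'.ps k'
  one : ∀ n k k', Rel n k k' → Rel n D.one D'.one
  mu : ∀ n k k' r, Rel (n + 1) k k' → Rel n (D.mu r k) (D'.mu r k')

/-- related letters -/
def RL (Rel : ℕ → κ → κ' → Prop) (n : ℕ) (s : Bool × κ) (s' : Bool × κ') : Prop :=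
  s.1 = s'.1 ∧ Rel n s.2 s'.2

/-- related lists -/
abbrev RLs (Rel : ℕ → κ → κ' → Prop) (n : ℕ) (V : List (Bool × κ)) (V' : List (Bool × κ')) : Prop :=
  List.Forall₂ (RL Rel n) V V'

/-- related descriptions -/
structure RP (Rel : ℕ → κ → κ' → Prop) (lab : ℤ → Bool) (δ : ℤ) (n : ℕ) (p : FPt κ) (p' : FPt κ') :
    Prop where
  idx : p'.1 = p.1 + δ
  lb : ∀ d : ℤ, |d| ≤ n → lab (p.1 + δ + d) = lab (p.1 + d)
  co : Rel n p.2.1 p'.2.1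
  ls : RLs Rel n p.2.2 p'.2.2

variable {D D'} {Rel : ℕ → κ → κ' → Prop} (T : Tr D D' Rel)
include T

theorem Tr.lmono {n : ℕ} {V : List (Bool × κ)} {V' : List (Bool × κ')} (h : RLs Rel (n + 1) V V') :
    RLs Rel n V V' := h.imp (fun _ _ h => ⟨h.1, T.mono _ _ _ h.2⟩)

theorem Tr.isB {n : ℕ} {s : Bool × κ} {s' : Bool × κ'} (h : RL Rel n s s') : isB D s = isB D' s' := by
  simp [SimpEmb.isB, h.1, T.ps _ _ _ h.2]

theorem Tr.isT {n : ℕ} {s : Bool × κ} {s' : Bool × κ'} (h : RL Rel n s s') : isT D s = isT D' s' := by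
  simp [SimpEmb.isT, h.1, T.ng _ _ _ h.2]

theorem Tr.clp {n : ℕ} {s : Bool × κ} {s' : Bool × κ'} (h : RL Rel n s s') :
    Rel n (clp D s) (clp D' s') := by
  rw [SimpEmb.clp, SimpEmb.clp, h.1, T.ps _ _ _ h.2, T.ng _ _ _ h.2]
  cases s'.1 <;> cases D'.ps s'.2 <;> cases D'.ng s'.2 <;>
    first | exact h.2 | exact T.one n _ _ h.2

theorem Tr.xG {n : ℕ} {V : List (Bool × κ)} {V' : List (Bool × κ')} (h : RLs Rel n V V') :
    RLs Rel n (xG D V) (xG D' V') := by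
  rcases h with _ | ⟨h1, h2⟩
  · exact .nil
  · rename_i s s' V V'
    rcases h2 with _ | ⟨h3, h4⟩
    · simp only [SimpEmb.xG, T.isB h1]
      cases SimpEmb.isB D' s'
      · exact .cons ⟨rfl, T.one n _ _ h1.2⟩ (.cons h1 .nil)
      · exact .nil
    · rename_i t t' V V'
      simp only [SimpEmb.xG, T.isB h1, T.isT h3]
      cases SimpEmb.isB D' s'
      · exact .cons ⟨rfl, T.one n _ _ h1.2⟩ (.cons h1 (.cons h3 h4))
      · cases SimpEmb.isT D' t'
        · exact .cons h3 h4
        · exact .cons ⟨rfl, T.one n _ _ h1.2⟩ (.cons ⟨rfl, T.one n _ _ h1.2⟩ h4)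

theorem Tr.xiG {n : ℕ} {V : List (Bool × κ)} {V' : List (Bool × κ')} (h : RLs Rel n V V') :
    RLs Rel n (xiG D V) (xiG D' V') := by
  rcases h with _ | ⟨h1, h2⟩
  · exact .nil
  · rename_i s s' V V'
    rcases h2 with _ | ⟨h3, h4⟩
    · simp only [SimpEmb.xiG, T.isT h1]
      cases SimpEmb.isT D' s'
      · exact .cons ⟨rfl, T.one n _ _ h1.2⟩ (.cons h1 .nil)
      · exact .nil
    · rename_i t t' V V'
      simp only [SimpEmb.xiG, T.isT h1, T.isB h3]
      cases SimpEmb.isT D' s'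
      · exact .cons ⟨rfl, T.one n _ _ h1.2⟩ (.cons h1 (.cons h3 h4))
      · cases SimpEmb.isB D' t'
        · exact .cons h3 h4
        · exact .cons ⟨rfl, T.one n _ _ h1.2⟩ (.cons ⟨rfl, T.one n _ _ h1.2⟩ h4)

theorem Tr.xsG {n : ℕ} (e : Bool) {V : List (Bool × κ)} {V' : List (Bool × κ')} (h : RLs Rel n V V') :
    RLs Rel n (xsG D e V) (xsG D' e V') := by
  cases e
  · exact T.xiG h
  · exact T.xG h

theorem Tr.emG {n : ℕ} {k : κ} {k' : κ'} (hk : Rel n k k') {V : List (Bool × κ)}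
    {V' : List (Bool × κ')} (h : RLs Rel n V V') : RLs Rel n (emG D k V) (emG D' k' V') := by
  rw [SimpEmb.emG, SimpEmb.emG, T.ng _ _ _ hk]
  cases D'.ng k'
  · exact .cons ⟨rfl, T.one n _ _ hk⟩ (.cons ⟨rfl, hk⟩ h)
  · exact .cons ⟨rfl, hk⟩ h

theorem Tr.tG {n : ℕ} (r : ℕ × Bool) {V : List (Bool × κ)} {V' : List (Bool × κ')}
    (h : RLs Rel (n + 1) V V') : RLs Rel n (tG D r V) (tG D' r V') := by
  have h0 := T.lmono h
  rcases h with _ | ⟨h1, h2⟩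
  · exact .nil
  · rename_i s s' V V'
    rcases h2 with _ | ⟨h3, h4⟩
    · simp only [SimpEmb.tG, h1.1, T.ng _ _ _ h1.2]
      cases s'.1
      · exact h0
      · cases D'.ng s'.2
        · exact .nil
        · exact T.emG (T.mu _ _ _ _ h1.2) .nil
    · rename_i t t' W W'
      simp only [SimpEmb.tG, h1.1, T.ng _ _ _ h1.2, h3.1]
      cases s'.1
      · exact h0
      · cases D'.ng s'.2
        · cases t'.1
          · exact T.emG (T.mu _ _ _ _ (T.clp h3)) (T.lmono h4)
          · exact h0
        · exact T.emG (T.mu _ _ _ _ h1.2) (T.lmono (.cons h3 h4))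

theorem Tr.bG {n : ℕ} (r : ℕ × Bool) {V : List (Bool × κ)} {V' : List (Bool × κ')}
    (h : RLs Rel (n + 1) V V') : RLs Rel n (bG D r V) (bG D' r V') := by
  have h0 := T.lmono h
  have m : ∀ {s : Bool × κ} {s' : Bool × κ'}, RL Rel (n + 1) s s' → RL Rel n s s' :=
    fun h => ⟨h.1, T.mono _ _ _ h.2⟩
  rcases h with _ | ⟨h1, h2⟩
  · exact .nil
  · rename_i s s' V V'
    rcases h2 with _ | ⟨h3, h4⟩
    · exact .nil
    · rename_i t t' W W'
      simp only [SimpEmb.bG, T.isB h1, T.isT h1, T.isT h3]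
      cases SimpEmb.isB D' s'
      · cases SimpEmb.isT D' s' && SimpEmb.isT D' t'
        · exact h0
        · rcases h4 with _ | ⟨h5, h6⟩
          · exact .nil
          · rename_i q q' Z Z'
            simp only [cond_true, cond_false, T.isB h5]
            cases SimpEmb.isB D' q'
            · exact h0
            · exact .cons (m h1) (.cons (m h3) (.cons (m h5) (T.tG _ h6)))
      · cases SimpEmb.isT D' t'
        · exact h0
        · exact .cons (m h1) (.cons (m h3) (T.tG _ h4))

theorem Tr.cG {lab : ℤ → Bool} {δ : ℤ} {n : ℕ} {p : FPt κ} {p' : FPt κ'}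
    (E : ℤ → Bool) (f : List (Bool × κ) → List (Bool × κ)) (f' : List (Bool × κ') → List (Bool × κ'))
    (hf : ∀ V V', RLs Rel (n + 1) V V' → RLs Rel n (f V) (f' V'))
    (hE : E p'.1 = E p.1)
    (h : RP Rel lab δ (n + 1) p p') : RP Rel lab δ n (cG D E f p) (cG D' E f' p') := by
  have hl : ∀ d : ℤ, |d| ≤ n → lab (p.1 + δ + d) = lab (p.1 + d) :=
    fun d hd => h.lb d (by push_cast; omega)
  rw [SimpEmb.cG, SimpEmb.cG, hE, T.ng _ _ _ h.co, T.ps _ _ _ h.co]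
  cases E p.1 && !D'.ng p'.2.1 && !D'.ps p'.2.1
  · exact ⟨h.idx, hl, T.mono _ _ _ h.co, T.lmono h.ls⟩
  · exact ⟨h.idx, hl, T.mono _ _ _ h.co, hf _ _ h.ls⟩

omit T in
theorem parB_add {δ : ℤ} (hδ : Even δ) (b : Bool) (i : ℤ) : parB b (i + δ) = parB b i := by
  obtain ⟨m, rfl⟩ := hδ
  have : (i + (m + m)) % 2 = i % 2 := by omega
  simp [parB, this]

theorem Tr.wG {lab : ℤ → Bool} {δ : ℤ} (hδ : Even δ) {n : ℕ} {p : FPt κ} {p' : FPt κ'} (b : Bool)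
    (f : List (Bool × κ) → List (Bool × κ)) (f' : List (Bool × κ') → List (Bool × κ'))
    (hf : ∀ V V', RLs Rel (n + 1) V V' → RLs Rel n (f V) (f' V'))
    (h : RP Rel lab δ (n + 1) p p') : RP Rel lab δ n (wG D b f p) (wG D' b f' p') := by
  have hl : ∀ j : ℤ, |j - p.1| ≤ 1 → ∀ d : ℤ, |d| ≤ n → lab (j + δ + d) = lab (j + d) := by
    intro j hj d hd
    have := h.lb (j - p.1 + d) (by push_cast; rw [abs_le] at *; omega)
    rw [show p.1 + δ + (j - p.1 + d) = j + δ + d by ring, show p.1 + (j - p.1 + d) = j + d by ring] at this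
    exact this
  have hw : wxG D' b p'.1 p'.2.1 = wxG D b p.1 p.2.1 + δ := by
    rw [wxG, wxG, h.idx, parB_add hδ, T.ng _ _ _ h.co, T.ps _ _ _ h.co]
    cases D'.ps p'.2.1 <;> cases D'.ng p'.2.1 <;> cases parB b p.1 <;> simp only [cond_true, cond_false] <;> ring
  have hj : |wxG D b p.1 p.2.1 - p.1| ≤ 1 ∧ wxG D b p.1 p.2.1 ≤ p.1 := by
    rw [wxG]
    cases D.ps p.2.1 <;> cases D.ng p.2.1 <;> cases parB b p.1 <;> simp
  have hj' : (!decide (wxG D b p.1 p.2.1 = p.1)) = false ∨ wxG D b p.1 p.2.1 = p.1 - 1 := by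
    by_cases h' : wxG D b p.1 p.2.1 = p.1
    · left; simp [h']
    · right; have := hj.1; rw [abs_le] at this; omega
  rw [SimpEmb.wG, SimpEmb.wG, hw, parB_add hδ, h.idx]
  generalize hjd : wxG D b p.1 p.2.1 = j at *
  cases parB b j
  · exact ⟨h.idx, hl _ (by simp), T.mono _ _ _ h.co, T.lmono h.ls⟩
  · have hff := hf ((!decide (j = p.1), p.2.1) :: p.2.2) ((!decide (j + δ = p.1 + δ), p'.2.1) :: p'.2.2)
      (.cons ⟨by simp, h.co⟩ h.ls)
    simp only [cond_true]
    revert hff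
    generalize f ((!decide (j = p.1), p.2.1) :: p.2.2) = V
    generalize f' ((!decide (j + δ = p.1 + δ), p'.2.1) :: p'.2.2) = V'
    intro hff
    rcases hff with _ | ⟨h1, h2⟩
    · exact ⟨h.idx, hl p.1 (by simp), T.mono _ _ _ h.co, T.lmono h.ls⟩
    · rename_i s s' V V'
      refine ⟨?_, ?_, T.clp h1, h2⟩
      · simp only [woG, h1.1]; ring
      · apply hl
        simp only [woG]
        have := hj.1
        have := hj.2
        rw [abs_le] at *
        cases s.1 <;> simp only [cond_true, cond_false] <;> constructor <;> omega

theorem Tr.aG {lab : ℤ → Bool} {δ : ℤ} (hδ : Even δ) {n : ℕ} {p : FPt κ} {p' : FPt κ'}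
    (g : ℕ × Bool) (h : RP Rel lab δ (n + 1) p p') :
    RP Rel lab δ n (aG D lab g p) (aG D' lab g p') := by
  have hp : ∀ b, parB b p'.1 = parB b p.1 := fun b => by rw [h.idx, parB_add hδ]
  have hx : ∀ V V', RLs Rel (n + 1) V V' → RLs Rel n (SimpEmb.xsG D g.2 V) (SimpEmb.xsG D' g.2 V') :=
    fun V V' h => T.xsG _ (T.lmono h)
  obtain ⟨m, e⟩ := g
  match m with
  | 0 => exact T.wG hδ _ _ _ hx h
  | 1 => exact T.wG hδ _ _ _ hx h
  | 2 => exact T.cG _ _ _ hx (hp _) h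
  | 3 => exact T.cG _ _ _ hx (hp _) h
  | 4 => exact T.cG _ _ _ hx (by rw [h.idx]; simpa using h.lb 0 (by simp; omega)) h
  | m + 5 => exact T.cG _ _ _ (fun V V' h => T.bG _ h) (hp _) h

theorem Tr.aW {lab : ℤ → Bool} {δ : ℤ} (hδ : Even δ) {n : ℕ} {p : FPt κ} {p' : FPt κ'}
    (w : List (ℕ × Bool)) (h : RP Rel lab δ (n + w.length) p p') :
    RP Rel lab δ n (aW D lab w p) (aW D' lab w p') := by
  induction w generalizing n with
  | nil => exact h
  | cons g w ih =>
    apply T.aG hδ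
    apply ih
    rw [List.length_cons] at h
    rwa [show n + 1 + w.length = n + (w.length + 1) by omega]

end FP
end SimpEmb

set_option linter.unusedSectionVars false
set_option linter.unusedSimpArgs false
namespace SimpEmb
/-! ### Descriptions and actual points -/
section Real
variable {K : Type*} [Group K] [LinearOrder K]

/-- signed generators -/
def yb (y : ℕ → K) (r : ℕ × Bool) : K := if r.2 then y r.1 else (y r.1)⁻¹

theorem yb_not (y : ℕ → K) (r : ℕ × Bool) : yb y (r.1, !r.2) = (yb y r)⁻¹ := by
  obtain ⟨n, e⟩ := r; cases e <;> simp [yb]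

/-- the coordinate data of the group itself -/
def KD (y : ℕ → K) : Cd K where
  ng k := decide (k < 1)
  ps k := decide (1 < k)
  one := 1
  mu r k := yb y r * k

/-- actual letter -/
noncomputable def rl (s : Bool × K) : Ltr K := ltr s.1 s.2

/-- actual string -/
noncomputable def rls (V : List (Bool × K)) (u : Str (Ltr K)) : Str (Ltr K) := pre (V.map rl) u

@[simp] theorem rls_nil (u : Str (Ltr K)) : rls [] u = u := rfl
@[simp] theorem rls_cons (s : Bool × K) (V : List (Bool × K)) (u : Str (Ltr K)) :
    rls (s :: V) u = cons (rl s) (rls V u) := rfl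

theorem rls_append (V W : List (Bool × K)) (u : Str (Ltr K)) :
    rls (V ++ W) u = rls V (rls W u) := by
  induction V with
  | nil => rfl
  | cons s V ih => simp [ih]

@[simp] theorem rl_bot : rl (false, (1 : K)) = ⊥ := rfl
@[simp] theorem rl_top : rl (true, (1 : K)) = ⊤ := rfl

variable (y : ℕ → K)

theorem isB_iff (s : Bool × K) : isB (KD y) s = true ↔ rl s = ⊥ := by
  obtain ⟨b, k⟩ := s
  cases b
  · by_cases h : 1 < k
    · simp [isB, KD, rl, h, ltr_f_ne h]
    · simp [isB, KD, rl, h, ltr_f_of_le (not_lt.1 h)]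
  · simp [isB, rl, ltr_t_ne_bot]

theorem isT_iff (s : Bool × K) : isT (KD y) s = true ↔ rl s = ⊤ := by
  obtain ⟨b, k⟩ := s
  cases b
  · simp [isT, rl, ltr_f_ne_top]
  · by_cases h : k < 1
    · simp [isT, KD, rl, h, ltr_t_ne h]
    · simp [isT, KD, rl, h, ltr_t_of_le (not_lt.1 h)]

theorem isB_f (s : Bool × K) (h : isB (KD y) s = false) : rl s ≠ ⊥ := by
  rw [Ne, ← isB_iff y, h]; simp
theorem isT_f (s : Bool × K) (h : isT (KD y) s = false) : rl s ≠ ⊤ := by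
  rw [Ne, ← isT_iff y, h]; simp

theorem clp_eq (s : Bool × K) : clp (KD y) s = kk (rl s) := by
  obtain ⟨b, k⟩ := s
  cases b
  · by_cases h : k < 1
    · simp [clp, KD, rl, kk_ltr_f, h, h.le]
    · simp [clp, KD, rl, kk_ltr_f, h, not_lt.1 h]
  · by_cases h : 1 < k
    · simp [clp, KD, rl, kk_ltr_t, h, h.le]
    · simp [clp, KD, rl, kk_ltr_t, h, not_lt.1 h]

theorem xG_real (V : List (Bool × K)) (hV : 2 ≤ V.length) (u : Str (Ltr K)) :
    rls (xG (KD y) V) u = xp _ (rls V u) := by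
  match V, hV with
  | s :: t :: W, _ =>
    simp only [xG, rls_cons]
    cases hs : isB (KD y) s
    · rw [xp_apply_cons _ (isB_f y s hs)]; rfl
    · rw [(isB_iff y s).1 hs]
      cases ht : isT (KD y) t
      · rw [xp_apply_bcons _ (isT_f y t ht)]; rfl
      · rw [(isT_iff y t).1 ht, xp_bt]; rfl

theorem xiG_real (V : List (Bool × K)) (hV : 2 ≤ V.length) (u : Str (Ltr K)) :
    rls (xiG (KD y) V) u = (xp _)⁻¹ (rls V u) := by
  match V, hV with
  | s :: t :: W, _ =>
    simp only [xiG, rls_cons]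
    cases hs : isT (KD y) s
    · rw [xp_inv_n (isT_f y s hs)]; rfl
    · rw [(isT_iff y s).1 hs]
      cases ht : isB (KD y) t
      · rw [xp_inv_t (isB_f y t ht)]; rfl
      · rw [(isB_iff y t).1 ht, xp_inv_tb]; rfl

/-- signed powers -/
def sg {G : Type*} [Group G] (g : G) (e : Bool) : G := if e then g else g⁻¹

theorem xsG_real (e : Bool) (V : List (Bool × K)) (hV : 2 ≤ V.length) (u : Str (Ltr K)) :
    rls (xsG (KD y) e V) u = sg (xp _) e (rls V u) := by
  cases e
  · exact xiG_real y V hV u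
  · exact xG_real y V hV u

theorem emG_real (k : K) (W : List (Bool × K)) (u : Str (Ltr K)) :
    rls (emG (KD y) k W) u = bl (k, rls W u) := by
  by_cases h : k < 1
  · rw [bl_neg h]; simp [emG, KD, h, rl]
  · rw [bl_nonneg (not_lt.1 h)]; simp [emG, KD, h, rl, top_def]

theorem tG_real (r : ℕ × Bool) (V : List (Bool × K)) (hV : 2 ≤ V.length) (u : Str (Ltr K)) :
    rls (tG (KD y) r V) u = TT (yb y r) (rls V u) := by
  match V, hV with
  | (b, k) :: (c, l) :: W, _ =>
    cases b
    · have := TT_notMem (yb y r) (rls ((false, k) :: (c, l) :: W) u)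
        (bl_ne_left (by simp [rl]))
      rw [this]; simp [tG]
    · by_cases h : k < 1
      · have e : tG (KD y) r ((true, k) :: (c, l) :: W) = emG (KD y) (yb y r * k) ((c, l) :: W) := by
          simp [tG, KD, h]
        rw [e, emG_real, ← TT_bl, bl_neg h]; rfl
      · have hk : rl (true, k) = ⊤ := ltr_t_of_le (not_lt.1 h)
        cases c
        · have e : tG (KD y) r ((true, k) :: (false, l) :: W) =
              emG (KD y) (yb y r * clp (KD y) (false, l)) W := by
            simp [tG, KD, h]
          rw [e, emG_real, ← TT_bl, clp_eq, bl_nonneg (one_le_kk (by simp [rl])), rls_cons, rls_cons, hk]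
          congr 3
          exact ltr_bit_kk (rl (false, l))
        · have e : tG (KD y) r ((true, k) :: (true, l) :: W) = (true, k) :: (true, l) :: W := by
            simp [tG, KD, h]
          rw [e, rls_cons, hk, TT_notMem]
          exact bl_ne_right (by simp [rl])

theorem bet_1 (g : Equiv.Perm (Str (Ltr K))) (u : Str (Ltr K)) :
    bet g (cons ⊥ (cons ⊤ u)) = cons ⊥ (cons ⊤ (g u)) := by
  have h1 := sb_pre [⊥, ⊤] g u
  simp only [pre_cons, pre_nil] at h1
  have h2 : sb [⊤, ⊤, ⊥] g⁻¹ (cons ⊥ (cons ⊤ u)) = cons ⊥ (cons ⊤ u) :=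
    lft_notMem _ _ _ _ (by intro v; simp)
  rw [bet, Equiv.Perm.mul_apply, h2, h1]

theorem bet_2 (g : Equiv.Perm (Str (Ltr K))) (u : Str (Ltr K)) :
    bet g (cons ⊤ (cons ⊤ (cons ⊥ u))) = cons ⊤ (cons ⊤ (cons ⊥ (g⁻¹ u))) := by
  have h1 := sb_pre [⊤, ⊤, ⊥] g⁻¹ u
  simp only [pre_cons, pre_nil] at h1
  rw [bet, Equiv.Perm.mul_apply, h1]
  exact lft_notMem _ _ _ _ (by intro v; simp)

theorem bet_3 (g : Equiv.Perm (Str (Ltr K))) (v : Str (Ltr K)) (h1 : ∀ u, v ≠ cons ⊥ (cons ⊤ u))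
    (h2 : ∀ u, v ≠ cons ⊤ (cons ⊤ (cons ⊥ u))) : bet g v = v := by
  have e2 : sb [⊤, ⊤, ⊥] g⁻¹ v = v :=
    lft_notMem _ _ _ _ (by intro u; exact (h2 u).symm)
  rw [bet, Equiv.Perm.mul_apply, e2]
  exact lft_notMem _ _ _ _ (by intro u; exact (h1 u).symm)

theorem bG_real (r : ℕ × Bool) (V : List (Bool × K)) (hV : 5 ≤ V.length) (u : Str (Ltr K)) :
    rls (bG (KD y) r V) u = bet (TT (yb y r)) (rls V u) := by
  match V, hV with
  | s :: t :: q :: a :: b :: W, _ =>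
    cases hs : isB (KD y) s
    · have hs' := isB_f y s hs
      cases hst : isT (KD y) s && isT (KD y) t
      · rw [bet_3]
        · simp [bG, hs, hst]
        · intro v; simp [hs']
        · intro v e
          simp only [rls_cons, cons_inj] at e
          have := (isT_iff y s).2 e.1
          have := (isT_iff y t).2 e.2.1
          simp_all
      · have h1 := (isT_iff y s).1 (by revert hst; cases isT (KD y) s <;> simp)
        have h2 := (isT_iff y t).1 (by revert hst; cases isT (KD y) t <;> simp)
        cases hq : isB (KD y) q
        · have := isB_f y q hq
          rw [bet_3]
          · simp [bG, hs, hst, hq]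
          · intro v; simp [hs']
          · intro v; simp [this]
        · have e : bG (KD y) r (s :: t :: q :: a :: b :: W) =
              s :: t :: q :: tG (KD y) (r.1, !r.2) (a :: b :: W) := by
            simp only [bG, hs, hst, hq, cond_true, cond_false]
          rw [e]
          simp only [rls_cons, h1, h2, (isB_iff y q).1 hq]
          rw [bet_2, tG_real _ _ _ (by simp), yb_not, map_inv]
          rfl
    · have hs' := (isB_iff y s).1 hs
      cases ht : isT (KD y) t
      · have := isT_f y t ht
        rw [bet_3]
        · simp [bG, hs, ht]
        · intro v; simp [this]
        · intro v; simp [hs']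
      · have e : bG (KD y) r (s :: t :: q :: a :: b :: W) =
              s :: t :: tG (KD y) r (q :: a :: b :: W) := by
            simp only [bG, hs, ht, cond_true, cond_false]
        rw [e]
        simp only [rls_cons, hs', (isT_iff y t).1 ht]
        rw [bet_1, tG_real _ _ _ (by simp)]
        rfl

/-- actual point -/
noncomputable def rp (p : FPt K) (u : Str (Ltr K)) : Om K := pt p.1 p.2.1 (rls p.2.2 u)

theorem cG_real (E : ℤ → Bool) (E' : Set ℤ) (hE : ∀ j, j ∈ E' ↔ E j = true)
    (f : List (Bool × K) → List (Bool × K)) (g : Equiv.Perm (Str (Ltr K))) (p : FPt K)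
    (u : Str (Ltr K)) (hf : rls (f p.2.2) u = g (rls p.2.2 u)) :
    rp (cG (KD y) E f p) u = cell E' g (rp p u) := by
  obtain ⟨i, k, V⟩ := p
  simp only [rp, cG, KD] at *
  by_cases h : i ∈ E' ∧ k = 1
  · obtain ⟨hi, rfl⟩ := h
    rw [cell_in _ hi, ← hf]
    simp [(hE i).1 hi]
  · rw [cell_out _ h]
    have : (E i && !decide (k < 1) && !decide (1 < k)) = false := by
      by_contra h'
      apply h
      simp at h'
      exact ⟨(hE i).2 h'.1, le_antisymm h'.2.2 h'.2.1⟩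
    simp [this]

theorem parB_iff (b : Bool) (j : ℤ) : j ∈ par b ↔ parB b j = true := by
  cases b <;> simp [par, parB]

theorem wxG_real (b : Bool) (i : ℤ) (k : K) (u : Str (Ltr K)) :
    wxG (KD y) b i k = wx b (pt i k u) := by
  rw [wx_pt, wxG]
  by_cases h1 : 1 < k <;> by_cases h2 : k < 1 <;> by_cases h3 : i ∈ par b <;>
    (have h3' := h3; rw [parB_iff] at h3'; simp [KD, h1, h2, h3, h3'])

theorem wG_real (b : Bool) (f : List (Bool × K) → List (Bool × K)) (g : Equiv.Perm (Str (Ltr K)))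
    (p : FPt K) (u : Str (Ltr K)) (hV : 1 ≤ p.2.2.length)
    (hf : ∀ V, 2 ≤ V.length → rls (f V) u = g (rls V u))
    (hf' : ∀ V, 2 ≤ V.length → f V ≠ []) :
    rp (wG (KD y) b f p) u = win b g (rp p u) := by
  obtain ⟨i, k, V⟩ := p
  simp only [rp, wG] at *
  have hw := wxG_real y b i k (rls V u)
  generalize hj : wxG (KD y) b i k = j at *
  by_cases h : j ∈ par b
  · have h' := (parB_iff b j).1 h
    have e1 : wi j (rls ((!decide (j = i), k) :: V) u) = pt i k (rls V u) := by
      rw [rls_cons, wi_cons]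
      have hk : kk (rl (!decide (j = i), k)) = k ∧ j + (if !decide (j = i) then 1 else 0) = i := by
        rw [wxG] at hj
        simp only [KD] at hj
        by_cases h1 : 1 < k
        · simp [h1] at hj; simp [hj, rl, kk_ltr_f, h1.le]
        · by_cases h2 : k < 1
          · simp [h1, h2] at hj; simp [← hj, rl, kk_ltr_t, h2.le]
          · have : k = 1 := by order
            subst this
            cases hp : parB b i
            · simp [hp] at hj; simp [← hj, rl, kk_ltr_t]
            · simp [hp] at hj; simp [← hj, rl, kk_ltr_f]
      rw [hk.1]
      congr 1
      exact hk.2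
    rw [← e1, win_wi h, ← hf _ (by simp; omega), h', cond_true]
    have := hf' ((!decide (j = i), k) :: V) (by simp; omega)
    match hm : f ((!decide (j = i), k) :: V), this with
    | s :: W, _ =>
      simp only [woG, rls_cons, wi_cons, clp_eq]
      congr 2
      rw [show bit (rl s) = s.1 from rfl]
      cases s.1 <;> rfl
  · have h' : parB b j = false := by
      rw [parB_iff] at h; simpa using h
    rw [h', win_out (by rw [← hw]; exact h)]
    rfl

theorem xsG_ne (e : Bool) (V : List (Bool × K)) (hV : 2 ≤ V.length) : xsG (KD y) e V ≠ [] := by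
  match V, hV with
  | s :: t :: W, _ =>
    cases e
    · simp only [xsG, xiG, cond_false]
      cases isT (KD y) s <;> cases isB (KD y) t <;> simp
    · simp only [xsG, xG, cond_true]
      cases isB (KD y) s <;> cases isT (KD y) t <;> simp

theorem map_sg {G H : Type*} [Group G] [Group H] (f : G →* H) (g : G) (e : Bool) :
    sg (f g) e = f (sg g e) := by cases e <;> simp [sg]

theorem bet_sg (n : ℕ) (e : Bool) : sg (bet (TT (y n))) e = bet (TT (yb y (n, e))) := by
  cases e
  · simp only [sg, yb, bet, map_inv, inv_inv]
    simp only [Bool.false_eq_true, if_false, mul_inv_rev, inv_inv, map_inv]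
    exact ((w_comm (K := K) _ _).inv_left).eq.symm
  · rfl

theorem aG_real {Ap : Set ℤ} {lab : ℤ → Bool} (hlab : ∀ j, j ∈ Ap ↔ lab j = true) (g : ℕ × Bool)
    (p : FPt K) (hp : 5 ≤ p.2.2.length) (u : Str (Ltr K)) :
    rp (aG (KD y) lab g p) u = sg (genN Ap y g.1) g.2 (rp p u) := by
  obtain ⟨m, e⟩ := g
  have hx := fun V hV => xsG_real (K := K) y e V hV u
  have hx' := fun V hV => xsG_ne (K := K) y e V hV
  match m with
  | 0 =>
    simp only [genN, XX]; rw [map_sg]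
    exact wG_real y false _ _ p u (by omega) hx hx'
  | 1 =>
    simp only [genN, XX]; rw [map_sg]
    exact wG_real y true _ _ p u (by omega) hx hx'
  | 2 =>
    simp only [genN]; rw [map_sg]
    exact cG_real y _ _ (parB_iff false) _ _ p u (hx _ (by omega))
  | 3 =>
    simp only [genN]; rw [map_sg]
    exact cG_real y _ _ (parB_iff true) _ _ p u (hx _ (by omega))
  | 4 =>
    simp only [genN]; rw [map_sg]
    exact cG_real y _ _ hlab _ _ p u (hx _ (by omega))
  | m + 5 =>
    simp only [genN]; rw [map_sg, bet_sg]
    exact cG_real y _ _ (parB_iff false) _ _ p u (bG_real _ _ _ hp u)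

end Real

section Len
variable {κ : Type*} (D : Cd κ)

theorem xsG_len (e : Bool) (V : List (Bool × κ)) : V.length ≤ (xsG D e V).length + 1 := by
  match V with
  | [] => simp
  | [s] => simp
  | s :: t :: W =>
    cases e
    · simp only [xsG, xiG, cond_false]
      cases isT D s <;> cases isB D t <;> simp
    · simp only [xsG, xG, cond_true]
      cases isB D s <;> cases isT D t <;> simp

theorem emG_len (k : κ) (W : List (Bool × κ)) : W.length + 1 ≤ (emG D k W).length := by
  rw [emG]; cases D.ng k <;> simp

theorem tG_len (r : ℕ × Bool) (V : List (Bool × κ)) : V.length ≤ (tG D r V).length + 1 := by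
  match V with
  | [] => simp
  | [s] => simp
  | s :: t :: W =>
    have h1 := emG_len D (D.mu r s.2) (t :: W)
    have h2 := emG_len D (D.mu r (clp D t)) W
    simp only [List.length_cons] at *
    simp only [tG]
    cases s.1 <;> cases D.ng s.2 <;> cases t.1 <;> simp <;> omega

theorem bG_len (r : ℕ × Bool) (V : List (Bool × κ)) : V.length ≤ (bG D r V).length + 2 := by
  match V with
  | [] => simp
  | [s] => simp
  | [s, t] => simp
  | s :: t :: q :: W =>
    have h1 := tG_len D r (q :: W)
    have h2 := tG_len D (r.1, !r.2) W
    simp only [List.length_cons] at *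
    simp only [bG]
    cases isB D s <;> cases isT D t <;> cases isT D s <;> cases isB D q <;> simp <;> omega

theorem cG_len (E : ℤ → Bool) (f : List (Bool × κ) → List (Bool × κ)) (p : FPt κ)
    (hf : p.2.2.length ≤ (f p.2.2).length + 2) :
    p.2.2.length ≤ (cG D E f p).2.2.length + 2 := by
  rw [cG]
  cases E p.1 && !D.ng p.2.1 && !D.ps p.2.1
  · simp
  · simpa using hf

theorem wG_len (b : Bool) (f : List (Bool × κ) → List (Bool × κ)) (p : FPt κ)
    (hf : ∀ V, V.length ≤ (f V).length + 1) :
    p.2.2.length ≤ (wG D b f p).2.2.length + 2 := by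
  rw [wG]
  have := hf ((!decide (wxG D b p.1 p.2.1 = p.1), p.2.1) :: p.2.2)
  cases parB b (wxG D b p.1 p.2.1)
  · simp
  · simp only [cond_true]
    match hm : f ((!decide (wxG D b p.1 p.2.1 = p.1), p.2.1) :: p.2.2) with
    | [] => simp [woG]
    | s :: W =>
      rw [hm] at this
      simp only [List.length_cons] at this
      simp only [woG]
      omega

theorem aG_len (lab : ℤ → Bool) (g : ℕ × Bool) (p : FPt κ) :
    p.2.2.length ≤ (aG D lab g p).2.2.length + 2 := by
  obtain ⟨m, e⟩ := g
  have hx := xsG_len D e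
  have hx' := fun V => (hx V).trans (Nat.le_succ _)
  match m with
  | 0 => exact wG_len D _ _ p hx
  | 1 => exact wG_len D _ _ p hx
  | 2 => exact cG_len D _ _ p (hx' _)
  | 3 => exact cG_len D _ _ p (hx' _)
  | 4 => exact cG_len D _ _ p (hx' _)
  | m + 5 => exact cG_len D _ _ p (bG_len D _ _)

theorem aW_len (lab : ℤ → Bool) (w : List (ℕ × Bool)) (p : FPt κ) :
    p.2.2.length ≤ (aW D lab w p).2.2.length + 2 * w.length := by
  induction w with
  | nil => simp [aW]
  | cons g w ih =>
    have := aG_len D lab g (aW D lab w p)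
    rw [List.length_cons]
    show p.2.2.length ≤ (aG D lab g (aW D lab w p)).2.2.length + _
    omega

end Len

section Real2
variable {K : Type*} [Group K] [LinearOrder K] (y : ℕ → K)

theorem evalWord_cons {G : Type*} [Group G] (x : ℕ → G) (g : ℕ × Bool) (w : List (ℕ × Bool)) :
    evalWord x (g :: w) = sg (x g.1) g.2 * evalWord x w := by
  simp [evalWord, sg]

theorem aW_real {Ap : Set ℤ} {lab : ℤ → Bool} (hlab : ∀ j, j ∈ Ap ↔ lab j = true)
    (w : List (ℕ × Bool)) (p : FPt K) (hp : 5 + 2 * w.length ≤ p.2.2.length) (u : Str (Ltr K)) :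
    rp (aW (KD y) lab w p) u = evalWord (genN Ap y) w (rp p u) := by
  induction w with
  | nil => simp [aW, evalWord]
  | cons g w ih =>
    rw [List.length_cons] at hp
    have := aW_len (KD y) lab w p
    rw [evalWord_cons, Equiv.Perm.mul_apply, ← ih (by omega)]
    exact aG_real y hlab g (aW (KD y) lab w p) (by omega) u

end Real2
end SimpEmb

set_option linter.unusedSectionVars false
set_option linter.unusedSimpArgs false
namespace SimpEmb
/-! ### The label set -/
section Labels

/-- odd 2-adic valuation -/
def l2 (x : ℤ) : Prop := ∃ i : ℕ, (2 : ℤ) ^ (2 * i + 1) ∣ x ∧ ¬ (2 : ℤ) ^ (2 * i + 2) ∣ x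

/-- the labelled integers -/
def Ap : Set ℤ := {j | l2 (3 * j + 1)}

open Classical in
/-- the label function -/
noncomputable def lab (j : ℤ) : Bool := decide (j ∈ Ap)

theorem lab_iff (j : ℤ) : j ∈ Ap ↔ lab j = true := by simp [lab]

theorem lab_eq {j j' : ℤ} (h : l2 (3 * j + 1) ↔ l2 (3 * j' + 1)) : lab j = lab j' := by
  unfold lab
  exact decide_eq_decide.2 h

theorem Ap_sub : Ap ⊆ par true := by
  rintro j ⟨i, h, _⟩
  have : (2 : ℤ) ∣ 3 * j + 1 := (dvd_pow_self 2 (by omega)).trans h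
  simp only [par, Set.mem_ofPred_eq]; simp; omega

theorem l2_congr {x x' : ℤ} {M : ℕ} (h : (2 : ℤ) ^ M ∣ x' - x) (hx : ¬ (2 : ℤ) ^ M ∣ x) (h1 : l2 x) :
    l2 x' := by
  obtain ⟨i, h1, h2⟩ := h1
  have hi : 2 * i + 2 ≤ M := by
    by_contra hc
    exact hx ((pow_dvd_pow 2 (by omega)).trans h1)
  have e1 : (2 : ℤ) ^ (2 * i + 1) ∣ x' - x := (pow_dvd_pow 2 (by omega)).trans h
  have e2 : (2 : ℤ) ^ (2 * i + 2) ∣ x' - x := (pow_dvd_pow 2 hi).trans h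
  refine ⟨i, ?_, ?_⟩
  · rwa [← dvd_iff_dvd_of_dvd_sub e1] at h1
  · rwa [← dvd_iff_dvd_of_dvd_sub e2] at h2

theorem l2_iff {x x' : ℤ} {M : ℕ} (h : (2 : ℤ) ^ M ∣ x' - x) (hx : ¬ (2 : ℤ) ^ M ∣ x) :
    l2 x ↔ l2 x' :=
  ⟨l2_congr h hx, l2_congr (M := M) (by rw [← neg_sub]; exact h.neg_right)
    (by rwa [dvd_iff_dvd_of_dvd_sub h])⟩

theorem l2_pow (k : ℕ) (c : ℤ) (hc : c % 2 = 1) : l2 (2 ^ k * c) ↔ k % 2 = 1 := by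
  have hd : ∀ m : ℕ, (2 : ℤ) ^ m ∣ 2 ^ k * c ↔ m ≤ k := by
    intro m
    constructor
    · intro h
      by_contra hm
      have h1 : (2 : ℤ) ^ (k + 1) ∣ 2 ^ k * c := (pow_dvd_pow 2 (by omega)).trans h
      rw [pow_succ] at h1
      have h2 := Int.dvd_of_mul_dvd_mul_left (by positivity) h1
      omega
    · intro h
      exact (pow_dvd_pow 2 h).mul_right c
  unfold l2
  simp only [hd]
  constructor
  · rintro ⟨i, h1, h2⟩; omega
  · intro h; exact ⟨k / 2, by omega, by omega⟩

theorem pow_mod3 (k : ℕ) : ((2 : ℤ) ^ k % 3 = 1) ∨ ((2 : ℤ) ^ k % 3 = 2) := by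
  induction k with
  | zero => left; rfl
  | succ k ih => rw [pow_succ]; omega

theorem lab_aperiodic (m : ℤ) (hm : m ≠ 0) : ∃ i, lab i ≠ lab (i + m) := by
  obtain ⟨v, c, hc, rfl⟩ : ∃ (v : ℕ) (c : ℤ), c % 2 = 1 ∧ m = 2 ^ v * c := by
    obtain ⟨c, hc, h⟩ := (Int.finiteMultiplicity_iff (a := 2) (b := m)).2 ⟨by decide, hm⟩
      |>.exists_eq_pow_mul_and_not_dvd
    exact ⟨_, c, by omega, hc⟩
  obtain ⟨i, e, he, hi⟩ : ∃ i e : ℤ, e % 2 = 1 ∧ 3 * i + 1 = 2 ^ (v + 1) * e := by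
    rcases pow_mod3 (v + 1) with h | h
    · exact ⟨(2 ^ (v + 1) - 1) / 3, 1, by rfl, by omega⟩
    · exact ⟨(-2 ^ (v + 1) - 1) / 3, -1, by rfl, by omega⟩
  refine ⟨i, fun h => ?_⟩
  have h1 : l2 (3 * i + 1) ↔ l2 (3 * (i + 2 ^ v * c) + 1) := by
    have := lab_iff i
    have h2 := lab_iff (i + 2 ^ v * c)
    rw [h] at this
    exact this.trans h2.symm
  have e2 : 3 * (i + 2 ^ v * c) + 1 = 2 ^ v * (2 * e + 3 * c) := by
    rw [pow_succ] at hi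
    linear_combination hi
  rw [hi, e2, l2_pow _ _ he, l2_pow _ _ (by omega)] at h1
  omega

theorem lab_toeplitz (n : ℕ) (j : ℤ) : ∃ B : ℕ, 1 ≤ B ∧ ∀ t d : ℤ, |d| ≤ n →
    lab (j + 2 ^ B * t + d) = lab (j + d) := by
  refine ⟨(3 * (|j| + n) + 2).toNat, ?_, ?_⟩
  · have := abs_nonneg j; omega
  intro t d hd
  apply lab_eq
  symm
  apply l2_iff (M := (3 * (|j| + n) + 2).toNat)
  · exact ⟨3 * t, by ring⟩
  · intro h
    have h1 := Int.le_of_dvd (abs_pos.2 (by omega)) ((dvd_abs _ _).2 h)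
    have h2 : (3 * (|j| + n) + 2).toNat < 2 ^ (3 * (|j| + n) + 2).toNat := Nat.lt_two_pow_self
    have h3 : (((3 * (|j| + n) + 2).toNat : ℕ) : ℤ) < (2 : ℤ) ^ (3 * (|j| + n) + 2).toNat := by
      exact_mod_cast h2
    have h4 : |3 * (j + d) + 1| ≤ 3 * (|j| + n) + 1 := by
      rcases abs_cases j with h | h <;> rcases abs_cases d with h' | h' <;>
        rcases abs_cases (3 * (j + d) + 1) with h'' | h'' <;> omega
    omega

theorem lab_recur (L M : ℕ) (hM : 1 ≤ M) (hL : 2 * L < 2 ^ M) (j : ℤ) :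
    ∃ j' : ℤ, 0 ≤ j' ∧ j' < 2 ^ (M + 2) ∧ Even (j' - j) ∧
      ∀ d : ℤ, |d| ≤ L → lab (j' + d) = lab (j + d) := by
  have hp : (0 : ℤ) < 2 ^ M := by positivity
  have hr0 := Int.emod_nonneg j hp.ne'
  have hr1 := Int.emod_lt_of_pos j hp
  have hr2 : j % 2 ^ M = j - 2 ^ M * (j / 2 ^ M) := by
    have := Int.emod_add_mul_ediv j (2 ^ M); linarith
  have key : ∀ t : ℤ, 0 ≤ t → t < 4 → (∀ d : ℤ, |d| ≤ L → (2 : ℤ) ^ M ∣ 3 * (j + d) + 1 →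
      lab (j % 2 ^ M + 2 ^ M * t + d) = lab (j + d)) → ∃ j' : ℤ, 0 ≤ j' ∧ j' < 2 ^ (M + 2) ∧
        Even (j' - j) ∧ ∀ d : ℤ, |d| ≤ L → lab (j' + d) = lab (j + d) := by
    intro t ht0 ht4 h
    refine ⟨j % 2 ^ M + 2 ^ M * t, by positivity, ?_, ?_, ?_⟩
    · rw [pow_add]; nlinarith
    · rw [hr2, even_iff_two_dvd]
      have : (2 : ℤ) ∣ 2 ^ M := dvd_pow_self 2 (by omega)
      refine this.trans ⟨t - j / 2 ^ M, by ring⟩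
    · intro d hd
      by_cases hdv : (2 : ℤ) ^ M ∣ 3 * (j + d) + 1
      · exact h d hd hdv
      · apply lab_eq
        symm
        refine l2_iff (M := M) ?_ hdv
        rw [hr2]
        exact ⟨3 * (t - j / 2 ^ M), by ring⟩
  by_cases hole : ∃ d : ℤ, |d| ≤ L ∧ (2 : ℤ) ^ M ∣ 3 * (j + d) + 1
  · obtain ⟨d0, hd0, e, he⟩ := hole
    have uniq : ∀ d : ℤ, |d| ≤ L → (2 : ℤ) ^ M ∣ 3 * (j + d) + 1 → d = d0 := by
      intro d hd hdv
      have h1 : (2 : ℤ) ^ M ∣ 3 * (d - d0) := by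
        have := dvd_sub hdv ⟨e, he⟩
        rwa [show 3 * (j + d) + 1 - (3 * (j + d0) + 1) = 3 * (d - d0) by ring] at this
      have h2 : (2 : ℤ) ^ M ∣ d - d0 := by
        apply IsCoprime.dvd_of_dvd_mul_left _ h1
        apply IsCoprime.pow_left
        exact ⟨-1, 1, by norm_num⟩
      have hL' : (2 * L : ℤ) < 2 ^ M := by exact_mod_cast hL
      have h3 : |d - d0| < 2 ^ M := by
        rw [abs_le] at hd hd0
        rw [abs_lt]; constructor <;> linarith
      have := Int.eq_zero_of_abs_lt_dvd h2 h3
      linarith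
    have hval : ∀ t : ℤ, 3 * (j % 2 ^ M + 2 ^ M * t + d0) + 1 =
        2 ^ M * (e - 3 * (j / 2 ^ M) + 3 * t) := by
      intro t; rw [hr2]; linear_combination he
    set e' := e - 3 * (j / 2 ^ M) with he'
    have t1 : ∃ t : ℤ, 0 ≤ t ∧ t < 4 ∧ (e' + 3 * t) % 4 = 1 := ⟨(e' + 3) % 4, by omega, by omega, by omega⟩
    have t2 : ∃ t : ℤ, 0 ≤ t ∧ t < 4 ∧ (e' + 3 * t) % 4 = 2 := ⟨(e' + 2) % 4, by omega, by omega, by omega⟩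
    have v1 : ∃ t : ℤ, 0 ≤ t ∧ t < 4 ∧ (l2 (2 ^ M * (e' + 3 * t)) ↔ M % 2 = 1) := by
      obtain ⟨t, a, b, c⟩ := t1
      exact ⟨t, a, b, l2_pow _ _ (by omega)⟩
    have v2 : ∃ t : ℤ, 0 ≤ t ∧ t < 4 ∧ (l2 (2 ^ M * (e' + 3 * t)) ↔ ¬ M % 2 = 1) := by
      obtain ⟨t, a, b, c⟩ := t2
      refine ⟨t, a, b, ?_⟩
      have := l2_pow (M + 1) ((e' + 3 * t) / 2) (by omega)
      rw [pow_succ, mul_assoc, show 2 * ((e' + 3 * t) / 2) = e' + 3 * t by omega] at this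
      rw [this]; omega
    have v3 : ∃ t : ℤ, 0 ≤ t ∧ t < 4 ∧ (l2 (2 ^ M * (e' + 3 * t)) ↔ l2 (3 * (j + d0) + 1)) := by
      by_cases hh : (l2 (3 * (j + d0) + 1) ↔ M % 2 = 1)
      · obtain ⟨t, a, b, c⟩ := v1
        exact ⟨t, a, b, c.trans hh.symm⟩
      · obtain ⟨t, a, b, c⟩ := v2
        exact ⟨t, a, b, c.trans (by tauto)⟩
    obtain ⟨t, a, b, c⟩ := v3
    refine key t a b ?_
    intro d hd hdv
    rw [uniq d hd hdv]
    apply lab_eq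
    rw [hval]
    exact c
  · push Not at hole
    exact key 0 le_rfl (by norm_num) (fun d hd h => absurd h (hole d hd))

end Labels
end SimpEmb

set_option linter.unusedSectionVars false
set_option linter.unusedSimpArgs false
namespace SimpEmb
/-! ### Simplicity -/
section Words

theorem evalWord_append {G : Type*} [Group G] (x : ℕ → G) (v w : List (ℕ × Bool)) :
    evalWord x (v ++ w) = evalWord x v * evalWord x w := by simp [evalWord]

/-- inverse word -/
def invW (w : List (ℕ × Bool)) : List (ℕ × Bool) := (w.map (fun p => (p.1, !p.2))).reverse

theorem evalWord_invW {G : Type*} [Group G] (x : ℕ → G) (v : List (ℕ × Bool)) :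
    evalWord x (invW v) = (evalWord x v)⁻¹ := by
  unfold invW
  induction v with
  | nil => simp [evalWord]
  | cons g v ih =>
    rw [List.map_cons, List.reverse_cons, evalWord_append, ih, evalWord_cons x g v, mul_inv_rev]
    obtain ⟨a, b⟩ := g
    cases b <;> simp [evalWord, sg]

theorem exists_word {G : Type*} [Group G] (x : ℕ → G) (m : ℕ) (h : G)
    (hh : h ∈ Subgroup.closure (Set.range (fun i : Fin m => x i))) :
    ∃ w : List (ℕ × Bool), (∀ g ∈ w, g.1 < m) ∧ evalWord x w = h := by
  induction hh using Subgroup.closure_induction with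
  | mem a ha =>
    obtain ⟨i, rfl⟩ := ha
    exact ⟨[(i, true)], by simp, by simp [evalWord]⟩
  | one => exact ⟨[], by simp, by simp [evalWord]⟩
  | mul a b _ _ ha hb =>
    obtain ⟨v, hv, rfl⟩ := ha
    obtain ⟨w, hw, rfl⟩ := hb
    refine ⟨v ++ w, ?_, by simp [evalWord]⟩
    intro g hg
    rcases List.mem_append.1 hg with h | h
    · exact hv g h
    · exact hw g h
  | inv a _ ha =>
    obtain ⟨v, hv, rfl⟩ := ha
    refine ⟨invW v, ?_, evalWord_invW x v⟩
    intro g hg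
    simp only [invW, List.mem_reverse, List.mem_map] at hg
    obtain ⟨p, hp, rfl⟩ := hg
    exact hv p hp

end Words

section Simple
variable {K : Type*} [Group K] [LinearOrder K]

theorem exists_rls (n : ℕ) (u : Str (Ltr K)) : ∃ (V : List (Bool × K)) (t : Str (Ltr K)),
    V.length = n ∧ u = rls V t := by
  induction n generalizing u with
  | zero => exact ⟨[], u, rfl, rfl⟩
  | succ n ih =>
    obtain ⟨s, v, rfl⟩ := exists_cons u
    obtain ⟨V, t, h1, h2⟩ := ih v
    refine ⟨(bit s, kk s) :: V, t, by simp [h1], ?_⟩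
    rw [rls_cons, rl, ltr_bit_kk, h2]

theorem rls_get (V : List (Bool × K)) (u u' : Str (Ltr K)) (m : ℕ) (hm : m < V.length) :
    rls V u m = rls V u' m := by
  induction V generalizing m with
  | nil => simp at hm
  | cons s V ih =>
    rw [rls_cons, rls_cons]
    cases m with
    | zero => rfl
    | succ m => exact ih m (by simpa using hm)

theorem trEq (y : ℕ → K) : Tr (KD y) (KD y) (fun _ => Eq) where
  mono := fun _ _ _ h => h
  ng := by rintro _ _ _ rfl; rfl
  ps := by rintro _ _ _ rfl; rfl
  one := fun _ _ _ _ => rfl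
  mu := by rintro _ _ _ _ rfl; rfl

/-- cylinders of labels -/
def Cyl (b : Bool) (n : ℕ) (i : ℤ) : Set ℤ := {j | j ∈ par b ∧ ∀ d : ℤ, |d| ≤ n → lab (j + d) = lab (i + d)}

theorem RLs_refl (n : ℕ) (V : List (Bool × K)) : RLs (fun _ => (Eq : K → K → Prop)) n V V :=
  List.forall₂_same.2 (fun _ _ => ⟨rfl, rfl⟩)

theorem RLs_eq (n : ℕ) (V V' : List (Bool × K)) (h : RLs (fun _ => (Eq : K → K → Prop)) n V V') :
    V' = V := by
  induction h with
  | nil => rfl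
  | cons h1 _ ih => rw [ih]; congr 1; exact (Prod.ext h1.1 h1.2).symm

theorem aW_cyl (y : ℕ → K) (w : List (ℕ × Bool)) (b : Bool) (n : ℕ) (hn : w.length ≤ n) (i j : ℤ) (hi : i ∈ par b)
    (hj : j ∈ Cyl b n i) (k : K) (V : List (Bool × K)) :
    aW (KD y) lab w (j, k, V) = ((aW (KD y) lab w (i, k, V)).1 + (j - i),
      (aW (KD y) lab w (i, k, V)).2) := by
  have hδ : Even (j - i) := by
    have h1 := hj.1
    rw [Int.even_iff]
    simp only [par, Set.mem_ofPred_eq] at hi h1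
    omega
  have := (trEq y).aW (lab := lab) hδ (n := 0) w (p := (i, k, V)) (p' := (j, k, V))
    ⟨by simp, by
      intro d hd
      have := hj.2 d (by push_cast at hd; omega)
      simpa using this, rfl, RLs_refl _ _⟩
  refine Prod.ext this.idx (Prod.ext this.co.symm (RLs_eq _ _ _ this.ls))

theorem exists_apart (y : ℕ → K) (w : List (ℕ × Bool)) (hw : evalWord (genN Ap y) w ≠ 1) :
    ∃ (b : Bool) (n : ℕ) (i : ℤ) (k : K) (V : List (Bool × K)), i ∈ par b ∧
      ∀ j ∈ Cyl b n i, ∀ j' ∈ Cyl b n i, ∀ t t',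
        evalWord (genN Ap y) w (pt j k (rls V t)) ≠ pt j' k (rls V t') := by
  obtain ⟨p, hp⟩ : ∃ p, evalWord (genN Ap y) w p ≠ p := by
    by_contra hc
    push Not at hc
    exact hw (Equiv.ext hc)
  obtain ⟨i, k, u, rfl⟩ := pt_cases p
  obtain ⟨i2, k2, u2, he⟩ := pt_cases (evalWord (genN Ap y) w (pt i k u))
  obtain ⟨b, hb⟩ : ∃ b, i ∈ par b := by
    by_cases h : i ∈ par false
    · exact ⟨_, h⟩
    · exact ⟨true, mem_par_not.2 h⟩
  have key : ∀ (m n : ℕ), w.length ≤ n → ∃ (V W : List (Bool × K)) (t : Str (Ltr K)), m < V.length ∧ m < W.length ∧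
      u = rls V t ∧ u2 = rls W t ∧ ∀ j ∈ Cyl b n i, ∀ t,
        evalWord (genN Ap y) w (pt j k (rls V t)) = pt (j + (i2 - i)) k2 (rls W t) := by
    intro m n hn
    obtain ⟨V, t, hV, hu⟩ := exists_rls (5 + 2 * w.length + m + 1) u
    have h1 := aW_real y lab_iff w (i, k, V) (by simp only [hV]; omega) t
    rw [rp, rp] at h1
    simp only [← hu, he] at h1
    obtain ⟨e1, e2, e3⟩ := pt_inj.1 h1
    have hl := aW_len (KD y) lab w (i, k, V)
    simp only [hV] at hl
    refine ⟨V, (aW (KD y) lab w (i, k, V)).2.2, t, by omega, by omega, hu, e3.symm, ?_⟩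
    intro j hj t'
    have h2 := aW_real y lab_iff w (j, k, V) (by simp only [hV]; omega) t'
    rw [aW_cyl y w b n hn i j hb hj] at h2
    rw [rp, rp] at h2
    simp only at h2
    rw [← h2, e1, e2]
    congr 1; ring
  by_cases hi : i2 = i
  · subst hi
    by_cases hk : k2 = k
    · subst hk
      have hu : u2 ≠ u := by rintro rfl; exact hp he
      obtain ⟨m, hm⟩ : ∃ m, u2 m ≠ u m := by
        by_contra hc; push Not at hc; exact hu (funext hc)
      obtain ⟨V, W, t, hV, hW, e1, e2, h⟩ := key m w.length le_rfl
      refine ⟨b, w.length, i2, k2, V, hb, ?_⟩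
      intro j hj j' hj' s s' hs
      rw [h j hj] at hs
      obtain ⟨_, _, e⟩ := pt_inj.1 hs
      apply hm
      rw [e1, e2, rls_get W t s m hW, e, rls_get V s' t m hV]
    · obtain ⟨V, W, t, hV, hW, e1, e2, h⟩ := key 0 w.length le_rfl
      refine ⟨b, w.length, i2, k, V, hb, ?_⟩
      intro j hj j' hj' s s' hs
      rw [h j hj] at hs
      exact hk (pt_inj.1 hs).2.1
  · obtain ⟨d0, hd0⟩ := lab_aperiodic (i2 - i) (sub_ne_zero.2 hi)
    obtain ⟨V, W, t, hV, hW, e1, e2, h⟩ := key 0 (w.length + (d0 - i).natAbs + (i2 - i).natAbs) (by omega)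
    refine ⟨b, w.length + (d0 - i).natAbs + (i2 - i).natAbs, i, k, V, hb, ?_⟩
    intro j hj j' hj' s s' hs
    rw [h j hj] at hs
    have e := (pt_inj.1 hs).1
    apply hd0
    have f1 := hj'.2 (d0 - i) (by rw [Int.abs_eq_natAbs]; omega)
    have f2 := hj.2 (d0 - i + (i2 - i)) (by rw [Int.abs_eq_natAbs]; omega)
    rw [← e] at f1
    rw [show i + (d0 - i) = d0 by ring] at f1
    rw [show i + (d0 - i + (i2 - i)) = d0 + (i2 - i) by ring] at f2
    rw [← f1, ← f2]
    congr 1; ring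

variable {y : ℕ → K} {R : ℕ}

theorem cell_congr {E E' : Set ℤ} {g : Equiv.Perm (Str (Ltr K))} {N : Subgroup (Equiv.Perm (Om K))}
    (h1 : cell E' g ∈ N) (h : E = E') : cell E g ∈ N := h ▸ h1

theorem par_disj {b b' : Bool} (h : b' ≠ b) {j : ℤ} (h1 : j ∈ par b) (h2 : j ∈ par b') : False := by
  cases b <;> cases b' <;> simp [par] at * <;> omega

theorem Cyl_mem (b : Bool) (n : ℕ) (i : ℤ) : cell (Cyl b n i) (xp (Ltr K)) ∈ HH Ap y R := by
  have key : ∀ ds : List ℤ, cell {j | j ∈ par b ∧ ∀ d ∈ ds, lab (j + d) = lab (i + d)} (xp (Ltr K)) ∈ HH Ap y R := by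
    intro ds
    induction ds with
    | nil =>
      have : {j | j ∈ par b ∧ ∀ d ∈ ([] : List ℤ), lab (j + d) = lab (i + d)} = par b := by ext j; simp
      rw [this]; exact cpar_mem b
    | cons d ds ih =>
      set E := {j | j ∈ par b ∧ ∀ d ∈ ds, lab (j + d) = lab (i + d)} with hE
      have hEb : E ⊆ par b := fun j hj => hj.1
      obtain ⟨b', h1, h2⟩ := mem_shift (nrm_self (Ap := Ap) (y := y) (R := R)) d Ap_sub cAp_mem
      by_cases hb : b' = b
      · subst hb
        have hI := mem_inter nrm_self hEb h1 ih h2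
        by_cases hl : i + d ∈ Ap
        · refine cell_congr (hI) ?_
          ext j
          simp only [List.forall_mem_cons, hE, Set.mem_ofPred_eq, Set.mem_inter_iff]
          rw [(lab_iff _).1 hl, lab_iff]; tauto
        · have hI2 := mem_diff nrm_self ih hI Set.inter_subset_left
          refine cell_congr (hI2) ?_
          ext j
          rw [lab_iff] at hl
          simp only [List.forall_mem_cons, hE, Set.mem_ofPred_eq, Set.mem_inter_iff, Set.mem_sdiff]
          rw [Bool.eq_false_iff.2 hl, lab_iff, Bool.eq_false_iff]; tauto
      · by_cases hl : i + d ∈ Ap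
        · refine cell_congr (mem_empty (nrm_self (Ap := Ap) (y := y) (R := R)) (xp (Ltr K))) ?_
          ext j
          simp only [List.forall_mem_cons, Set.mem_ofPred_eq, Set.mem_empty_iff_false, iff_false]
          rintro ⟨h3, h4, _⟩
          rw [(lab_iff _).1 hl, ← lab_iff] at h4
          exact par_disj hb h3 (h1 h4)
        · refine cell_congr (ih) ?_
          ext j
          simp only [List.forall_mem_cons, hE, Set.mem_ofPred_eq]
          rw [lab_iff] at hl
          rw [Bool.eq_false_iff.2 hl, Bool.eq_false_iff]
          constructor
          · tauto
          · rintro ⟨h3, h4⟩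
            refine ⟨h3, ?_, h4⟩
            intro h5
            rw [← lab_iff] at h5
            exact par_disj hb h3 (h1 h5)
  have := key ((Finset.Icc (-(n : ℤ)) n).toList)
  refine cell_congr (this) ?_
  ext j
  simp [Cyl, abs_le]

theorem win_bot (b : Bool) (g : Equiv.Perm (Str (Ltr K))) : win b (sub ⊥ g) = cell (par b) g := by
  apply cell_ext
  · intro i hi u
    rw [← wi_bot, win_wi hi, sub_cons, wi_bot]
  · intro i k u h
    by_cases hx : wx b (pt i k u) ∈ par b
    · obtain ⟨q, hq⟩ := exists_wi _ hx
      rw [← hq, win_wi hx]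
      obtain ⟨s, v, rfl⟩ := exists_cons q
      rw [sub_ne]
      rintro rfl
      rw [wi_bot] at hq
      obtain ⟨e1, e2, e3⟩ := pt_inj.1 hq
      exact h ⟨e1 ▸ hx, e2.symm⟩
    · exact win_out hx _

theorem win_top (b : Bool) (g : Equiv.Perm (Str (Ltr K))) : win b (sub ⊤ g) = cell (par (!b)) g := by
  apply cell_ext
  · intro i hi u
    have hi' : i - 1 ∈ par b := by rw [mem_par_pred]; exact mem_par_not.1 hi
    have e : pt i 1 u = wi (i - 1) (cons ⊤ u) := by rw [wi_top]; simp
    rw [e, win_wi hi', sub_cons, wi_top]; simp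
  · intro i k u h
    by_cases hx : wx b (pt i k u) ∈ par b
    · obtain ⟨q, hq⟩ := exists_wi _ hx
      rw [← hq, win_wi hx]
      obtain ⟨s, v, rfl⟩ := exists_cons q
      rw [sub_ne]
      rintro rfl
      rw [wi_top] at hq
      obtain ⟨e1, e2, e3⟩ := pt_inj.1 hq
      exact h ⟨e1 ▸ mem_par_succ'.2 hx, e2.symm⟩
    · exact win_out hx _

variable {N : Subgroup (Equiv.Perm (Om K))} (hN : Nrm Ap y R N) (hNH : N ≤ HH Ap y R)
include hN

theorem mem_disp {b : Bool} {C : Set ℤ} (hC : C ⊆ par b) (hCH : cell C (xp (Ltr K)) ∈ HH Ap y R)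
    (h : Equiv.Perm (Om K)) (hh : h ∈ N)
    (hd : ∀ j ∈ C, ∀ j' ∈ C, ∀ u u', h (pt j 1 u) ≠ pt j' 1 u') : cell C (xp (Ltr K)) ∈ N := by
  have hm : cell C (xm (Ltr K)) ∈ HH Ap y R := (mem_xm nrm_self hC).2 hCH
  have ht : cell C (xt (Ltr K)) ∈ HH Ap y R := (mem_xt nrm_self hC).2 hCH
  have key : ∀ g1 g2, cell C g1 ∈ HH Ap y R → cell C g2 ∈ HH Ap y R →
      cell C (g1 * g2 * g1⁻¹ * g2⁻¹) ∈ N := by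
    intro g1 g2 h1 h2
    have hc : Commute (h * (cell C g1)⁻¹ * h⁻¹) (cell C g2) := by
      apply Equiv.Perm.Disjoint.commute
      intro x
      obtain ⟨i, k, u, rfl⟩ := pt_cases x
      by_cases hx : i ∈ C ∧ k = 1
      · left
        obtain ⟨hi, rfl⟩ := hx
        obtain ⟨i2, k2, u2, e⟩ := pt_cases (h⁻¹ (pt i 1 u))
        have e' : h (pt i2 k2 u2) = pt i 1 u := by rw [← e]; exact h.apply_symm_apply _
        rw [Equiv.Perm.mul_apply, Equiv.Perm.mul_apply, e, ← map_inv, cell_out, e']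
        rintro ⟨h3, rfl⟩
        exact hd _ h3 _ hi _ _ e'
      · right; exact cell_out _ hx _
    have h3 : cell C g1 * (h * (cell C g1)⁻¹ * h⁻¹) ∈ N := by
      have : cell C g1 * (h * (cell C g1)⁻¹ * h⁻¹) = (cell C g1 * h * (cell C g1)⁻¹) * h⁻¹ := by group
      rw [this]
      exact mul_mem (hN _ h1 _ hh) (inv_mem hh)
    have h4 := hN.comm_left h2 h3
    have e : ∀ a a' c : Equiv.Perm (Om K), Commute a' c →
        a * a' * c * (a * a')⁻¹ * c⁻¹ = a * c * a⁻¹ * c⁻¹ := by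
      intro a a' c hc
      rw [mul_assoc a a' c, hc.eq]; group
    rw [e _ _ _ hc] at h4
    simpa only [map_mul, map_inv] using h4
  apply mem_of_comm hN hC hm
  · apply key _ _ _ hm
    simp only [map_mul, map_inv]
    exact mul_mem (mul_mem (inv_mem hCH) (inv_mem ht)) (mul_mem hCH hCH)
  · have := key (xm (Ltr K))⁻¹ ((xp (Ltr K))⁻¹ * (xt (Ltr K))⁻¹ * xp (Ltr K)) (by rw [map_inv]; exact inv_mem hm)
      (by
        simp only [map_mul, map_inv]
        exact mul_mem (mul_mem (inv_mem hCH) (inv_mem ht)) hCH)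
    simpa only [inv_inv] using this

include hNH

theorem mem_par_of_cyl {b : Bool} {n : ℕ} {i : ℤ} (hi : i ∈ par b)
    (h : cell (Cyl b n i) (xp (Ltr K)) ∈ N) (b' : Bool) : cell (par b') (xp (Ltr K)) ∈ N := by
  have hCb : Cyl b n i ⊆ par b := fun j hj => hj.1
  have key : ∀ m : ℕ, cell {j | j ∈ par b ∧ ∃ s : ℕ, s < m ∧ j + s ∈ Cyl b n i} (xp (Ltr K)) ∈ N := by
    intro m
    induction m with
    | zero =>
      refine cell_congr (mem_empty hN (xp (Ltr K))) ?_
      ext j; simp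
    | succ m ih =>
      set U := {j | j ∈ par b ∧ ∃ s : ℕ, s < m ∧ j + s ∈ Cyl b n i} with hU
      have hUb : U ⊆ par b := fun j hj => hj.1
      obtain ⟨b1, h1, h2⟩ := mem_shift hN m hCb h
      by_cases hb : b1 = b
      · subst hb
        have h3 := mem_inter hN h1 hUb h2 (hNH ih)
        have h4 := mem_diff hN h2 h3 Set.inter_subset_left
        have h5 := mem_union_disj hN ih h4 (by
          rw [Set.disjoint_left]
          intro j h6 h7
          exact h7.2 ⟨h7.1, h6⟩)
        refine cell_congr (h5) ?_
        ext j
        simp only [Set.mem_union, Set.mem_sdiff, Set.mem_inter_iff]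
        constructor
        · rintro ⟨h6, s, hs, h7⟩
          by_cases hj : j ∈ U
          · exact Or.inl hj
          · right
            have : s = m := by
              by_contra hc
              exact hj ⟨h6, s, by omega, h7⟩
            subst this
            exact ⟨h7, fun h => hj h.2⟩
        · rintro (⟨h6, s, hs, h7⟩ | ⟨h6, _⟩)
          · exact ⟨h6, s, by omega, h7⟩
          · exact ⟨h1 h6, m, by omega, h6⟩
      · refine cell_congr (ih) ?_
        ext j
        constructor
        · rintro ⟨h6, s, hs, h7⟩
          refine ⟨h6, s, ?_, h7⟩
          by_contra hc
          have : s = m := by omega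
          subst this
          exact par_disj hb h6 (h1 h7)
        · rintro ⟨h6, s, hs, h7⟩
          exact ⟨h6, s, by omega, h7⟩
  have hb : cell (par b) (xp (Ltr K)) ∈ N := by
    obtain ⟨B, hB, ht⟩ := lab_toeplitz n i
    refine cell_congr (key (2 ^ B)) ?_
    ext j
    constructor
    · intro hj
      refine ⟨hj, ((i - j) % 2 ^ B).toNat, ?_, ?_⟩
      · have := Int.emod_lt_of_pos (i - j) (b := 2 ^ B) (by positivity)
        have h0 := Int.emod_nonneg (i - j) (b := 2 ^ B) (by positivity)
        zify
        rw [Int.toNat_of_nonneg h0]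
        exact this
      · have h0 := Int.emod_nonneg (i - j) (b := 2 ^ B) (by positivity)
        rw [Int.toNat_of_nonneg h0]
        have e : j + (i - j) % 2 ^ B = i + 2 ^ B * (-((i - j) / 2 ^ B)) := by
          have := Int.emod_add_mul_ediv (i - j) (2 ^ B)
          linarith
        rw [e]
        refine ⟨?_, fun d hd => ht _ d hd⟩
        obtain ⟨c, rfl⟩ : ∃ c, B = c + 1 := ⟨B - 1, by omega⟩
        rw [pow_succ']
        simp only [par, Set.mem_ofPred_eq] at hi ⊢
        rw [← hi, mul_assoc]
        omega
    · exact fun h => h.1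
  by_cases hbb : b' = b
  · rw [hbb]; exact hb
  · obtain ⟨_, _, h2⟩ := mem_shift hN 1 (fun _ h => h) hb
    refine cell_congr (h2) ?_
    ext j
    simp only [Set.mem_ofPred_eq]
    rw [mem_par_succ]
    have : b' = !b := by cases b <;> cases b' <;> simp at hbb ⊢
    rw [this, mem_par_not]

theorem HH_le (hb : ∀ b, cell (par b) (xp (Ltr K)) ∈ N) : HH Ap y R ≤ N := by
  have hA : cell Ap (xp (Ltr K)) ∈ N := by
    have := mem_inter hN (fun _ h => h) Ap_sub (hb true) cAp_mem
    rwa [Set.inter_eq_right.2 Ap_sub] at this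
  have hX : ∀ b, XX K b ∈ N := by
    intro b
    have h := congrArg (win b) (pentagon (S := Ltr K))
    rw [map_mul, map_mul, map_mul, win_bot, win_top] at h
    have e : XX K b = ((XX K b)⁻¹ * cell (par (!b)) (xp (Ltr K)) * XX K b) * cell (par b) (xp (Ltr K)) := by
      have : (XX K b)⁻¹ * (XX K b * XX K b) = (XX K b)⁻¹ * (cell (par (!b)) (xp (Ltr K)) * XX K b * cell (par b) (xp (Ltr K))) := by
        rw [XX]; rw [h]
      rw [inv_mul_cancel_left] at this
      nth_rewrite 1 [this]
      group
    rw [e]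
    exact mul_mem ((hN.conj_iff' (XX_mem b)).2 (hb _)) (hb _)
  rw [HH, Subgroup.closure_le]
  rintro _ ⟨⟨n, hn⟩, rfl⟩
  match n, hn with
  | 0, _ => exact hX false
  | 1, _ => exact hX true
  | 2, _ => exact hb false
  | 3, _ => exact hb true
  | 4, _ => exact hA
  | n + 5, hn =>
    have hc : cell (par false) (bet (TT (y n))) ∈ HH Ap y R := genN_mem (n := n + 5) hn
    change cell (par false) (bet (TT (y n))) ∈ N
    have h := congrArg (cell (par false)) (bet_commutator (TT (y n)))
    have hx := hb false
    have ht := (mem_xt hN (fun _ h => h)).2 hx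
    simp only [map_mul, map_inv] at h
    set c := cell (par false) (bet (TT (y n)))
    set x := cell (par false) (xp (Ltr K))
    set t := cell (par false) (xt (Ltr K))
    have h2 : c⁻¹ * (t * t * c * (t * t)⁻¹) ∈ N := by
      have : c⁻¹ * (t * t * c * (t * t)⁻¹) = (c⁻¹ * (t * t) * c) * (t * t)⁻¹ := by group
      rw [this]
      exact mul_mem ((hN.conj_iff' hc).2 (mul_mem ht ht)) (inv_mem (mul_mem ht ht))
    rw [← h] at h2
    exact (hN.conj_iff (hNH (mul_mem hx hx))).1 h2

omit hN hNH

theorem HH_simple (hy : Subgroup.closure (y '' {n | n < R}) = ⊤) : IsSimpleGroup (HH Ap y R) := by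
  have hnt : XX K false ≠ 1 := by
    intro h
    have h0 : (0 : ℤ) ∈ par false := by simp [par]
    have := XX_bt (K := K) h0 (fun _ => ⊥)
    rw [h, Equiv.Perm.one_apply] at this
    have := (pt_inj.1 this).1
    omega
  have : Nontrivial (HH Ap y R) :=
    ⟨⟨⟨XX K false, XX_mem _⟩, 1, fun h => hnt (congrArg Subtype.val h)⟩⟩
  refine ⟨fun N' hN' => ?_⟩
  by_cases hbot : N' = ⊥
  · exact Or.inl hbot
  right
  obtain ⟨⟨h, hh⟩, hm, hne⟩ : ∃ a : HH Ap y R, a ∈ N' ∧ a ≠ 1 := by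
    by_contra hc
    push Not at hc
    exact hbot ((Subgroup.eq_bot_iff_forall _).2 hc)
  set N := N'.map (HH Ap y R).subtype with hNd
  have hmem : ∀ (g : Equiv.Perm (Om K)) (hg : g ∈ HH Ap y R), g ∈ N ↔ (⟨g, hg⟩ : HH Ap y R) ∈ N' := by
    intro g hg
    constructor
    · rintro ⟨⟨a, ha⟩, h1, rfl⟩; exact h1
    · intro h1; exact ⟨_, h1, rfl⟩
  have hNH : N ≤ HH Ap y R := by rintro _ ⟨⟨a, ha⟩, h1, rfl⟩; exact ha
  have hN : Nrm Ap y R N := by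
    intro a ha c hc
    have hcH := hNH hc
    rw [hmem _ (mul_mem (mul_mem ha hcH) (inv_mem ha))]
    exact hN'.conj_mem ⟨c, hcH⟩ ((hmem c hcH).1 hc) ⟨a, ha⟩
  have hhN : h ∈ N := (hmem h hh).2 hm
  have hh1 : h ≠ 1 := fun e => hne (Subtype.ext e)
  obtain ⟨w, _, hw⟩ := exists_word (genN Ap y) (R + 5) h hh
  obtain ⟨b, n, i, k, V, hi, hap⟩ := exists_apart y w (by rw [hw]; exact hh1)
  rw [hw] at hap
  obtain ⟨f, hf, d, hfd⟩ := exists_strip (Ap := Ap) hy (V.map rl) b k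
  have hCb : Cyl b n i ⊆ par b := fun j hj => hj.1
  obtain ⟨b', hb', hC⟩ := mem_shift (nrm_self (Ap := Ap) (y := y) (R := R)) (-d) hCb (Cyl_mem b n i)
  have h1 := mem_disp hN hb' hC (f * h * f⁻¹) (hN f hf h hhN) (by
    intro j hj j' hj' u u' he
    apply hap _ hj _ hj' u u'
    have e1 := hfd _ hj.1 u
    have e2 := hfd _ hj'.1 u'
    rw [neg_add_cancel_right] at e1 e2
    rw [← e1, ← e2, Equiv.Perm.mul_apply, Equiv.Perm.mul_apply] at he
    have := f.injective he
    rw [← Equiv.Perm.mul_apply f⁻¹ f, inv_mul_cancel, Equiv.Perm.one_apply] at this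
    exact this)
  obtain ⟨_, _, h2⟩ := mem_shift hN d hb' h1
  have h3 : cell (Cyl b n i) (xp (Ltr K)) ∈ N := by
    refine cell_congr (h2) ?_
    ext j; simp
  have h4 := HH_le hN hNH (mem_par_of_cyl hN hNH hi h3)
  rw [eq_top_iff]
  rintro ⟨g, hg⟩ _
  exact (hmem g hg).1 (h4 hg)

end Simple
end SimpEmb

set_option linter.unusedSectionVars false
set_option linter.unusedSimpArgs false
namespace SimpEmb
/-! ### Distortion and conjugacy -/
section Balls
variable {K : Type*} [Group K]

/-- balls in a group with respect to a sequence of generators -/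
def Bl (y : ℕ → K) : ℕ → Set K
  | 0 => {1}
  | L + 1 => {g | g ∈ Bl y L ∨ ∃ r, ∃ h ∈ Bl y L, g = yb y r * h}

variable {y : ℕ → K}

theorem Bl_succ {L : ℕ} {g : K} (h : g ∈ Bl y L) : g ∈ Bl y (L + 1) := Or.inl h

theorem Bl_mul {L : ℕ} {g : K} (r : ℕ × Bool) (h : g ∈ Bl y L) : yb y r * g ∈ Bl y (L + 1) :=
  Or.inr ⟨r, g, h, rfl⟩

theorem Bl_one (L : ℕ) : (1 : K) ∈ Bl y L := by
  induction L with
  | zero => rfl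
  | succ L ih => exact Bl_succ ih

theorem Bl_mono {L M : ℕ} (h : L ≤ M) : Bl y L ⊆ Bl y M := by
  induction h with
  | refl => exact fun _ h => h
  | step _ ih => exact fun g hg => Bl_succ (ih hg)

theorem Bl_finite (hy : (Set.range y).Finite) (L : ℕ) : (Bl y L).Finite := by
  induction L with
  | zero => exact Set.finite_singleton _
  | succ L ih =>
    have h1 : (Set.range (yb y)).Finite := by
      apply (hy.union (hy.image (fun g => g⁻¹))).subset
      rintro _ ⟨⟨n, e⟩, rfl⟩
      cases e
      · right; exact ⟨y n, ⟨n, rfl⟩, by simp [yb]⟩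
      · left; exact ⟨n, by simp [yb]⟩
    apply (ih.union (Set.Finite.image2 (fun a b => a * b) h1 ih)).subset
    rintro g (h | ⟨r, h, hh, rfl⟩)
    · exact Or.inl h
    · exact Or.inr ⟨_, ⟨r, rfl⟩, h, hh, rfl⟩

theorem evalWord_mem_Bl (w : List (ℕ × Bool)) : evalWord y w ∈ Bl y w.length := by
  induction w with
  | nil => simp [evalWord, Bl]
  | cons r w ih => rw [evalWord_cons]; exact Bl_mul r ih

theorem Bl_word {L : ℕ} {g : K} (h : g ∈ Bl y L) : ∃ w : List (ℕ × Bool), w.length ≤ L ∧ evalWord y w = g := by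
  induction L generalizing g with
  | zero => exact ⟨[], le_rfl, by rw [h]; simp [evalWord]⟩
  | succ L ih =>
    rcases h with h | ⟨r, h, hh, rfl⟩
    · obtain ⟨w, h1, h2⟩ := ih h; exact ⟨w, by omega, h2⟩
    · obtain ⟨w, h1, h2⟩ := ih hh
      exact ⟨r :: w, by simpa using h1, by rw [evalWord_cons, h2]; rfl⟩

variable [LinearOrder K] [MulLeftStrictMono K] [NoMaxOrder K]

theorem exists_huge (S : Set K) (hS : S.Finite) (κ0 : K) : ∃ κ, κ0 < κ ∧ ∀ c ∈ S, 1 < c * κ := by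
  obtain ⟨κ1, h1⟩ := ((hS.image (fun c => c⁻¹)).insert κ0).bddAbove
  obtain ⟨κ, h2⟩ := exists_gt κ1
  refine ⟨κ, (h1 (Set.mem_insert _ _)).trans_lt h2, fun c hc => ?_⟩
  have := (h1 (Set.mem_insert_of_mem _ ⟨c, hc, rfl⟩)).trans_lt h2
  have := mul_lt_mul_right this c
  simpa using this

theorem trHuge {κ κ' : K} {L : ℕ} (h1 : ∀ c ∈ Bl y L, 1 < c * κ)
    (h2 : ∀ c ∈ Bl y L, 1 < c * κ') : Tr (KD y) (KD y)
      (fun n k k' => k = k' ∨ (n ≤ L ∧ ∃ c ∈ Bl y (L - n), k = c * κ ∧ k' = c * κ')) where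
  mono := by
    rintro n k k' (h | ⟨hn, c, hc, h⟩)
    · exact Or.inl h
    · exact Or.inr ⟨by omega, c, Bl_mono (by omega) hc, h⟩
  ng := by
    rintro n k k' (rfl | ⟨hn, c, hc, rfl, rfl⟩)
    · rfl
    · have e1 := h1 c (Bl_mono (by omega) hc)
      have e2 := h2 c (Bl_mono (by omega) hc)
      simp [KD, not_lt.2 e1.le, not_lt.2 e2.le]
  ps := by
    rintro n k k' (rfl | ⟨hn, c, hc, rfl, rfl⟩)
    · rfl
    · have e1 := h1 c (Bl_mono (by omega) hc)
      have e2 := h2 c (Bl_mono (by omega) hc)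
      simp [KD, e1, e2]
  one := fun _ _ _ _ => Or.inl rfl
  mu := by
    rintro n k k' r (rfl | ⟨hn, c, hc, rfl, rfl⟩)
    · exact Or.inl rfl
    · refine Or.inr ⟨by omega, yb y r * c, ?_, by simp [KD, mul_assoc], by simp [KD, mul_assoc]⟩
      have := Bl_mul r hc
      rwa [show L - (n + 1) + 1 = L - n by omega] at this

/-- comparing two huge points -/
theorem huge_pts {κ κ' : K} (w : List (ℕ × Bool)) (h1 : ∀ c ∈ Bl y w.length, 1 < c * κ)
    (h2 : ∀ c ∈ Bl y w.length, 1 < c * κ') :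
    ∃ (j : ℤ) (k k' : K) (u v v' : Str (Ltr K)),
      evalWord (genN Ap y) w (pt 1 κ u) = pt j k v ∧ evalWord (genN Ap y) w (pt 1 κ' u) = pt j k' v' ∧
      (k = k' ∨ ∃ c ∈ Bl y w.length, k = c * κ ∧ k' = c * κ') := by
  set V : List (Bool × K) := List.replicate (5 + 2 * w.length) (false, 1)
  set u : Str (Ltr K) := fun _ => ⊥
  have hV : V.length = 5 + 2 * w.length := by simp [V]
  have r1 := aW_real y lab_iff w (1, κ, V) (by simp [hV]) u
  have r2 := aW_real y lab_iff w (1, κ', V) (by simp [hV]) u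
  have t := (trHuge h1 h2).aW (lab := lab) (δ := 0) (by simp) (n := 0) w (p := (1, κ, V)) (p' := (1, κ', V))
    ⟨by simp, by simp, by
      right
      refine ⟨by simp, 1, Bl_one _, by simp, by simp⟩, List.forall₂_same.2 (fun _ _ => ⟨rfl, Or.inl rfl⟩)⟩
  refine ⟨(aW (KD y) lab w (1, κ, V)).1, (aW (KD y) lab w (1, κ, V)).2.1,
    (aW (KD y) lab w (1, κ', V)).2.1, rls V u, rls (aW (KD y) lab w (1, κ, V)).2.2 u,
    rls (aW (KD y) lab w (1, κ', V)).2.2 u, r1.symm, ?_, ?_⟩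
  · have e := t.idx
    rw [add_zero] at e
    rw [← e]; exact r2.symm
  · rcases t.co with h | ⟨_, c, hc, h⟩
    · exact Or.inl h
    · exact Or.inr ⟨c, by simpa using hc, h⟩

theorem tau_undistorted (hfin : (Set.range y).Finite) (a : K) (w : List (ℕ × Bool))
    (h : evalWord (genN Ap y) w = tau true a) : a ∈ Bl y w.length := by
  obtain ⟨κ, -, h1⟩ := exists_huge _ (Bl_finite hfin w.length) 1
  obtain ⟨κ', hk, h2⟩ := exists_huge _ (Bl_finite hfin w.length) κ
  obtain ⟨j, k, k', u, v, v', e1, e2, e3⟩ := huge_pts w h1 h2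
  have ho : (1 : ℤ) ∈ par true := by simp [par]
  rw [h, tau_in ho] at e1 e2
  obtain ⟨-, rfl, -⟩ := pt_inj.1 e1
  obtain ⟨-, rfl, -⟩ := pt_inj.1 e2
  rcases e3 with e | ⟨c, hc, e, -⟩
  · exact absurd (mul_left_cancel e) hk.ne
  · rw [mul_right_cancel e]; exact hc

theorem tau_injective : Function.Injective (tau true : K →* Equiv.Perm (Om K)) := by
  rw [injective_iff_map_eq_one]
  intro a ha
  have ho : (1 : ℤ) ∈ par true := by simp [par]
  have := tau_in ho a 1 (fun _ => ⊥)
  rw [ha, Equiv.Perm.one_apply] at this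
  simpa using (pt_inj.1 this).2.1.symm

theorem tau_frattini (hfin : (Set.range y).Finite) (a b : K) (w : List (ℕ × Bool))
    (h : evalWord (genN Ap y) w * tau true a = tau true b * evalWord (genN Ap y) w) : IsConj a b := by
  obtain ⟨κ, -, h1⟩ := exists_huge (Bl y w.length ∪ (fun c => c * a) '' (Bl y w.length))
    ((Bl_finite hfin w.length).union ((Bl_finite hfin w.length).image _)) 1
  obtain ⟨j, k, k', u, v, v', e1, e2, e3⟩ := huge_pts (y := y) (κ := κ) (κ' := a * κ) w
    (fun c hc => h1 c (Or.inl hc)) (fun c hc => by rw [← mul_assoc]; exact h1 _ (Or.inr ⟨c, hc, rfl⟩))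
  have ho : (1 : ℤ) ∈ par true := by simp [par]
  have e := congrArg (fun f => f (pt 1 κ u)) h
  simp only [Equiv.Perm.mul_apply] at e
  rw [tau_in ho, e1, e2] at e
  have triv : a = 1 → IsConj a b := by
    rintro rfl
    rw [map_one, mul_one] at h
    have h3 : tau true b = 1 := mul_eq_right.1 h.symm
    have : b = 1 := tau_injective (by rw [h3, map_one])
    rw [this]
  by_cases hj : j ∈ par true
  · rw [tau_in hj] at e
    have ek := (pt_inj.1 e).2.1
    rcases e3 with rfl | ⟨c, hc, rfl, rfl⟩
    · have hb : b = 1 := mul_eq_right.1 ek.symm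
      rw [hb, map_one, one_mul] at h
      have h3 : tau true a = 1 := mul_eq_left.1 h
      exact triv (tau_injective (by rw [h3, map_one]))
    · rw [isConj_iff]
      refine ⟨c, ?_⟩
      rw [← mul_assoc, ← mul_assoc] at ek
      rw [mul_right_cancel ek]; group
  · rw [tau_out hj, ← e1, ← e2] at e
    have := (pt_inj.1 ((evalWord (genN Ap y) w).injective e)).2.1
    exact triv (mul_eq_right.1 this)

end Balls
end SimpEmb

set_option linter.unusedSectionVars false
set_option linter.unusedSimpArgs false
namespace SimpEmb
/-! ### Computability library -/
attribute [fun_prop] Computable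
section CompLib
variable {α β γ σ : Type*} [Primcodable α] [Primcodable β] [Primcodable γ] [Primcodable σ]
@[fun_prop] theorem C_id : Computable (fun a : α => a) := Computable.id
@[fun_prop] theorem C_const (b : β) : Computable (fun _ : α => b) := Computable.const b
@[fun_prop] theorem C_comp {f : β → γ} {g : α → β} (hf : Computable f) (hg : Computable g) :
    Computable (fun a => f (g a)) := hf.comp hg
@[fun_prop] theorem C_pair {f : α → β} {g : α → γ} (hf : Computable f) (hg : Computable g) :
    Computable (fun a => (f a, g a)) := hf.pair hg
@[fun_prop] theorem C_fst {f : α → β × γ} (hf : Computable f) :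
    Computable (fun a => (f a).1) := Computable.fst.comp hf
@[fun_prop] theorem C_snd {f : α → β × γ} (hf : Computable f) :
    Computable (fun a => (f a).2) := Computable.snd.comp hf
@[fun_prop] theorem C_cond {c : α → Bool} {f g : α → β} (hc : Computable c) (hf : Computable f)
    (hg : Computable g) : Computable (fun a => bif c a then f a else g a) := Computable.cond hc hf hg
@[fun_prop] theorem C_elim {o : α → Option β} {f : α → γ} {g : α → β → γ} (hc : Computable o)
    (hf : Computable f) (hg : Computable (fun p : α × β => g p.1 p.2)) :
    Computable (fun a => (o a).elim (f a) (g a)) :=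
  (Computable.option_casesOn hc hf hg).of_eq (fun a => by cases o a <;> rfl)
@[fun_prop] theorem C_some {f : α → β} (hf : Computable f) :
    Computable (fun a => some (f a)) := Computable.option_some.comp hf
theorem C_prim₁ {h : β → γ} (hh : Primrec h) {f : α → β} (hf : Computable f) :
    Computable (fun a => h (f a)) := hh.to_comp.comp hf
theorem C_prim₂ {h : β → γ → σ} (hh : Primrec₂ h) {f : α → β} {g : α → γ} (hf : Computable f)
    (hg : Computable g) : Computable (fun a => h (f a) (g a)) :=
  (hh.to_comp).comp hf hg

/-! booleans -/
@[fun_prop] theorem C_and {f g : α → Bool} (hf : Computable f) (hg : Computable g) :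
    Computable (fun a => f a && g a) := C_prim₂ Primrec.and hf hg
@[fun_prop] theorem C_or {f g : α → Bool} (hf : Computable f) (hg : Computable g) :
    Computable (fun a => f a || g a) := C_prim₂ Primrec.or hf hg
@[fun_prop] theorem C_not {f : α → Bool} (hf : Computable f) :
    Computable (fun a => !f a) := C_prim₁ Primrec.not hf
@[fun_prop] theorem C_eq [DecidableEq β] {f g : α → β} (hf : Computable f) (hg : Computable g) :
    Computable (fun a => decide (f a = g a)) :=
  C_prim₂ (h := fun a b : β => decide (a = b)) (PrimrecRel.decide Primrec.eq) hf hg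

/-! naturals -/
@[fun_prop] theorem C_nadd {f g : α → ℕ} (hf : Computable f) (hg : Computable g) :
    Computable (fun a => f a + g a) := C_prim₂ Primrec.nat_add hf hg
@[fun_prop] theorem C_nsub {f g : α → ℕ} (hf : Computable f) (hg : Computable g) :
    Computable (fun a => f a - g a) := C_prim₂ Primrec.nat_sub hf hg
@[fun_prop] theorem C_nmul {f g : α → ℕ} (hf : Computable f) (hg : Computable g) :
    Computable (fun a => f a * g a) := C_prim₂ Primrec.nat_mul hf hg
@[fun_prop] theorem C_nmod {f g : α → ℕ} (hf : Computable f) (hg : Computable g) :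
    Computable (fun a => f a % g a) := C_prim₂ Primrec.nat_mod hf hg
@[fun_prop] theorem C_ndiv {f g : α → ℕ} (hf : Computable f) (hg : Computable g) :
    Computable (fun a => f a / g a) := C_prim₂ Primrec.nat_div hf hg
@[fun_prop] theorem C_nlt {f g : α → ℕ} (hf : Computable f) (hg : Computable g) :
    Computable (fun a => decide (f a < g a)) :=
  C_prim₂ (h := fun a b : ℕ => decide (a < b)) (PrimrecRel.decide Primrec.nat_lt) hf hg
@[fun_prop] theorem C_nrec {f : α → ℕ} {g : α → β} {h : α → ℕ → β → β} (hf : Computable f)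
    (hg : Computable g) (hh : Computable (fun p : α × ℕ × β => h p.1 p.2.1 p.2.2)) :
    Computable (fun a => Nat.rec (motive := fun _ => β) (g a) (h a) (f a)) :=
  (Computable.nat_rec (h := fun a p => h a p.1 p.2) hf hg hh).of_eq (fun _ => rfl)
@[fun_prop] theorem C_npow {f g : α → ℕ} (hf : Computable f) (hg : Computable g) :
    Computable (fun a => f a ^ g a) := by
  have : Computable (fun a => Nat.rec (motive := fun _ => ℕ) 1 (fun _ r => r * f a) (g a)) := by fun_prop
  refine this.of_eq (fun a => ?_)
  generalize g a = m
  induction m with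
  | zero => rfl
  | succ m ih => rw [pow_succ, ← ih]
@[fun_prop] theorem C_unpair {f : α → ℕ} (hf : Computable f) :
    Computable (fun a => Nat.unpair (f a)) := C_prim₁ Primrec.unpair hf
@[fun_prop] theorem C_npair {f g : α → ℕ} (hf : Computable f) (hg : Computable g) :
    Computable (fun a => Nat.pair (f a) (g a)) := C_prim₂ Primrec₂.natPair hf hg
@[fun_prop] theorem C_encode {f : α → β} (hf : Computable f) :
    Computable (fun a => Encodable.encode (f a)) := C_prim₁ Primrec.encode hf
@[fun_prop] theorem C_decode {f : α → ℕ} (hf : Computable f) :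
    Computable (fun a => (Encodable.decode (f a) : Option β)) := C_prim₁ Primrec.decode hf

/-! integers -/
theorem enc_ofNat (m : ℕ) : Encodable.encode (m : ℤ) = 2 * m := rfl
theorem enc_negSucc (m : ℕ) : Encodable.encode (Int.negSucc m) = 2 * m + 1 := rfl
@[fun_prop] theorem C_ofNat {f : α → ℕ} (hf : Computable f) :
    Computable (fun a => (f a : ℤ)) := by
  refine Computable.encode_iff.1 ?_
  simp only [enc_ofNat]; fun_prop
@[fun_prop] theorem C_toNat {f : α → ℤ} (hf : Computable f) :
    Computable (fun a => (f a).toNat) := by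
  have : Computable (fun a => bif decide (Encodable.encode (f a) % 2 = 0) then
      Encodable.encode (f a) / 2 else 0) := by fun_prop
  refine this.of_eq (fun a => ?_)
  rcases f a with m | m
  · have := enc_ofNat m
    simp only [Int.ofNat_eq_natCast, this]; simp
  · rw [enc_negSucc]; simp
theorem C_negNat {f : α → ℤ} (hf : Computable f) :
    Computable (fun a => (-(f a)).toNat) := by
  have : Computable (fun a => bif decide (Encodable.encode (f a) % 2 = 0) then
      0 else Encodable.encode (f a) / 2 + 1) := by fun_prop
  refine this.of_eq (fun a => ?_)
  rcases f a with m | m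
  · have := enc_ofNat m
    simp only [Int.ofNat_eq_natCast, this]; simp
  · rw [enc_negSucc, Int.neg_negSucc]
    have : (2 * m + 1) % 2 ≠ 0 := by omega
    simp only [this, decide_false, cond_false]
    have e : ((m.succ : ℕ) : ℤ).toNat = m + 1 := rfl
    rw [e]; omega
theorem C_subNat {f g : α → ℕ} (hf : Computable f) (hg : Computable g) :
    Computable (fun a => (f a : ℤ) - (g a : ℤ)) := by
  have : Computable (fun a => bif decide (f a < g a) then 2 * (g a - f a - 1) + 1 else 2 * (f a - g a)) := by
    fun_prop
  refine Computable.encode_iff.1 (this.of_eq (fun a => ?_))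
  by_cases h : f a < g a
  · have e : (f a : ℤ) - (g a : ℤ) = Int.negSucc (g a - f a - 1) := by omega
    rw [e, enc_negSucc]; simp [h]
  · have e : (f a : ℤ) - (g a : ℤ) = ((f a - g a : ℕ) : ℤ) := by omega
    rw [e, enc_ofNat]; simp [h]
@[fun_prop] theorem C_zadd {f g : α → ℤ} (hf : Computable f) (hg : Computable g) :
    Computable (fun a => f a + g a) := by
  have h1 := C_negNat hf
  have h2 := C_negNat hg
  refine (C_subNat (f := fun a => (f a).toNat + (g a).toNat)
    (g := fun a => (-(f a)).toNat + (-(g a)).toNat) (by fun_prop) (by fun_prop)).of_eq (fun a => ?_)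
  omega
@[fun_prop] theorem C_zneg {f : α → ℤ} (hf : Computable f) :
    Computable (fun a => -(f a)) := by
  have h1 := C_negNat hf
  refine (C_subNat (g := fun a => (f a).toNat) (f := fun a => (-(f a)).toNat)
    (by fun_prop) (by fun_prop)).of_eq (fun a => ?_)
  omega
@[fun_prop] theorem C_zsub {f g : α → ℤ} (hf : Computable f) (hg : Computable g) :
    Computable (fun a => f a - g a) := by
  simp only [sub_eq_add_neg]; fun_prop
@[fun_prop] theorem C_natAbs {f : α → ℤ} (hf : Computable f) :
    Computable (fun a => (f a).natAbs) := by
  have : Computable (fun a => (f a).toNat + (-(f a)).toNat) := by fun_prop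
  exact this.of_eq (fun a => by omega)
@[fun_prop] theorem C_zlt {f g : α → ℤ} (hf : Computable f) (hg : Computable g) :
    Computable (fun a => decide (f a < g a)) := by
  have : Computable (fun a => decide (0 < (g a - f a).toNat)) := by fun_prop
  exact this.of_eq (fun a => by simp)

/-! lists -/
@[fun_prop] theorem C_cons {f : α → β} {g : α → List β} (hf : Computable f) (hg : Computable g) :
    Computable (fun a => f a :: g a) := C_prim₂ Primrec.list_cons hf hg
@[fun_prop] theorem C_append {f : α → List β} {g : α → List β} (hf : Computable f) (hg : Computable g) :
    Computable (fun a => f a ++ g a) := C_prim₂ Primrec.list_append hf hg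
@[fun_prop] theorem C_length {f : α → List β} (hf : Computable f) :
    Computable (fun a => (f a).length) := C_prim₁ Primrec.list_length hf
@[fun_prop] theorem C_reverse {f : α → List β} (hf : Computable f) :
    Computable (fun a => (f a).reverse) := C_prim₁ Primrec.list_reverse hf
@[fun_prop] theorem C_range {f : α → ℕ} (hf : Computable f) :
    Computable (fun a => List.range (f a)) := C_prim₁ Primrec.list_range hf
@[fun_prop] theorem C_head? {f : α → List β} (hf : Computable f) :
    Computable (fun a => (f a).head?) := C_prim₁ Primrec.list_head? hf
@[fun_prop] theorem C_tail {f : α → List β} (hf : Computable f) :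
    Computable (fun a => (f a).tail) := C_prim₁ Primrec.list_tail hf
@[fun_prop] theorem C_get? {f : α → List β} {g : α → ℕ} (hf : Computable f) (hg : Computable g) :
    Computable (fun a => (f a)[g a]?) := C_prim₂ Primrec.list_getElem? hf hg

/-- case analysis on lists -/
def lc {β γ : Type*} (l : List β) (e : γ) (h : β → List β → γ) : γ :=
  l.head?.elim e (fun b => h b l.tail)
@[simp] theorem lc_nil (e : γ) (h : β → List β → γ) : lc [] e h = e := rfl
@[simp] theorem lc_cons (e : γ) (h : β → List β → γ) (b : β) (l : List β) : lc (b :: l) e h = h b l := rfl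
@[fun_prop] theorem C_lc {f : α → List β} {g : α → γ} {h : α → β → List β → γ} (hf : Computable f)
    (hg : Computable g) (hh : Computable (fun p : α × β × List β => h p.1 p.2.1 p.2.2)) :
    Computable (fun a => lc (f a) (g a) (h a)) := by
  have : Computable (fun p : α × β => h p.1 p.2 (f p.1).tail) :=
    hh.comp (f := fun p : α × β × List β => h p.1 p.2.1 p.2.2)
      (g := fun p : α × β => (p.1, p.2, (f p.1).tail)) (by fun_prop)
  unfold lc
  fun_prop

theorem foldr_rec (h : β → γ → γ) (e : γ) (l : List β) (m : ℕ) :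
    Nat.rec (motive := fun _ => γ) e (fun i r => (l[i]?).elim r (fun b => h b r)) m =
      (l.take m).foldl (fun r b => h b r) e := by
  induction m with
  | zero => simp
  | succ m ih =>
    simp only [ih, List.take_add_one, List.foldl_append]
    cases l[m]? <;> simp

@[fun_prop] theorem C_foldr {f : α → List β} {g : α → γ} {h : α → β → γ → γ} (hf : Computable f)
    (hg : Computable g) (hh : Computable (fun p : α × β × γ => h p.1 p.2.1 p.2.2)) :
    Computable (fun a => (f a).foldr (h a) (g a)) := by
  have h1 : Computable (fun p : (α × ℕ × γ) × β => h p.1.1 p.2 p.1.2.2) :=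
    hh.comp (f := fun p : α × β × γ => h p.1 p.2.1 p.2.2)
      (g := fun p : (α × ℕ × γ) × β => (p.1.1, p.2, p.1.2.2)) (by fun_prop)
  have : Computable (fun a => Nat.rec (motive := fun _ => γ) (g a)
      (fun i r => ((f a).reverse[i]?).elim r (fun b => h a b r)) (f a).length) := by fun_prop
  refine this.of_eq (fun a => ?_)
  rw [foldr_rec, ← List.length_reverse, List.take_length, List.foldl_reverse]

@[fun_prop] theorem C_map {f : α → List β} {h : α → β → γ} (hf : Computable f)
    (hh : Computable (fun p : α × β => h p.1 p.2)) : Computable (fun a => (f a).map (h a)) := by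
  have h1 : Computable (fun p : α × β × List γ => h p.1 p.2.1) :=
    hh.comp (f := fun p : α × β => h p.1 p.2) (g := fun p : α × β × List γ => (p.1, p.2.1)) (by fun_prop)
  have : Computable (fun a => (f a).foldr (fun b r => h a b :: r) []) := by fun_prop
  exact this.of_eq (fun a => by simp)

@[fun_prop] theorem C_flatMap {f : α → List β} {h : α → β → List γ} (hf : Computable f)
    (hh : Computable (fun p : α × β => h p.1 p.2)) : Computable (fun a => (f a).flatMap (h a)) := by
  have h1 : Computable (fun p : α × β × List γ => h p.1 p.2.1) :=
    hh.comp (f := fun p : α × β => h p.1 p.2) (g := fun p : α × β × List γ => (p.1, p.2.1)) (by fun_prop)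
  have : Computable (fun a => (f a).foldr (fun b r => h a b ++ r) []) := by fun_prop
  refine this.of_eq (fun a => ?_)
  induction f a with
  | nil => rfl
  | cons b l ih => simp [ih]

@[fun_prop] theorem C_all {f : α → List β} {h : α → β → Bool} (hf : Computable f)
    (hh : Computable (fun p : α × β => h p.1 p.2)) : Computable (fun a => (f a).all (h a)) := by
  have h1 : Computable (fun p : α × β × Bool => h p.1 p.2.1) :=
    hh.comp (f := fun p : α × β => h p.1 p.2) (g := fun p : α × β × Bool => (p.1, p.2.1)) (by fun_prop)
  have : Computable (fun a => (f a).foldr (fun b r => h a b && r) true) := by fun_prop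
  refine this.of_eq (fun a => ?_)
  induction f a with
  | nil => rfl
  | cons b l ih => simp [ih]

@[fun_prop] theorem C_any {f : α → List β} {h : α → β → Bool} (hf : Computable f)
    (hh : Computable (fun p : α × β => h p.1 p.2)) : Computable (fun a => (f a).any (h a)) := by
  have : Computable (fun a => !((f a).all (fun b => !(h a b)))) := by fun_prop
  refine this.of_eq (fun a => ?_)
  induction f a with
  | nil => rfl
  | cons b l ih => simp [ih]

@[fun_prop] theorem C_replicate {f : α → ℕ} {g : α → β} (hf : Computable f) (hg : Computable g) :
    Computable (fun a => List.replicate (f a) (g a)) := by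
  have : Computable (fun a => (List.range (f a)).map (fun _ => g a)) := by fun_prop
  exact this.of_eq (fun a => by simp)

/-- all lists of given length over an alphabet -/
def allL {β : Type*} (A : List β) (m : ℕ) : List (List β) :=
  Nat.rec (motive := fun _ => List (List β)) [[]] (fun _ r => A.flatMap (fun b => r.map (fun l => b :: l))) m

theorem mem_allL (A : List β) (l : List β) (h : ∀ b ∈ l, b ∈ A) : l ∈ allL A l.length := by
  induction l with
  | nil => simp [allL]
  | cons b l ih =>
    have := ih (fun b hb => h b (by simp [hb]))
    simp only [List.length_cons]
    show _ ∈ A.flatMap _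
    rw [List.mem_flatMap]
    exact ⟨b, h b (by simp), List.mem_map.2 ⟨l, this, rfl⟩⟩

@[fun_prop] theorem C_allL {f : α → List β} {g : α → ℕ} (hf : Computable f) (hg : Computable g) :
    Computable (fun a => allL (f a) (g a)) := by
  unfold allL
  fun_prop

@[fun_prop] theorem C_invW {f : α → List (ℕ × Bool)} (hf : Computable f) :
    Computable (fun a => invW (f a)) := by
  unfold invW; fun_prop

/-! the labels -/
theorem lab_any (j : ℤ) : lab j = (List.range (j + j + j + 1).natAbs).any (fun i =>
    decide ((j + j + j + 1).natAbs % 2 ^ (2 * i + 1) = 0) && !decide ((j + j + j + 1).natAbs % 2 ^ (2 * i + 2) = 0)) := by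
  have hd : ∀ m : ℕ, (2 : ℤ) ^ m ∣ 3 * j + 1 ↔ (j + j + j + 1).natAbs % 2 ^ m = 0 := by
    intro m
    rw [← Nat.dvd_iff_mod_eq_zero, ← Int.natCast_dvd, show j + j + j + 1 = 3 * j + 1 by ring]
    push_cast; rfl
  rw [Bool.eq_iff_iff, ← lab_iff, List.any_eq_true]
  show l2 _ ↔ _
  unfold l2
  simp only [hd, List.mem_range, Bool.and_eq_true, Bool.not_eq_true', decide_eq_true_eq, decide_eq_false_iff_not]
  constructor
  · rintro ⟨i, h1, h2⟩
    refine ⟨i, ?_, h1, h2⟩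
    have h3 := Nat.le_of_dvd (by omega) (Nat.dvd_of_mod_eq_zero h1)
    have h4 : 2 * i + 1 < 2 ^ (2 * i + 1) := Nat.lt_two_pow_self
    omega
  · rintro ⟨i, _, h1, h2⟩
    exact ⟨i, h1, h2⟩

@[fun_prop] theorem C_lab {f : α → ℤ} (hf : Computable f) : Computable (fun a => lab (f a)) := by
  have : Computable lab := by
    refine Computable.of_eq ?_ (fun j => (lab_any j).symm)
    fun_prop
  exact this.comp hf

@[fun_prop] theorem C_parB {b : α → Bool} {f : α → ℤ} (hb : Computable b) (hf : Computable f) :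
    Computable (fun a => parB (b a) (f a)) := by
  have : Computable (fun a => bif b a then decide ((f a).natAbs % 2 = 1) else decide ((f a).natAbs % 2 = 0)) := by
    fun_prop
  refine this.of_eq (fun a => ?_)
  unfold parB
  cases b a <;> simp only [cond_true, cond_false, decide_eq_decide] <;> omega
end CompLib
end SimpEmb

set_option linter.unusedSectionVars false
set_option linter.unusedSimpArgs false
namespace SimpEmb
/-! ### Computable orders from computable actions -/
section GenLem

/-- comparison sign -/
def csg {Ω : Type*} [LinearOrder Ω] (a b : Ω) : ℤ := if a < b then -1 else if a = b then 0 else 1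

theorem csg_eq_zero {Ω : Type*} [LinearOrder Ω] {a b : Ω} : csg a b = 0 ↔ a = b := by
  unfold csg
  split_ifs with h1 h2
  · simp [h1.ne]
  · simp [h2]
  · simp [h2]

theorem csg_self {Ω : Type*} [LinearOrder Ω] (a : Ω) : csg a a = 0 := csg_eq_zero.2 rfl

theorem csg_map {Ω Ω' : Type*} [LinearOrder Ω] [LinearOrder Ω'] {f : Ω → Ω'} (hf : StrictMono f) (a b : Ω) :
    csg (f a) (f b) = csg a b := by
  simp [csg, hf.lt_iff_lt, hf.injective.eq_iff]

variable {H : Type*} [Group H] {Ω : Type*} [LinearOrder Ω] (α : H →* Equiv.Perm Ω)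
  {C : Type*} [Primcodable C] (val : C → Ω)

/-- key of an element -/
noncomputable def key (h : H) (m : ℕ) : WithBot Ω :=
  (Encodable.decode m : Option C).elim ⊥ (fun c => ((α h (val c) : Ω) : WithBot Ω))

theorem gl (hα : ∀ h, StrictMono (α h)) (x : ℕ → H) (hx : ∀ h, ∃ w, evalWord x w = h)
    (s : List (ℕ × Bool) → C → ℤ) (hs : Computable (fun p : List (ℕ × Bool) × C => s p.1 p.2))
    (hsv : ∀ w c, s w c = csg (α (evalWord x w) (val c)) (val c))
    (test : List (ℕ × Bool) → List C) (ht : Computable test)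
    (htv : ∀ w, (∀ c ∈ test w, s w c = 0) → evalWord x w = 1) :
    ComputableLeftOrderWrt x := by
  have key_d : ∀ (h : H) (c : C), key α val h (Encodable.encode c) = ((α h (val c) : Ω) : WithBot Ω) := by
    intro h c; simp [key]
  have inj : Function.Injective (fun h : H => (toLex (key α val h) : Lex (ℕ → WithBot Ω))) := by
    intro h h' e
    obtain ⟨w, hw⟩ := hx (h'⁻¹ * h)
    have e1 : ∀ c, s w c = 0 := by
      intro c
      rw [hsv, csg_eq_zero, hw, map_mul, map_inv, Equiv.Perm.mul_apply, Equiv.Perm.inv_eq_iff_eq]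
      have e' : key α val h = key α val h' := e
      have := congrFun e' (Encodable.encode c)
      rw [key_d, key_d] at this
      exact (WithBot.coe_inj.1 this)
    have := htv w (fun c _ => e1 c)
    rw [hw] at this
    exact (inv_mul_eq_one.1 this).symm
  let l : LinearOrder H := LinearOrder.lift' (fun h : H => (toLex (key α val h) : Lex (ℕ → WithBot Ω))) inj
  have lt_iff : ∀ a b : H, l.lt a b ↔ ∃ m, (∀ i < m, key α val a i = key α val b i) ∧ key α val a m < key α val b m :=
    fun a b => Iff.rfl
  have keymul : ∀ (a b : H) (m : ℕ), key α val (a * b) m = WithBot.map (α a) (key α val b m) := by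
    intro a b m
    unfold key
    cases (Encodable.decode m : Option C) <;> simp
  have kmono : ∀ a : H, StrictMono (WithBot.map (α a)) := fun a => WithBot.strictMono_map_iff.2 (hα a)
  refine ⟨l, ?_, ?_⟩
  · intro a b c hbc
    rcases (@le_iff_eq_or_lt H l.toPartialOrder b c).1 hbc with rfl | h
    · exact l.le_refl _
    · refine @le_of_lt H l.toPreorder _ _ ?_
      obtain ⟨m, h1, h2⟩ := (lt_iff _ _).1 h
      refine (lt_iff _ _).2 ⟨m, fun i hi => ?_, ?_⟩
      · rw [keymul, keymul, h1 i hi]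
      · rw [keymul, keymul]; exact kmono a h2
  · let σ : List (ℕ × Bool) → ℕ → ℤ := fun w m => (Encodable.decode m : Option C).elim 0 (fun c => s w c)
    have hσ : Computable (fun p : List (ℕ × Bool) × ℕ => σ p.1 p.2) := by
      have : Computable (fun p : (List (ℕ × Bool) × ℕ) × C => s p.1.1 p.2) :=
        hs.comp (g := fun p : (List (ℕ × Bool) × ℕ) × C => (p.1.1, p.2)) (by fun_prop)
      show Computable (fun p : List (ℕ × Bool) × ℕ => (Encodable.decode p.2 : Option C).elim 0 (fun c => s p.1 c))
      fun_prop
    have hσv : ∀ w m, σ w m = csg (key α val (evalWord x w) m) (key α val 1 m) := by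
      intro w m
      show (Encodable.decode m : Option C).elim 0 (fun c => s w c) = _
      unfold key
      cases (Encodable.decode m : Option C) with
      | none => simp [csg_self]
      | some c => simp [hsv, csg]
    let tr : List (ℕ × Bool) → Bool := fun w => (test w).all (fun c => decide (s w c = 0))
    have htr : Computable tr := by
      show Computable (fun w => (test w).all (fun c => decide (s w c = 0)))
      fun_prop
    have htrv : ∀ w, tr w = true ↔ evalWord x w = 1 := by
      intro w
      constructor
      · intro h
        apply htv
        simpa [tr] using h
      · intro h
        simp [tr, hsv, h, csg_self]
    have hp : Computable (fun p : List (ℕ × Bool) × ℕ => tr p.1 || !decide (σ p.1 p.2 = 0)) := by fun_prop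
    have hq : Computable (fun p : List (ℕ × Bool) × ℕ => bif tr p.1 then 0 else σ p.1 p.2) := by fun_prop
    have hP : Partrec (fun w => (Nat.rfind (fun m => Part.some (tr w || !decide (σ w m = 0)))).map
        (fun m => bif tr w then 0 else σ w m)) := by
      refine Partrec.map (f := fun w => (Nat.rfind (fun m => Part.some (tr w || !decide (σ w m = 0)))))
        (g := fun w m => bif tr w then 0 else σ w m) (Partrec.rfind (p := fun w m => Part.some (tr w || !decide (σ w m = 0))) ?_) hq
      exact hp.partrec
    refine Partrec.of_eq_tot hP (fun w => ?_)
    rw [Part.mem_map_iff]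
    by_cases h : evalWord x w = 1
    · refine ⟨0, ?_, ?_⟩
      · refine Nat.mem_rfind.2 ⟨?_, ?_⟩
        · simp [(htrv w).2 h]
        · intro m hm; omega
      · have : ¬ l.lt 1 1 := @lt_irrefl H l.toPreorder 1
        simp [(htrv w).2 h, orderSign, h, this]
    · have ht' : tr w = false := by
        rw [← Bool.not_eq_true]; exact fun h' => h ((htrv w).1 h')
      have hex : ∃ m, σ w m ≠ 0 := by
        by_contra hc
        push Not at hc
        apply h
        apply htv
        intro c _
        have := hc (Encodable.encode c)
        simpa [σ] using this
      classical
      have hf := Nat.find_spec hex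
      have hmin : ∀ m < Nat.find hex, σ w m = 0 := fun m hm => by simpa using Nat.find_min hex hm
      refine ⟨Nat.find hex, ?_, ?_⟩
      · refine Nat.mem_rfind.2 ⟨by simpa [ht'] using hf, ?_⟩
        intro m hm
        simp [ht', hmin m hm]
      · simp only [ht', cond_false]
        set m := Nat.find hex
        have heq : ∀ i < m, key α val (evalWord x w) i = key α val 1 i := fun i hi => by
          have := hmin i hi
          rwa [hσv, csg_eq_zero] at this
        have hlt : l.lt (evalWord x w) 1 ↔ key α val (evalWord x w) m < key α val 1 m := by
          rw [lt_iff]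
          constructor
          · rintro ⟨m', h1, h2⟩
            rcases lt_trichotomy m m' with h3 | rfl | h3
            · exact absurd (by rw [hσv, h1 _ h3]; exact csg_self _) hf
            · exact h2
            · rw [heq _ h3] at h2; exact absurd h2 (lt_irrefl _)
          · exact fun h => ⟨m, heq, h⟩
        rw [hσv] at hf ⊢
        unfold orderSign csg
        unfold csg at hf
        by_cases h1 : key α val (evalWord x w) m < key α val 1 m
        · simp [h1, hlt]
        · by_cases h2 : key α val (evalWord x w) m = key α val 1 m
          · simp [h2] at hf
          · simp [h1, h2, hlt, h]
end GenLem
end SimpEmb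

set_option linter.unusedSectionVars false
set_option linter.unusedSimpArgs false
namespace SimpEmb
/-! ### Computing the action -/
section CompAct
variable {α : Type*} [Primcodable α]

/-- words -/
abbrev Wd := List (ℕ × Bool)

/-- coordinate data on words -/
def D0 (sgn : Wd → ℤ) : Cd Wd where
  ng w := decide (sgn w = -1)
  ps w := decide (sgn w = 1)
  one := []
  mu r w := r :: w

variable {sgn : Wd → ℤ}

@[fun_prop] theorem C_ng (hs : Computable sgn) {f : α → Wd} (hf : Computable f) :
    Computable (fun a => (D0 sgn).ng (f a)) := by unfold D0; fun_prop
@[fun_prop] theorem C_ps (hs : Computable sgn) {f : α → Wd} (hf : Computable f) :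
    Computable (fun a => (D0 sgn).ps (f a)) := by unfold D0; fun_prop
theorem C_mu {r : α → ℕ × Bool} {f : α → Wd} (hr : Computable r) (hf : Computable f) :
    Computable (fun a => (D0 sgn).mu (r a) (f a)) := by unfold D0; fun_prop
@[fun_prop] theorem C_isB (hs : Computable sgn) {f : α → Bool × Wd} (hf : Computable f) :
    Computable (fun a => isB (D0 sgn) (f a)) := by unfold isB; fun_prop
@[fun_prop] theorem C_isT (hs : Computable sgn) {f : α → Bool × Wd} (hf : Computable f) :
    Computable (fun a => isT (D0 sgn) (f a)) := by unfold isT; fun_prop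
@[fun_prop] theorem C_clp (hs : Computable sgn) {f : α → Bool × Wd} (hf : Computable f) :
    Computable (fun a => clp (D0 sgn) (f a)) := by unfold clp; fun_prop
@[fun_prop] theorem C_xG (hs : Computable sgn) {f : α → List (Bool × Wd)} (hf : Computable f) :
    Computable (fun a => xG (D0 sgn) (f a)) := by
  have : Computable (fun a => lc (f a) [] (fun s V => bif isB (D0 sgn) s then
      lc V [] (fun t W => bif isT (D0 sgn) t then (true, (D0 sgn).one) :: (false, (D0 sgn).one) :: W else t :: W)
      else (true, (D0 sgn).one) :: s :: V)) := by fun_prop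
  refine this.of_eq (fun a => ?_)
  rcases f a with _ | ⟨s, _ | ⟨t, W⟩⟩ <;> rfl
@[fun_prop] theorem C_xiG (hs : Computable sgn) {f : α → List (Bool × Wd)} (hf : Computable f) :
    Computable (fun a => xiG (D0 sgn) (f a)) := by
  have : Computable (fun a => lc (f a) [] (fun s V => bif isT (D0 sgn) s then
      lc V [] (fun t W => bif isB (D0 sgn) t then (false, (D0 sgn).one) :: (true, (D0 sgn).one) :: W else t :: W)
      else (false, (D0 sgn).one) :: s :: V)) := by fun_prop
  refine this.of_eq (fun a => ?_)
  rcases f a with _ | ⟨s, _ | ⟨t, W⟩⟩ <;> rfl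
@[fun_prop] theorem C_xsG (hs : Computable sgn) {e : α → Bool} (he : Computable e)
    {f : α → List (Bool × Wd)} (hf : Computable f) :
    Computable (fun a => xsG (D0 sgn) (e a) (f a)) := by unfold xsG; fun_prop
@[fun_prop] theorem C_emG (hs : Computable sgn) {k : α → Wd} (hk : Computable k)
    {f : α → List (Bool × Wd)} (hf : Computable f) :
    Computable (fun a => emG (D0 sgn) (k a) (f a)) := by unfold emG; fun_prop
@[fun_prop] theorem C_tG (hs : Computable sgn) {r : α → ℕ × Bool} (hr : Computable r)
    {f : α → List (Bool × Wd)} (hf : Computable f) :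
    Computable (fun a => tG (D0 sgn) (r a) (f a)) := by
  have : Computable (fun a => lc (f a) [] (fun s V => bif s.1 then
      (bif (D0 sgn).ng s.2 then emG (D0 sgn) ((D0 sgn).mu (r a) s.2) V
        else lc V [] (fun t W => bif t.1 then s :: t :: W else
          emG (D0 sgn) ((D0 sgn).mu (r a) (clp (D0 sgn) t)) W))
      else s :: V)) := by fun_prop
  refine this.of_eq (fun a => ?_)
  rcases f a with _ | ⟨s, _ | ⟨t, W⟩⟩ <;> rfl
@[fun_prop] theorem C_bG (hs : Computable sgn) {r : α → ℕ × Bool} (hr : Computable r)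
    {f : α → List (Bool × Wd)} (hf : Computable f) :
    Computable (fun a => bG (D0 sgn) (r a) (f a)) := by
  have : Computable (fun a => lc (f a) [] (fun s V => lc V [] (fun t W =>
      bif isB (D0 sgn) s then (bif isT (D0 sgn) t then s :: t :: tG (D0 sgn) (r a) W else s :: t :: W)
        else bif isT (D0 sgn) s && isT (D0 sgn) t then
          lc W [] (fun q Z => bif isB (D0 sgn) q then
            s :: t :: q :: tG (D0 sgn) ((r a).1, !(r a).2) Z else s :: t :: q :: Z)
        else s :: t :: W))) := by fun_prop
  refine this.of_eq (fun a => ?_)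
  rcases f a with _ | ⟨s, _ | ⟨t, _ | ⟨q, Z⟩⟩⟩ <;> rfl
@[fun_prop] theorem C_cG (hs : Computable sgn) {E : ℤ → Bool} (hE : Computable E)
    {f : α → List (Bool × Wd) → List (Bool × Wd)} (hf : Computable (fun q : α × List (Bool × Wd) => f q.1 q.2))
    {p : α → FPt Wd} (hp : Computable p) :
    Computable (fun a => cG (D0 sgn) E (f a) (p a)) := by
  have : Computable (fun a => f a (p a).2.2) :=
    hf.comp (g := fun a => (a, (p a).2.2)) (by fun_prop)
  unfold cG; fun_prop
@[fun_prop] theorem C_wxG (hs : Computable sgn) {b : α → Bool} (hb : Computable b) {i : α → ℤ}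
    (hi : Computable i) {k : α → Wd} (hk : Computable k) :
    Computable (fun a => wxG (D0 sgn) (b a) (i a) (k a)) := by unfold wxG; fun_prop
@[fun_prop] theorem C_woG (hs : Computable sgn) {j : α → ℤ} (hj : Computable j) {p : α → FPt Wd}
    (hp : Computable p) {f : α → List (Bool × Wd)} (hf : Computable f) :
    Computable (fun a => woG (D0 sgn) (j a) (p a) (f a)) := by
  have : Computable (fun a => lc (f a) (p a) (fun s V => (j a + (bif s.1 then 1 else 0), clp (D0 sgn) s, V))) := by
    fun_prop
  refine this.of_eq (fun a => ?_)
  rcases f a with _ | ⟨s, V⟩ <;> rfl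
@[fun_prop] theorem C_wG (hs : Computable sgn) {b : α → Bool} (hb : Computable b)
    {f : α → List (Bool × Wd) → List (Bool × Wd)} (hf : Computable (fun q : α × List (Bool × Wd) => f q.1 q.2))
    {p : α → FPt Wd} (hp : Computable p) :
    Computable (fun a => wG (D0 sgn) (b a) (f a) (p a)) := by
  have : Computable (fun a => f a ((!decide (wxG (D0 sgn) (b a) (p a).1 (p a).2.1 = (p a).1), (p a).2.1) :: (p a).2.2)) :=
    hf.comp (g := fun a => (a, ((!decide (wxG (D0 sgn) (b a) (p a).1 (p a).2.1 = (p a).1), (p a).2.1) :: (p a).2.2)))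
      (by fun_prop)
  unfold wG; fun_prop
theorem C_aG (hs : Computable sgn) {g : α → ℕ × Bool} (hg : Computable g)
    {p : α → FPt Wd} (hp : Computable p) :
    Computable (fun a => aG (D0 sgn) lab (g a) (p a)) := by
  have hl : Computable lab := C_lab C_id
  have : Computable (fun a =>
    bif decide ((g a).1 = 0) then wG (D0 sgn) false (xsG (D0 sgn) (g a).2) (p a)
    else bif decide ((g a).1 = 1) then wG (D0 sgn) true (xsG (D0 sgn) (g a).2) (p a)
    else bif decide ((g a).1 = 2) then cG (D0 sgn) (parB false) (xsG (D0 sgn) (g a).2) (p a)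
    else bif decide ((g a).1 = 3) then cG (D0 sgn) (parB true) (xsG (D0 sgn) (g a).2) (p a)
    else bif decide ((g a).1 = 4) then cG (D0 sgn) lab (xsG (D0 sgn) (g a).2) (p a)
    else cG (D0 sgn) (parB false) (bG (D0 sgn) ((g a).1 - 5, (g a).2)) (p a)) := by fun_prop
  refine this.of_eq (fun a => ?_)
  rcases g a with ⟨_ | _ | _ | _ | _ | m, e⟩ <;> simp [aG]
@[fun_prop] theorem C_aW (hs : Computable sgn) {w : α → Wd} (hw : Computable w)
    {p : α → FPt Wd} (hp : Computable p) :
    Computable (fun a => aW (D0 sgn) lab (w a) (p a)) := by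
  have : Computable (fun q : α × (ℕ × Bool) × FPt Wd => aG (D0 sgn) lab q.2.1 q.2.2) :=
    C_aG hs (by fun_prop) (by fun_prop)
  unfold aW
  exact C_foldr (h := fun _ g p => aG (D0 sgn) lab g p) hw hp this

/-! comparison -/
/-- lexicographic combination of signs -/
def lx (a b : ℤ) : ℤ := bif decide (a = 0) then b else a
@[fun_prop] theorem C_lx {f g : α → ℤ} (hf : Computable f) (hg : Computable g) :
    Computable (fun a => lx (f a) (g a)) := by unfold lx; fun_prop
/-- integer comparison -/
def cz (a b : ℤ) : ℤ := bif decide (a < b) then -1 else bif decide (a = b) then 0 else 1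
@[fun_prop] theorem C_cz {f g : α → ℤ} (hf : Computable f) (hg : Computable g) :
    Computable (fun a => cz (f a) (g a)) := by unfold cz; fun_prop
theorem cz_eq (a b : ℤ) : cz a b = csg a b := by
  unfold cz csg
  by_cases h1 : a < b <;> by_cases h2 : a = b <;> simp [h1, h2]

variable (sgn) in
/-- letter comparison -/
def clt (s t : Bool × Wd) : ℤ :=
  bif s.1 then (bif t.1 then sgn (invW (clp (D0 sgn) t) ++ clp (D0 sgn) s) else 1)
  else (bif t.1 then -1 else sgn (invW (clp (D0 sgn) t) ++ clp (D0 sgn) s))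
@[fun_prop] theorem C_clt (hs : Computable sgn) {f g : α → Bool × Wd} (hf : Computable f) (hg : Computable g) :
    Computable (fun a => clt sgn (f a) (g a)) := by unfold clt; fun_prop

/-- padded pairing -/
def zipP (V W : List (Bool × Wd)) : List ((Bool × Wd) × (Bool × Wd)) :=
  (List.range (V.length + W.length)).map (fun i => ((V[i]?).elim (false, []) (fun b => b), (W[i]?).elim (false, []) (fun b => b)))
@[fun_prop] theorem C_zipP {f g : α → List (Bool × Wd)} (hf : Computable f) (hg : Computable g) :
    Computable (fun a => zipP (f a) (g a)) := by unfold zipP; fun_prop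

variable (sgn) in
/-- point comparison -/
def cpt (p q : FPt Wd) : ℤ :=
  lx (cz p.1 q.1) (lx (sgn (invW q.2.1 ++ p.2.1))
    ((zipP p.2.2 q.2.2).foldr (fun z r => lx (clt sgn z.1 z.2) r) 0))
@[fun_prop] theorem C_cpt (hs : Computable sgn) {f g : α → FPt Wd} (hf : Computable f) (hg : Computable g) :
    Computable (fun a => cpt sgn (f a) (g a)) := by unfold cpt; fun_prop

variable (sgn) in
/-- the sign of the displacement of a point -/
noncomputable def sW (w : Wd) (c : FPt Wd) : ℤ :=
  cpt sgn (aW (D0 sgn) lab w (c.1, c.2.1, c.2.2 ++ List.replicate (5 + 2 * w.length) (false, []))) c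
theorem C_sW (hs : Computable sgn) : Computable (fun p : Wd × FPt Wd => sW sgn p.1 p.2) := by
  unfold sW; fun_prop

/-! correctness -/
variable {K : Type*} [Group K] [LinearOrder K] [MulLeftStrictMono K] (y : ℕ → K)

/-- evaluated letters -/
def evL (s : Bool × Wd) : Bool × K := (s.1, evalWord y s.2)
/-- evaluated description -/
def evP (c : FPt Wd) : FPt K := (c.1, evalWord y c.2.1, c.2.2.map (evL y))
/-- the least string -/
noncomputable def bω (K : Type*) [Group K] [LinearOrder K] : Str (Ltr K) := fun _ => (⊥ : Ltr K)
/-- value of a description -/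
noncomputable def vl (c : FPt Wd) : Om K := rp (evP y c) (bω K)

theorem cons_bω : cons (⊥ : Ltr K) (bω K) = bω K := by
  funext m; cases m <;> rfl

variable {y} (hsg : ∀ w, sgn w = csg (evalWord y w) 1)
include hsg

theorem tr0 : Tr (D0 sgn) (KD y) (fun _ w k => evalWord y w = k) where
  mono := fun _ _ _ h => h
  ng := by
    rintro _ w _ rfl
    simp only [D0, KD, hsg, csg, decide_eq_decide]
    split_ifs <;> simp_all
  ps := by
    rintro _ w _ rfl
    simp only [D0, KD, hsg, csg, decide_eq_decide]
    split_ifs with h1 h2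
    · simp [h1.le]
    · simp [h2]
    · simpa using lt_of_le_of_ne (not_lt.1 h1) (Ne.symm h2)
  one := fun _ _ _ _ => by simp [D0, KD, evalWord]
  mu := by rintro _ w _ r rfl; simp only [D0, KD, evalWord_cons]; rfl

theorem evL_forall (V : List (Bool × Wd)) (V' : List (Bool × K)) :
    RLs (fun _ w k => evalWord y w = k) 0 V V' ↔ V' = V.map (evL y) := by
  induction V generalizing V' with
  | nil => simp [RLs]
  | cons s V ih =>
    rcases V' with _ | ⟨s', V'⟩
    · simp [RLs]
    · unfold RLs at ih ⊢
      rw [List.forall₂_cons, ih, RL, List.map_cons, List.cons_eq_cons, evL, Prod.ext_iff, eq_comm,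
        @eq_comm _ (evalWord y s.2)]

theorem aW_ev (w : Wd) (c : FPt Wd) : aW (KD y) lab w (evP y c) = evP y (aW (D0 sgn) lab w c) := by
  have := (tr0 hsg).aW (lab := lab) (δ := 0) (by simp) (n := 0) w (p := c) (p' := evP y c)
    ⟨by simp [evP], by simp, rfl, (evL_forall hsg _ _).2 rfl⟩
  refine Prod.ext ?_ (Prod.ext this.co.symm ((evL_forall hsg _ _).1 this.ls))
  simpa [evP] using this.idx

omit hsg in
theorem csg_mul (a b c : K) : csg (c * a) (c * b) = csg a b := by
  simp [csg]

theorem sgn_inv (v w : Wd) : sgn (invW w ++ v) = csg (evalWord y v) (evalWord y w) := by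
  rw [hsg, evalWord_append, evalWord_invW, ← csg_mul _ _ (evalWord y w)]
  simp

theorem clp_ev (s : Bool × Wd) : evalWord y (clp (D0 sgn) s) = kk (rl (evL y s)) := by
  rw [← clp_eq y]
  exact (tr0 hsg).clp (n := 0) (s' := evL y s) ⟨rfl, rfl⟩

theorem clt_ev (s t : Bool × Wd) : clt sgn s t = csg (rl (evL y s)) (rl (evL y t)) := by
  unfold clt
  rw [sgn_inv hsg, clp_ev hsg, clp_ev hsg]
  have hb : ∀ s : Bool × Wd, bit (rl (evL y s)) = s.1 := fun s => rfl
  have e1 := hb s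
  have e2 := hb t
  generalize rl (evL y s) = a at *
  generalize rl (evL y t) = b at *
  rw [← e1, ← e2]
  have hlt : a < b ↔ ¬ b ≤ a := not_le.symm
  have heq : a = b ↔ bit a = bit b ∧ kk a = kk b := ⟨by rintro rfl; simp, fun h => ltr_ext h.1 h.2⟩
  rw [ltr_le] at hlt
  unfold csg
  rw [if_congr hlt rfl rfl, if_congr heq rfl rfl]
  cases bit a <;> cases bit b <;> simp
omit hsg in
theorem csg_lx {Ω A B : Type*} [LinearOrder Ω] [LinearOrder A] [LinearOrder B] {x x' : Ω} {a a' : A} {b b' : B}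
    (h : x < x' ↔ a < a' ∨ a = a' ∧ b < b') (h' : x = x' ↔ a = a' ∧ b = b') :
    csg x x' = lx (csg a a') (csg b b') := by
  unfold csg lx
  rw [if_congr h rfl rfl, if_congr h' rfl rfl]
  rcases lt_trichotomy a a' with h1 | rfl | h1
  · simp [h1]
  · simp
  · simp [h1.not_gt, h1.ne']

omit hsg in
theorem csg_cons {s s' : Ltr K} {u u' : Str (Ltr K)} : csg (cons s u) (cons s' u') = lx (csg s s') (csg u u') := by
  refine csg_lx cons_lt ⟨fun h => ?_, ?_⟩
  · have h1 := congrArg hd h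
    have h2 := congrArg tl h
    simpa using ⟨h1, h2⟩
  · rintro ⟨rfl, rfl⟩; rfl

theorem fold_ev (P : List ((Bool × Wd) × (Bool × Wd))) (t : Str (Ltr K)) :
    P.foldr (fun z r => lx (clt sgn z.1 z.2) r) 0 =
      csg (rls ((P.map (fun z => z.1)).map (evL y)) t) (rls ((P.map (fun z => z.2)).map (evL y)) t) := by
  induction P with
  | nil => simp [csg_self]
  | cons z P ih =>
    rw [List.foldr_cons, ih, clt_ev hsg, List.map_cons, List.map_cons, List.map_cons, List.map_cons,
      rls_cons, rls_cons, csg_cons]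

omit hsg in
theorem rls_pad (m : ℕ) : rls ((List.replicate m ((false, []) : Bool × Wd)).map (evL y)) (bω K) = bω K := by
  induction m with
  | zero => rfl
  | succ m ih =>
    rw [List.replicate_succ, List.map_cons, rls_cons, ih]
    simp only [evL]
    have : evalWord y [] = 1 := rfl
    rw [this, rl_bot, cons_bω]

omit hsg in
theorem map_pad (V : List (Bool × Wd)) (m : ℕ) :
    (List.range (V.length + m)).map (fun i => (V[i]?).elim ((false, []) : Bool × Wd) (fun b => b)) = V ++ List.replicate m (false, []) := by
  apply List.ext_getElem?
  intro i
  rw [List.getElem?_map, List.getElem?_append]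
  by_cases h : i < V.length
  · rw [List.getElem?_range (by omega)]
    simp [h]
  · by_cases h2 : i < V.length + m
    · have e : V[i]? = none := by simp; omega
      rw [List.getElem?_range h2]
      rw [List.getElem?_eq_getElem (l := List.replicate m _) (by simp; omega)]
      simp [h]
    · rw [List.getElem?_eq_none (by simp; omega), List.getElem?_eq_none (l := List.replicate m _) (by simp; omega)]
      simp [h]

theorem cpt_ev (p q : FPt Wd) : cpt sgn p q = csg (vl y p) (vl y q) := by
  unfold cpt vl rp
  rw [cz_eq, sgn_inv hsg, fold_ev hsg _ (bω K)]
  rw [csg_lx (x := pt (evP y p).1 (evP y p).2.1 (rls (evP y p).2.2 (bω K))) (x' := pt (evP y q).1 (evP y q).2.1 (rls (evP y q).2.2 (bω K))) (a := p.1) (a' := q.1) (b := (toLex (evalWord y p.2.1, rls (p.2.2.map (evL y)) (bω K)) : K ×ₗ Str (Ltr K)))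
    (b' := (toLex (evalWord y q.2.1, rls (q.2.2.map (evL y)) (bω K)) : K ×ₗ Str (Ltr K)))]
  · rw [csg_lx (x := (toLex _ : K ×ₗ Str (Ltr K))) (a := evalWord y p.2.1) (a' := evalWord y q.2.1)
      (b := rls (p.2.2.map (evL y)) (bω K)) (b' := rls (q.2.2.map (evL y)) (bω K)) Prod.Lex.lt_iff]
    · congr 3
      · simp only [zipP, List.map_map]
        have := map_pad p.2.2 q.2.2.length
        rw [show ((fun z : (Bool × Wd) × (Bool × Wd) => z.1) ∘ fun i => ((p.2.2[i]?).elim (false, []) (fun b => b), (q.2.2[i]?).elim (false, []) (fun b => b))) =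
          fun i => (p.2.2[i]?).elim (false, []) (fun b => b) from rfl, ← List.map_map, this, List.map_append, rls_append, rls_pad]
      · simp only [zipP, List.map_map]
        have := map_pad q.2.2 p.2.2.length
        rw [show ((fun z : (Bool × Wd) × (Bool × Wd) => z.2) ∘ fun i => ((p.2.2[i]?).elim (false, []) (fun b => b), (q.2.2[i]?).elim (false, []) (fun b => b))) =
          fun i => (q.2.2[i]?).elim (false, []) (fun b => b) from rfl, ← List.map_map, add_comm, this, List.map_append, rls_append, rls_pad]
    · exact ⟨fun h => ⟨congrArg (fun z => (ofLex z).1) h, congrArg (fun z => (ofLex z).2) h⟩,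
        fun h => by rw [h.1, h.2]⟩
  · exact Prod.Lex.lt_iff
  · rw [pt_inj]
    simp only [evP]
    refine and_congr_right (fun _ => ?_)
    exact ⟨fun h => by rw [h.1, h.2], fun h => ⟨congrArg (fun z => (ofLex z).1) h, congrArg (fun z => (ofLex z).2) h⟩⟩

theorem sW_ev (w : Wd) (c : FPt Wd) : sW sgn w c = csg (evalWord (genN Ap y) w (vl y c)) (vl y c) := by
  unfold sW
  rw [cpt_ev hsg]
  congr 1
  unfold vl
  rw [← aW_ev hsg, aW_real y lab_iff]
  · congr 1
    unfold rp evP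
    simp only
    rw [List.map_append, rls_append, rls_pad]
  · simp [evP]
end CompAct
end SimpEmb

set_option linter.unusedSectionVars false
set_option linter.unusedSimpArgs false
namespace SimpEmb
/-! ### The word problem in the simple group -/
section WPH
variable {K : Type*} [Group K] [LinearOrder K]

theorem pre_get {S : Type*} (B : List S) (s : S) (u : Str S) : pre B (cons s u) B.length = s := by
  induction B with
  | nil => rfl
  | cons b B ih => exact ih

theorem pre_star (s : Ltr K) (hs : s ≠ ⊥) (A B : List (Ltr K))
    (h : pre A (cons s (bω K)) = pre B (cons s (bω K))) : A = B := by
  have key : ∀ (b : Ltr K) (B : List (Ltr K)), cons s (bω K) ≠ pre (b :: B) (cons s (bω K)) := by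
    intro b B e
    have := congrArg tl e
    rw [pre_cons, tl_cons, tl_cons] at this
    have := congrFun this B.length
    rw [pre_get] at this
    exact hs this.symm
  induction A generalizing B with
  | nil =>
    rcases B with _ | ⟨b, B⟩
    · rfl
    · exact absurd h (key b B)
  | cons a A ih =>
    rcases B with _ | ⟨b, B⟩
    · exact absurd h.symm (key a A)
    · have h1 := congrArg hd h
      have h2 := congrArg tl h
      rw [pre_cons, pre_cons, hd_cons, hd_cons] at h1
      rw [pre_cons, pre_cons, tl_cons, tl_cons] at h2
      rw [h1, ih B h2]

theorem Bl_inv {y : ℕ → K} {L : ℕ} {g : K} (h : g ∈ Bl y L) : g⁻¹ ∈ Bl y L := by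
  obtain ⟨w, hw, rfl⟩ := Bl_word h
  rw [← evalWord_invW]
  refine Bl_mono ?_ (evalWord_mem_Bl (invW w))
  simpa [invW] using hw

/-- the relation used to transfer the word problem -/
def RelS (y : ℕ → K) (L : ℕ) (S : Finset K) (θ : K → K) (n : ℕ) (k k' : K) : Prop :=
  n ≤ L ∧ ((k = k' ∧ k ∈ Bl y (L - n)) ∨ ∃ r ∈ S, ∃ c ∈ Bl y (L - n), k = c * r ∧ k' = c * θ r)

variable {y : ℕ → K} {L : ℕ} {S : Finset K} {θ : K → K}

theorem csg_lt_iff {a b c d : K} (h : csg a b = csg c d) : (a < b ↔ c < d) ∧ (b < a ↔ d < c) := by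
  unfold csg at h
  rcases lt_trichotomy a b with h1 | h1 | h1 <;> rcases lt_trichotomy c d with h2 | h2 | h2 <;>
    first
    | (simp [h1, h2]; done)
    | (simp [h1, h2, h1.not_gt, h2.not_gt]; done)
    | (exfalso; revert h; simp [h1, h2, h1.not_gt, h2.not_gt, h1.ne', h2.ne'])
    | (exfalso; revert h; simp [h1, h2, h1.not_gt, h1.ne'])
    | (exfalso; revert h; simp [h1, h2, h2.not_gt, h2.ne'])

theorem trS (h1 : ∀ c ∈ Bl y L, ∀ k ∈ S, csg (c * k) 1 = csg (c * θ k) 1) :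
    Tr (KD y) (KD y) (RelS y L S θ) where
  mono := by
    rintro n k k' ⟨hn, h⟩
    have hs : Bl y (L - (n + 1)) ⊆ Bl y (L - n) := Bl_mono (by omega)
    refine ⟨by omega, ?_⟩
    rcases h with ⟨h, h'⟩ | ⟨r, hr, c, hc, h⟩
    · exact Or.inl ⟨h, hs h'⟩
    · exact Or.inr ⟨r, hr, c, hs hc, h⟩
  ng := by
    rintro n k k' ⟨hn, ⟨rfl, h'⟩ | ⟨r, hr, c, hc, rfl, rfl⟩⟩
    · rfl
    · have := csg_lt_iff (h1 c (Bl_mono (Nat.sub_le L n) hc) r hr)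
      simp only [KD, decide_eq_decide]; exact this.1
  ps := by
    rintro n k k' ⟨hn, ⟨rfl, h'⟩ | ⟨r, hr, c, hc, rfl, rfl⟩⟩
    · rfl
    · have := csg_lt_iff (h1 c (Bl_mono (Nat.sub_le L n) hc) r hr)
      simp only [KD, decide_eq_decide]; exact this.2
  one := by
    rintro n k k' ⟨hn, -⟩
    exact ⟨hn, Or.inl ⟨rfl, Bl_one _⟩⟩
  mu := by
    rintro n k k' r ⟨hn, h⟩
    have e : L - n = L - (n + 1) + 1 := by omega
    refine ⟨by omega, ?_⟩
    rw [e]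
    rcases h with ⟨h, h'⟩ | ⟨s, hs, c, hc, h, h'⟩
    · exact Or.inl ⟨by rw [h], Bl_mul r h'⟩
    · refine Or.inr ⟨s, hs, yb y r * c, Bl_mul r hc, ?_, ?_⟩
      · rw [h]; exact (mul_assoc _ _ _).symm
      · rw [h']; exact (mul_assoc _ _ _).symm

theorem relS_eq (h1 : ∀ c ∈ Bl y L, ∀ k ∈ S, csg (c * k) 1 = csg (c * θ k) 1)
    (h2 : ∀ c ∈ Bl y L, ∀ k ∈ S, ∀ r ∈ S, c * θ k = θ r → c * k = r) {a a' b b' : K}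
    (ha : RelS y L S θ 0 a a') (hb : RelS y L S θ L b b') (h : a' = b') : a = b := by
  have h3 : ∀ c ∈ Bl y L, ∀ k ∈ S, c * θ k = 1 → c * k = 1 := by
    intro c hc k hk e
    have := h1 c hc k hk
    rwa [e, csg_self, csg_eq_zero] at this
  obtain ⟨-, ha⟩ := ha
  obtain ⟨-, hb⟩ := hb
  rw [Nat.sub_zero] at ha
  rw [Nat.sub_self] at hb
  have hb' : (b = 1 ∧ b' = 1) ∨ ∃ r ∈ S, b = r ∧ b' = θ r := by
    rcases hb with ⟨h, h'⟩ | ⟨r, hr, c, hc, h, h'⟩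
    · have : b = 1 := h'
      exact Or.inl ⟨this, by rw [← h, this]⟩
    · have : c = 1 := hc
      exact Or.inr ⟨r, hr, by rw [h, this, one_mul], by rw [h', this, one_mul]⟩
  rcases ha with ⟨rfl, ha⟩ | ⟨r, hr, c, hc, rfl, rfl⟩ <;> rcases hb' with ⟨rfl, rfl⟩ | ⟨r2, hr2, rfl, rfl⟩
  · exact h
  · have := h3 a⁻¹ (Bl_inv ha) b hr2 (by rw [h]; simp)
    rw [inv_mul_eq_one] at this; exact this
  · exact h3 c hc r hr h
  · exact h2 c hc r hr b hr2 h

theorem map_rl_eq {R R2 : Bool × K → Bool × K → Prop} {W W' V V' : List (Bool × K)}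
    (h1 : List.Forall₂ R W W') (h2 : List.Forall₂ R2 V V') (h : W'.map rl = V'.map rl)
    (H : ∀ s s' t t', R s s' → R2 t t' → rl s' = rl t' → rl s = rl t) : W.map rl = V.map rl := by
  induction h1 generalizing V V' with
  | nil =>
    cases h2 with
    | nil => rfl
    | cons _ _ => simp at h
  | cons a _ ih =>
    cases h2 with
    | nil => simp at h
    | cons b h2 =>
      rw [List.map_cons, List.map_cons, List.cons_eq_cons] at h ⊢
      exact ⟨H _ _ _ _ a b h.1, ih h2 h.2⟩

variable [MulLeftStrictMono K]

/-- words of bounded length -/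
def wds (R N : ℕ) : List Wd := (List.range (N + 1)).flatMap fun n =>
      allL ((List.range R).flatMap fun r => [(r, true), (r, false)]) n
theorem C_wds (R : ℕ) {α : Type*} [Primcodable α] {f : α → ℕ} (hf : Computable f) : Computable (fun a => wds R (f a)) := by
  unfold wds; fun_prop
/-- lists of letters -/
def lts (A : List Wd) (n : ℕ) : List (List (Bool × Wd)) :=
  allL (A.flatMap fun v => [(true, v), (false, v)]) n
theorem C_lts {α : Type*} [Primcodable α] {f : α → List Wd} {g : α → ℕ} (hf : Computable f) (hg : Computable g) :
    Computable (fun a => lts (f a) (g a)) := by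
  unfold lts; fun_prop
/-- the test points, given the words -/
def tst1 (n : ℕ) (A : List Wd) (B : List (List (Bool × Wd))) : List (FPt Wd) :=
  (List.range (2 ^ (n + 3))).flatMap fun j : ℕ => A.flatMap fun k =>
      B.map fun V => (((j : ℤ), k, V ++ [(true, [])]) : FPt Wd)
theorem C_tst1 {α : Type*} [Primcodable α] {n : α → ℕ} {A : α → List Wd} {B : α → List (List (Bool × Wd))}
    (hn : Computable n) (hA : Computable A) (hB : Computable B) : Computable (fun a => tst1 (n a) (A a) (B a)) := by
  unfold tst1; fun_prop
/-- the test points -/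
def tst (R : ℕ) (Y : ℕ → ℕ → ℕ) (w : Wd) : List (FPt Wd) :=
  tst1 w.length (wds R (Y w.length (6 + 2 * w.length)))
    (lts (wds R (Y w.length (6 + 2 * w.length))) (5 + 2 * w.length))

theorem C_tst (R : ℕ) {Y : ℕ → ℕ → ℕ} (hY : Computable (fun p : ℕ × ℕ => Y p.1 p.2)) : Computable (tst R Y) := by
  have h0 : Computable (fun w : Wd => Y w.length (6 + 2 * w.length)) :=
    hY.comp (f := fun p : ℕ × ℕ => Y p.1 p.2) (g := fun w : Wd => (w.length, 6 + 2 * w.length)) (by fun_prop)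
  exact C_tst1 (by fun_prop) (C_wds R h0) (C_lts (C_wds R h0) (by fun_prop))

theorem mem_wds {R N : ℕ} {v : Wd} (h1 : ∀ p ∈ v, p.1 < R) (h2 : v.length ≤ N) :
    v ∈ wds R N := by
  rw [wds, List.mem_flatMap]
  refine ⟨v.length, by simp; omega, mem_allL _ _ ?_⟩
  rintro ⟨r, e⟩ hp
  rw [List.mem_flatMap]
  refine ⟨r, by simpa using h1 _ hp, ?_⟩
  cases e <;> simp

theorem tst_ok {sgn : Wd → ℤ} (hsg : ∀ w, sgn w = csg (evalWord y w) 1) (R : ℕ) {Y : ℕ → ℕ → ℕ}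
    (hgen : ∀ (L m : ℕ) (S : Finset K), S.card ≤ m → ∃ θ : K → Wd, (∀ k, ∀ p ∈ θ k, p.1 < R) ∧
      (∀ k, (θ k).length ≤ Y L m) ∧
      (∀ c ∈ Bl y L, ∀ k ∈ S, csg (c * k) 1 = csg (c * evalWord y (θ k)) 1) ∧
      (∀ c ∈ Bl y L, ∀ k ∈ S, ∀ r ∈ S, c * evalWord y (θ k) = evalWord y (θ r) → c * k = r))
    (w : Wd) (h : ∀ c ∈ tst R Y w, sW sgn w c = 0) : evalWord (genN Ap y) w = 1 := by
  ext p
  obtain ⟨i, k, u, rfl⟩ := pt_cases p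
  obtain ⟨V, t, hV, rfl⟩ := exists_rls (5 + 2 * w.length) u
  rw [Equiv.Perm.one_apply]
  classical
  set L := w.length with hL
  obtain ⟨θ, g1, g2, g3, g4⟩ := hgen L (6 + 2 * L) (insert k (V.map Prod.snd).toFinset) (by
    refine (Finset.card_insert_le _ _).trans ?_
    have := List.toFinset_card_le (V.map Prod.snd)
    rw [List.length_map, hV] at this
    omega)
  set S := insert k (V.map Prod.snd).toFinset with hS
  have hlt : 2 * L < 2 ^ (L + 1) := by
    have := Nat.lt_two_pow_self (n := L)
    rw [pow_succ]; omega
  obtain ⟨i', i1, i2, i3, i4⟩ := lab_recur L (L + 1) (by omega) hlt i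
  obtain ⟨j, rfl⟩ := Int.eq_ofNat_of_zero_le i1
  have hS1 : ∀ s ∈ V, s.2 ∈ S := by
    intro s hs
    rw [hS, Finset.mem_insert, List.mem_toFinset]
    exact Or.inr (List.mem_map_of_mem hs)
  have hc := h ((j : ℤ), θ k, (V.map fun s => (s.1, θ s.2)) ++ [(true, [])]) (by
    unfold tst tst1 lts
    rw [List.mem_flatMap]
    refine ⟨j, by rw [List.mem_range]; exact_mod_cast i2, ?_⟩
    rw [List.mem_flatMap]
    refine ⟨θ k, mem_wds (g1 k) (g2 k), ?_⟩
    rw [List.mem_map]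
    refine ⟨V.map fun s => (s.1, θ s.2), ?_, rfl⟩
    have e : 5 + 2 * w.length = (V.map fun s => (s.1, θ s.2)).length := by rw [List.length_map, hV]
    rw [e]
    refine mem_allL _ _ ?_
    intro b hb
    obtain ⟨s, hs, rfl⟩ := List.mem_map.1 hb
    rw [List.mem_flatMap]
    refine ⟨θ s.2, mem_wds (g1 _) (g2 _), ?_⟩
    cases s.1 <;> simp)
  rw [sW_ev hsg, csg_eq_zero] at hc
  set p : FPt K := (i, k, V) with hp
  set p' : FPt K := ((j : ℤ), evalWord y (θ k), V.map fun s => (s.1, evalWord y (θ s.2))) with hp'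
  have hv : vl y ((j : ℤ), θ k, (V.map fun s => (s.1, θ s.2)) ++ [(true, [])]) =
      rp p' (cons (rl (true, 1)) (bω K)) := by
    unfold vl evP
    simp only [List.map_append, List.map_map]
    unfold rp
    simp only [rls_append]
    rfl
  rw [hv, ← aW_real y lab_iff w p' (by simp [hp', hV, hL])] at hc
  have hT := (trS g3).aW (lab := lab) (δ := (j : ℤ) - i) i3 (n := 0) w (p := p) (p' := p')
    ⟨by simp [hp, hp'], by
      intro d hd
      have := i4 d (by simpa using hd)
      simpa [hp] using this, by
      rw [zero_add]
      exact ⟨le_rfl, Or.inr ⟨k, Finset.mem_insert_self _ _, 1, Bl_one _, (one_mul _).symm, (one_mul _).symm⟩⟩, by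
      rw [zero_add]
      simp only [hp, hp', RLs, List.forall₂_map_right_iff, List.forall₂_same]
      intro s hs
      exact ⟨rfl, le_rfl, Or.inr ⟨s.2, hS1 s hs, 1, Bl_one _, (one_mul _).symm, (one_mul _).symm⟩⟩⟩
  have hls : RLs (RelS y L S (fun k => evalWord y (θ k))) L V p'.2.2 := by
    simp only [hp', RLs, List.forall₂_map_right_iff, List.forall₂_same]
    intro s hs
    exact ⟨rfl, le_rfl, Or.inr ⟨s.2, hS1 s hs, 1, Bl_one _, (one_mul _).symm, (one_mul _).symm⟩⟩
  obtain ⟨c1, c2, c3⟩ := pt_inj.1 hc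
  have f1 : (aW (KD y) lab w p).1 = i := by
    have := hT.idx
    rw [c1] at this
    simp only [hp'] at this
    omega
  have f2 : (aW (KD y) lab w p).2.1 = k :=
    relS_eq g3 g4 hT.co ⟨le_rfl, Or.inr ⟨k, Finset.mem_insert_self _ _, 1, Bl_one _, (one_mul _).symm, (one_mul _).symm⟩⟩ c2
  have f3 : (aW (KD y) lab w p).2.2.map rl = V.map rl := by
    refine map_rl_eq hT.ls hls (pre_star _ (ltr_t_ne_bot _) _ _ c3) ?_
    intro s s' t t' r1 r2 e
    apply ltr_ext
    · have := congrArg bit e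
      change s'.1 = t'.1 at this
      change s.1 = t.1
      rw [r1.1, this, r2.1]
    · rw [← clp_eq y, ← clp_eq y]
      refine relS_eq g3 g4 ((trS g3).clp r1) ((trS g3).clp r2) ?_
      rw [clp_eq y, clp_eq y, e]
  have := aW_real y lab_iff w p (by simp [hp, hV, hL]) t
  rw [show pt i k (rls V t) = rp p t from rfl, ← this]
  unfold rp
  rw [f1, f2]
  unfold rls
  rw [f3]

/-! the generators of `HH` -/
variable (y) in
/-- generators as elements of `HH` -/
noncomputable def xH (R : ℕ) (n : ℕ) : HH Ap y R := if h : n < R + 5 then ⟨genN Ap y n, genN_mem h⟩ else 1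

theorem xH_coe {R : ℕ} (hR : ∀ n, R ≤ n → y n = 1) (n : ℕ) : ((xH y R n : HH Ap y R) : Equiv.Perm (Om K)) = genN Ap y n := by
  unfold xH
  split_ifs with h
  · rfl
  · obtain ⟨m, rfl⟩ : ∃ m, n = m + 5 := ⟨n - 5, by omega⟩
    simp [genN, hR m (by omega), bet]

theorem evalWord_map {G H : Type*} [Group G] [Group H] (f : G →* H) (x : ℕ → G) (w : Wd) :
    f (evalWord x w) = evalWord (fun n => f (x n)) w := by
  induction w with
  | nil => simp [evalWord]
  | cons p w ih =>
    simp only [evalWord, List.map_cons, List.prod_cons, map_mul] at ih ⊢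
    rw [ih]
    congr 1
    split_ifs <;> simp

theorem xH_word {R : ℕ} (hR : ∀ n, R ≤ n → y n = 1) (w : Wd) :
    ((evalWord (xH y R) w : HH Ap y R) : Equiv.Perm (Om K)) = evalWord (genN Ap y) w := by
  have := evalWord_map (HH Ap y R).subtype (xH y R) w
  simp only [Subgroup.coe_subtype] at this
  rw [this]
  congr 1
  funext n
  exact xH_coe hR n

theorem genN_strictMono (n : ℕ) : StrictMono (genN Ap y n) := by
  have hx : StrictMono (xp (Ltr K)) := xp_strictMono
  match n with
  | 0 => exact win_strictMono _ _ hx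
  | 1 => exact win_strictMono _ _ hx
  | 2 => exact cell_strictMono _ _ hx
  | 3 => exact cell_strictMono _ _ hx
  | 4 => exact cell_strictMono _ _ hx
  | n + 5 =>
    refine cell_strictMono _ _ ?_
    unfold bet
    exact (sb_strictMono _ _ (TT_strictMono _)).comp (sb_strictMono _ _ (strictMono_inv _ (TT_strictMono _)))

theorem HH_strictMono {R : ℕ} (h : HH Ap y R) : StrictMono (h : Equiv.Perm (Om K)) := by
  obtain ⟨h, hh⟩ := h
  induction hh using Subgroup.closure_induction with
  | mem a ha => obtain ⟨i, rfl⟩ := ha; exact genN_strictMono _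
  | one => exact strictMono_id
  | mul a b _ _ ha hb => exact ha.comp hb
  | inv a _ ha => exact strictMono_inv _ ha

theorem xH_surj {R : ℕ} (hR : ∀ n, R ≤ n → y n = 1) (h : HH Ap y R) : ∃ w : Wd, (∀ g ∈ w, g.1 < R + 5) ∧ evalWord (xH y R) w = h := by
  obtain ⟨w, hw, e⟩ := exists_word (genN Ap y) (R + 5) h.1 h.2
  exact ⟨w, hw, Subtype.ext (by rw [xH_word hR, e])⟩

theorem HH_computable {sgn : Wd → ℤ} (hs : Computable sgn) (hsg : ∀ w, sgn w = csg (evalWord y w) 1) (R : ℕ)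
    (hR : ∀ n, R ≤ n → y n = 1) {Y : ℕ → ℕ → ℕ} (hY : Computable (fun p : ℕ × ℕ => Y p.1 p.2))
    (hgen : ∀ (L m : ℕ) (S : Finset K), S.card ≤ m → ∃ θ : K → Wd, (∀ k, ∀ p ∈ θ k, p.1 < R) ∧
      (∀ k, (θ k).length ≤ Y L m) ∧
      (∀ c ∈ Bl y L, ∀ k ∈ S, csg (c * k) 1 = csg (c * evalWord y (θ k)) 1) ∧
      (∀ c ∈ Bl y L, ∀ k ∈ S, ∀ r ∈ S, c * evalWord y (θ k) = evalWord y (θ r) → c * k = r)) :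
    ComputableLeftOrderWrt (xH y R : ℕ → HH Ap y R) := by
  refine gl (HH Ap y R).subtype (vl y) HH_strictMono (xH y R) (fun h => ?_) (sW sgn) (C_sW hs) (fun w c => ?_)
    (tst R Y) (C_tst R hY) (fun w hw => ?_)
  · obtain ⟨w, -, h⟩ := xH_surj hR h; exact ⟨w, h⟩
  · rw [sW_ev hsg, Subgroup.coe_subtype, xH_word hR]
  · exact Subtype.ext (by rw [xH_word hR, tst_ok hsg R hgen w hw]; rfl)

end WPH
end SimpEmb

set_option linter.unusedSectionVars false
set_option linter.unusedSimpArgs false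
namespace SimpEmb
/-! ### Adding a central infinitesimal -/
section KZs

/-- the product with `ℤ` -/
def KZ (K1 : Type*) := K1 × Multiplicative ℤ

variable {K1 : Type*} [Group K1]
instance : Group (KZ K1) := inferInstanceAs (Group (K1 × Multiplicative ℤ))

/-- constructor -/
def mz (a : K1) (n : ℤ) : KZ K1 := (a, Multiplicative.ofAdd n)

theorem mz_cases (k : KZ K1) : ∃ a n, k = mz a n := ⟨k.1, Multiplicative.toAdd k.2, rfl⟩
theorem mz_inj {a b : K1} {m n : ℤ} : mz a m = mz b n ↔ a = b ∧ m = n := by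
  constructor
  · intro h
    exact ⟨congrArg Prod.fst h, congrArg (fun k : KZ K1 => Multiplicative.toAdd k.2) h⟩
  · rintro ⟨rfl, rfl⟩; rfl
theorem mz_mul (a b : K1) (m n : ℤ) : mz a m * mz b n = mz (a * b) (m + n) := rfl
theorem mz_inv (a : K1) (m : ℤ) : (mz a m)⁻¹ = mz a⁻¹ (-m) := rfl
theorem mz_one : (1 : KZ K1) = mz 1 0 := rfl

variable [LinearOrder K1]
noncomputable instance : LinearOrder (KZ K1) :=
  LinearOrder.lift' (fun k : KZ K1 => (toLex (k.1, Multiplicative.toAdd k.2) : K1 ×ₗ ℤ)) (by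
    intro k k' h
    exact Prod.ext (congrArg (fun z : K1 ×ₗ ℤ => (ofLex z).1) h) (congrArg (fun z : K1 ×ₗ ℤ => (ofLex z).2) h))

theorem mz_lt {a b : K1} {m n : ℤ} : mz a m < mz b n ↔ a < b ∨ a = b ∧ m < n := by
  change (toLex (a, m) : K1 ×ₗ ℤ) < toLex (b, n) ↔ _
  rw [Prod.Lex.lt_iff]; rfl

theorem csg_mz (a b : K1) (m n : ℤ) : csg (mz a m) (mz b n) = lx (csg a b) (csg m n) :=
  csg_lx mz_lt mz_inj

instance [MulLeftStrictMono K1] : MulLeftStrictMono (KZ K1) where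
  elim := by
    intro c a b h
    obtain ⟨c, l, rfl⟩ := mz_cases c
    obtain ⟨a, m, rfl⟩ := mz_cases a
    obtain ⟨b, n, rfl⟩ := mz_cases b
    rw [mz_lt] at h
    change mz c l * mz a m < mz c l * mz b n
    rw [mz_mul, mz_mul, mz_lt]
    rcases h with h | ⟨rfl, h⟩
    · exact Or.inl (mul_lt_mul_right h c)
    · exact Or.inr ⟨rfl, by omega⟩

instance : NoMaxOrder (KZ K1) where
  exists_gt := by
    intro a
    obtain ⟨a, m, rfl⟩ := mz_cases a
    exact ⟨mz a (m + 1), mz_lt.2 (Or.inr ⟨rfl, by omega⟩)⟩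

/-- generators -/
def yz (y1 : ℕ → K1) : ℕ → KZ K1
  | 0 => mz 1 1
  | n + 1 => mz (y1 n) 0

variable {y1 : ℕ → K1} {R1 : ℕ}

/-- the hom `K1 → KZ K1` -/
def iz : K1 →* KZ K1 := MonoidHom.inl K1 (Multiplicative ℤ)
theorem iz_eq (a : K1) : iz a = mz a 0 := rfl

theorem yz_gen (h : Subgroup.closure (y1 '' {n | n < R1}) = ⊤) :
    Subgroup.closure (yz y1 '' {n | n < R1 + 1}) = ⊤ := by
  set C := Subgroup.closure (yz y1 '' {n | n < R1 + 1})
  have h0 : mz 1 1 ∈ C := Subgroup.subset_closure ⟨0, by simp, rfl⟩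
  have h1 : ∀ a : K1, iz a ∈ C := by
    intro a
    have ha : a ∈ Subgroup.closure (y1 '' {n | n < R1}) := by rw [h]; trivial
    induction ha using Subgroup.closure_induction with
    | mem a ha =>
      obtain ⟨n, hn, rfl⟩ := ha
      exact Subgroup.subset_closure ⟨n + 1, by simpa using hn, rfl⟩
    | one => rw [map_one]; exact one_mem _
    | mul a b _ _ ha hb => rw [map_mul]; exact mul_mem ha hb
    | inv a _ ha => rw [map_inv]; exact inv_mem ha
  have h2 : ∀ n : ℤ, mz (1 : K1) n = (mz 1 1) ^ n := by
    intro n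
    refine Prod.ext ?_ ?_
    · change (1 : K1) = (1 : K1) ^ n; simp
    · change Multiplicative.ofAdd n = (Multiplicative.ofAdd (1 : ℤ)) ^ n
      rw [← ofAdd_zsmul]; simp
  rw [eq_top_iff]
  intro k _
  obtain ⟨a, n, rfl⟩ := mz_cases k
  have : mz a n = iz a * mz 1 n := by rw [iz_eq, mz_mul]; simp
  rw [this, h2]
  exact mul_mem (h1 a) (zpow_mem h0 n)

theorem yz_one (h : ∀ n, R1 ≤ n → y1 n = 1) (n : ℕ) (hn : R1 + 1 ≤ n) : yz y1 n = 1 := by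
  obtain ⟨m, rfl⟩ : ∃ m, n = m + 1 := ⟨n - 1, by omega⟩
  rw [yz, h m (by omega), mz_one]

/-- the `K1`-part of a word -/
def w1 (w : Wd) : Wd := w.flatMap fun p => bif decide (p.1 = 0) then [] else [(p.1 - 1, p.2)]
/-- the exponent sum -/
def wz (w : Wd) : ℤ := w.foldr (fun p r => bif decide (p.1 = 0) then (bif p.2 then r + 1 else r - 1) else r) 0

theorem eval_yz (w : Wd) : evalWord (yz y1) w = mz (evalWord y1 (w1 w)) (wz w) := by
  induction w with
  | nil => rfl
  | cons p w ih =>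
    obtain ⟨n, e⟩ := p
    have e1 : w1 ((n, e) :: w) = (bif decide (n = 0) then [] else [(n - 1, e)]) ++ w1 w := rfl
    have e2 : wz ((n, e) :: w) = bif decide (n = 0) then (bif e then wz w + 1 else wz w - 1) else wz w := rfl
    rw [evalWord_cons, ih, e1, e2, evalWord_append]
    rcases n with _ | n <;> cases e <;> simp [sg, yz, mz_inv, mz_mul, evalWord, mz_inj] <;> ring

/-- sign function of `KZ` -/
def sgz (sgn1 : Wd → ℤ) (w : Wd) : ℤ := lx (sgn1 (w1 w)) (cz (wz w) 0)
theorem C_sgz {sgn1 : Wd → ℤ} (h : Computable sgn1) : Computable (sgz sgn1) := by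
  unfold sgz w1 wz; fun_prop
theorem sgz_eq {sgn1 : Wd → ℤ} (h : ∀ w, sgn1 w = csg (evalWord y1 w) 1) (w : Wd) :
    sgz sgn1 w = csg (evalWord (yz y1) w) 1 := by
  rw [eval_yz, mz_one, csg_mz, sgz, h, cz_eq]

theorem w1_len (w : Wd) : (w1 w).length ≤ w.length := by
  induction w with
  | nil => simp [w1]
  | cons p w ih =>
    have e1 : w1 (p :: w) = (bif decide (p.1 = 0) then [] else [(p.1 - 1, p.2)]) ++ w1 w := rfl
    rw [e1]
    cases decide (p.1 = 0) <;> simp <;> omega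
theorem wz_len (w : Wd) : |wz w| ≤ w.length := by
  induction w with
  | nil => simp [wz]
  | cons p w ih =>
    have e2 : wz (p :: w) = bif decide (p.1 = 0) then (bif p.2 then wz w + 1 else wz w - 1) else wz w := rfl
    rw [e2, List.length_cons]
    rw [Int.abs_eq_natAbs] at ih
    cases decide (p.1 = 0) <;> cases p.2 <;> simp only [cond_true, cond_false] <;> rw [Int.abs_eq_natAbs] <;>
      omega

theorem Bl_yz {L : ℕ} {a : K1} {n : ℤ} (h : mz a n ∈ Bl (yz y1) L) : a ∈ Bl y1 L ∧ |n| ≤ L := by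
  obtain ⟨w, hw, e⟩ := Bl_word h
  rw [eval_yz, mz_inj] at e
  obtain ⟨rfl, rfl⟩ := e
  have := wz_len w
  exact ⟨Bl_mono ((w1_len w).trans hw) (evalWord_mem_Bl _), by omega⟩

theorem Bl_word' (h : ∀ n, R1 ≤ n → y1 n = 1) {L : ℕ} {g : K1} (hg : g ∈ Bl y1 L) :
    ∃ w : Wd, w.length ≤ L ∧ evalWord y1 w = g ∧ ∀ p ∈ w, p.1 < R1 := by
  obtain ⟨w, hw, rfl⟩ := Bl_word hg
  refine ⟨w.filter (fun p => p.1 < R1), (List.length_filter_le _ _).trans hw, ?_, by simp⟩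
  clear hg hw
  induction w with
  | nil => rfl
  | cons p w ih =>
    by_cases hp : p.1 < R1
    · rw [List.filter_cons_of_pos (by simpa using hp), evalWord_cons, evalWord_cons, ih]
    · rw [List.filter_cons_of_neg (by simpa using hp), evalWord_cons, ih, h p.1 (by omega)]
      cases p.2 <;> simp [sg]

/-- replacement integer -/
def nz (L i : ℕ) : ℤ := (i + 1) * (4 * L + 4)

/-- shifted word -/
def wsh (w : Wd) : Wd := w.map fun p => (p.1 + 1, p.2)
theorem eval_wsh (w : Wd) : evalWord (yz y1) (wsh w) = mz (evalWord y1 w) 0 := by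
  induction w with
  | nil => rfl
  | cons p w ih =>
    have : wsh (p :: w) = (p.1 + 1, p.2) :: wsh w := rfl
    rw [this, evalWord_cons, evalWord_cons, ih]
    cases p.2 <;> simp [sg, yz, mz_inv, mz_mul]

/-- power word -/
def wpw (n : ℤ) : Wd := List.replicate n.natAbs (0, decide (0 ≤ n))
theorem eval_wpw (n : ℤ) : evalWord (yz y1) (wpw n) = mz 1 n := by
  have h1 : ∀ m : ℕ, evalWord (yz y1) (List.replicate m (0, true)) = mz 1 m := by
    intro m
    induction m with
    | zero => rfl
    | succ m ih =>
      rw [List.replicate_succ, evalWord_cons, ih]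
      simp [sg, yz, mz_mul, mz_inj]; try ring
  have h2 : ∀ m : ℕ, evalWord (yz y1) (List.replicate m (0, false)) = mz 1 (-m) := by
    intro m
    induction m with
    | zero => rfl
    | succ m ih =>
      rw [List.replicate_succ, evalWord_cons, ih]
      simp [sg, yz, mz_mul, mz_inv, mz_inj]; try ring
  unfold wpw
  by_cases h : 0 ≤ n
  · simp only [h, decide_true, h1]; congr 1; omega
  · simp only [h, decide_false, h2]; congr 1; omega

variable [MulLeftStrictMono K1]

theorem hgenZ (hR : ∀ n, R1 ≤ n → y1 n = 1) (L m : ℕ) (S : Finset (KZ K1)) (hS : S.card ≤ m) :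
    ∃ θ : KZ K1 → Wd, (∀ k, ∀ p ∈ θ k, p.1 < R1 + 1) ∧
      (∀ k, (θ k).length ≤ L + (m + 1) * (4 * L + 4)) ∧
      (∀ c ∈ Bl (yz y1) L, ∀ k ∈ S, csg (c * k) 1 = csg (c * evalWord (yz y1) (θ k)) 1) ∧
      (∀ c ∈ Bl (yz y1) L, ∀ k ∈ S, ∀ r ∈ S, c * evalWord (yz y1) (θ k) = evalWord (yz y1) (θ r) → c * k = r) := by
  classical
  have hfin : (Bl y1 L).Finite := by
    apply Bl_finite
    refine ((Set.finite_lt_nat R1).image y1 |>.insert 1).subset ?_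
    rintro _ ⟨n, rfl⟩
    by_cases h : n < R1
    · exact Or.inr ⟨n, h, rfl⟩
    · exact Or.inl (hR n (by omega))
  -- index function
  obtain ⟨ix, hix1, hix2⟩ : ∃ ix : KZ K1 → ℕ, (∀ k ∈ S, ∀ r ∈ S, ix k = ix r → k = r) ∧ ∀ k, ix k ≤ m := by
    refine ⟨fun k => if h : k ∈ S then (S.equivFin ⟨k, h⟩ : ℕ) else 0, ?_, ?_⟩
    · intro k hk r hr e
      simp only [hk, hr, dif_pos] at e
      have := S.equivFin.injective (Fin.ext e)
      exact congrArg Subtype.val this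
    · intro k
      simp only
      split_ifs with h
      · have := (S.equivFin ⟨k, h⟩).2; omega
      · omega
  have hnz : ∀ i, 4 * (L : ℤ) + 4 ≤ nz L i := by
    intro i; unfold nz; nlinarith [Int.natCast_nonneg i, Int.natCast_nonneg L]
  have hnz1 : ∀ i i' : ℕ, i < i' → nz L i + (4 * L + 4) ≤ nz L i' := by
    intro i i' h
    have : (i : ℤ) + 1 ≤ i' := by exact_mod_cast h
    unfold nz; nlinarith [Int.natCast_nonneg L]
  have hnz2 : ∀ i, i ≤ m → nz L i ≤ (m + 1) * (4 * L + 4) := by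
    intro i h
    have : (i : ℤ) ≤ m := by exact_mod_cast h
    unfold nz; nlinarith [Int.natCast_nonneg L]
  have main : ∀ k : KZ K1, ∃ (b : K1) (n : ℤ), b ∈ Bl y1 L ∧
      ((k = mz b n ∧ |n| ≤ L) ∨ n = nz L (ix k) ∨ n = - nz L (ix k)) ∧
      (∀ c ∈ Bl (yz y1) L, csg (c * k) 1 = csg (c * mz b n) 1) := by
    intro k
    obtain ⟨a, n, rfl⟩ := mz_cases k
    set i := ix (mz a n)
    have hi := hnz i
    by_cases ha : a ∈ Bl y1 L
    · by_cases hn : |n| ≤ L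
      · exact ⟨a, n, ha, Or.inl ⟨rfl, hn⟩, fun _ _ => rfl⟩
      · refine ⟨a, if 0 < n then nz L i else - nz L i, ha, Or.inr ?_, ?_⟩
        · split_ifs <;> simp
        · intro c hc
          obtain ⟨γ, j, rfl⟩ := mz_cases c
          obtain ⟨-, hj⟩ := Bl_yz hc
          rw [mz_mul, mz_mul, mz_one, csg_mz, csg_mz, ← cz_eq, ← cz_eq]
          congr 1
          rw [Int.abs_eq_natAbs] at hn hj
          unfold cz
          split_ifs with h0
          · have e1 : ¬ (j + n < 0) := by omega
            have e2 : ¬ (j + n = 0) := by omega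
            have e3 : ¬ (j + nz L i < 0) := by omega
            have e4 : ¬ (j + nz L i = 0) := by omega
            simp [e1, e2, e3, e4]
          · have e1 : (j + n < 0) := by omega
            have e3 : (j + - nz L i < 0) := by omega
            simp [e1, e3]
    · -- outside the ball
      have hcmp : ∀ γ ∈ Bl y1 L, csg (γ * a) 1 = csg a γ⁻¹ := by
        intro γ _
        rw [← csg_mul (γ * a) 1 γ⁻¹]; simp
      have hne : ∀ γ ∈ Bl y1 L, a ≠ γ⁻¹ := by
        rintro γ hγ rfl; exact ha (Bl_inv hγ)
      by_cases hex : ∃ b ∈ Bl y1 L, b < a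
      · obtain ⟨b, hb, hmax⟩ := (hfin.subset (Set.sep_subset _ (fun b => b < a))).exists_maximal
          (by obtain ⟨b, hb, hb'⟩ := hex; exact ⟨b, hb, hb'⟩)
        refine ⟨b, nz L i, hb.1, Or.inr (Or.inl rfl), ?_⟩
        intro c hc
        obtain ⟨γ, j, rfl⟩ := mz_cases c
        obtain ⟨hγ, hj⟩ := Bl_yz hc
        rw [Int.abs_eq_natAbs] at hj
        rw [mz_mul, mz_mul, mz_one, csg_mz, csg_mz, hcmp γ hγ]
        have e0 : csg (γ * b) 1 = csg b γ⁻¹ := by rw [← csg_mul (γ * b) 1 γ⁻¹]; simp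
        rw [e0]
        have hjn : csg (j + nz L i) 0 = 1 := by
          have e3 : ¬ (j + nz L i < 0) := by omega
          have e4 : ¬ (j + nz L i = 0) := by omega
          simp [csg, e3, e4]
        rw [hjn]
        rcases lt_trichotomy a γ⁻¹ with h | h | h
        · have := hb.2.trans h
          simp [csg, lx, h, this]
        · exact absurd h (hne γ hγ)
        · have h2 : γ⁻¹ ≤ b := by
            by_contra h3
            push Not at h3
            exact absurd (hmax ⟨Bl_inv hγ, h⟩ h3.le) (not_le.2 h3)
          rcases h2.lt_or_eq with h3 | h3
          · simp [csg, lx, h.not_gt, h.ne', h3.not_gt, h3.ne']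
          · rw [h3] at h ⊢; simp [csg, lx, h.not_gt, h.ne']
      · obtain ⟨b, hb, hmin⟩ := hfin.exists_minimal ⟨1, Bl_one L⟩
        refine ⟨b, - nz L i, hb, Or.inr (Or.inr rfl), ?_⟩
        intro c hc
        obtain ⟨γ, j, rfl⟩ := mz_cases c
        obtain ⟨hγ, hj⟩ := Bl_yz hc
        rw [Int.abs_eq_natAbs] at hj
        rw [mz_mul, mz_mul, mz_one, csg_mz, csg_mz, hcmp γ hγ]
        have e0 : csg (γ * b) 1 = csg b γ⁻¹ := by rw [← csg_mul (γ * b) 1 γ⁻¹]; simp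
        rw [e0]
        have hjn : csg (j + - nz L i) 0 = -1 := by
          have e3 : (j + - nz L i < 0) := by omega
          simp [csg, e3]
        rw [hjn]
        have h1 : a < γ⁻¹ := by
          rcases lt_trichotomy a γ⁻¹ with h | h | h
          · exact h
          · exact absurd h (hne γ hγ)
          · exact absurd ⟨_, Bl_inv hγ, h⟩ hex
        have h2 : b ≤ γ⁻¹ := by
          by_contra h3
          push Not at h3
          exact absurd (hmin (Bl_inv hγ) h3.le) (not_le.2 h3)
        rcases h2.lt_or_eq with h3 | h3
        · simp [csg, lx, h1, h3]
        · simp [csg, lx, h1, h3]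
  choose b n hb hcase hsign using main
  have hword : ∀ k, ∃ w : Wd, w.length ≤ L ∧ evalWord y1 w = b k ∧ ∀ p ∈ w, p.1 < R1 := fun k => Bl_word' hR (hb k)
  choose w hw1 hw2 hw3 using hword
  have hev : ∀ k, evalWord (yz y1) (wsh (w k) ++ wpw (n k)) = mz (b k) (n k) := by
    intro k
    rw [evalWord_append, eval_wsh, eval_wpw, mz_mul, hw2]; simp
  refine ⟨fun k => wsh (w k) ++ wpw (n k), ?_, ?_, ?_, ?_⟩
  · intro k p hp
    rcases List.mem_append.1 hp with hp | hp
    · obtain ⟨q, hq, rfl⟩ := List.mem_map.1 hp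
      have := hw3 k q hq
      simp only; omega
    · rw [List.eq_of_mem_replicate hp]; simp only; omega
  · intro k
    have h1 : (wsh (w k)).length = (w k).length := by simp [wsh]
    have h2 : (wpw (n k)).length = (n k).natAbs := by simp [wpw]
    rw [List.length_append, h1, h2]
    have h3 := hw1 k
    have h4 := hnz2 (ix k) (hix2 k)
    have h6 := hnz (ix k)
    have h5 : (n k).natAbs ≤ (m + 1) * (4 * L + 4) := by
      zify
      rcases hcase k with ⟨-, h⟩ | h | h
      · refine h.trans ?_; nlinarith [Int.natCast_nonneg L, Int.natCast_nonneg m]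
      · rw [h, abs_of_nonneg (by omega)]; exact h4
      · rw [h, abs_neg, abs_of_nonneg (by omega)]; exact h4
    omega
  · intro c hc k _
    simp only [hev]
    exact hsign k c hc
  · intro c hc k hk r hr h
    simp only [hev] at h
    obtain ⟨γ, j, rfl⟩ := mz_cases c
    obtain ⟨hγ, hj⟩ := Bl_yz hc
    rw [Int.abs_eq_natAbs] at hj
    rw [mz_mul, mz_inj] at h
    have hk4 := hnz (ix k)
    have hr4 := hnz (ix r)
    have same : (n k = n r) → k = r → mz γ j * k = r := by
      intro e1 e2
      subst e2
      have hj0 : j = 0 := by omega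
      have hγ1 : γ = 1 := by simpa using h.1
      rw [hj0, hγ1, ← mz_one, one_mul]
    have tri := lt_trichotomy (ix k) (ix r)
    rcases hcase k with ⟨ek, h1⟩ | h1 | h1 <;> rcases hcase r with ⟨er, h2⟩ | h2 | h2
    · rw [ek, mz_mul]
      conv_rhs => rw [er]
      rw [mz_inj]; exact h
    all_goals try (rw [Int.abs_eq_natAbs] at h1; exfalso; omega)
    all_goals try (rw [Int.abs_eq_natAbs] at h2; exfalso; omega)
    · rcases tri with t | t | t
      · have := hnz1 _ _ t; exfalso; omega
      · exact same (by rw [h1, h2, t]) (hix1 k hk r hr t)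
      · have := hnz1 _ _ t; exfalso; omega
    · exfalso; omega
    · exfalso; omega
    · rcases tri with t | t | t
      · have := hnz1 _ _ t; exfalso; omega
      · exact same (by rw [h1, h2, t]) (hix1 k hk r hr t)
      · have := hnz1 _ _ t; exfalso; omega

end KZs
end SimpEmb

set_option linter.unusedSectionVars false
set_option linter.unusedSimpArgs false
namespace SimpEmb
/-! ### The finitely generated group containing the family -/

/-- `m+1` if `n = 2^m`, else `0` -/
def lg (n : ℤ) : ℕ :=
  (List.range n.toNat).foldr (fun m r => bif decide (2 ^ m = n.toNat) then m + 1 else r) 0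

theorem lg_aux (x : ℕ) (l : List ℕ) :
    ((∀ m ∈ l, 2 ^ m ≠ x) ∧ l.foldr (fun m r => bif decide (2 ^ m = x) then m + 1 else r) 0 = 0) ∨
    ∃ m, 2 ^ m = x ∧ l.foldr (fun m r => bif decide (2 ^ m = x) then m + 1 else r) 0 = m + 1 := by
  induction l with
  | nil => simp
  | cons a l ih =>
    rw [List.foldr_cons]
    by_cases h : 2 ^ a = x
    · right; exact ⟨a, h, by simp [h]⟩
    · rcases ih with ⟨h1, h2⟩ | ⟨m, h1, h2⟩
      · left
        refine ⟨by simpa [h] using h1, ?_⟩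
        simp only [h, decide_false, cond_false, h2]
      · right
        exact ⟨m, h1, by simp only [h, decide_false, cond_false, h2]⟩

theorem lg_spec {n : ℤ} (h : lg n ≠ 0) : ∃ m : ℕ, n = 2 ^ m ∧ lg n = m + 1 := by
  rcases lg_aux n.toNat (List.range n.toNat) with ⟨_, h2⟩ | ⟨m, h1, h2⟩
  · exact absurd h2 h
  · refine ⟨m, ?_, h2⟩
    have : 0 < n.toNat := by rw [← h1]; positivity
    have h3 : ((2 ^ m : ℕ) : ℤ) = n.toNat := by rw [h1]
    push_cast at h3
    omega

theorem lg_pow (m : ℕ) : lg (2 ^ m) = m + 1 := by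
  have e : (2 ^ m : ℤ).toNat = 2 ^ m := by
    have : (2 ^ m : ℤ) = ((2 ^ m : ℕ) : ℤ) := by push_cast; rfl
    rw [this, Int.toNat_natCast]
  rcases lg_aux (2 ^ m : ℤ).toNat (List.range (2 ^ m : ℤ).toNat) with ⟨h1, _⟩ | ⟨m', h1, h2⟩
  · exact absurd e.symm (h1 m (by rw [e]; simpa using Nat.lt_two_pow_self))
  · rw [e] at h1
    have := Nat.pow_right_injective (le_refl 2) h1
    have this : m' = m := this
    rw [this] at h2; exact h2

theorem lg_le (n : ℤ) : (lg n : ℤ) ≤ |n| := by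
  by_cases h : lg n = 0
  · rw [h]; simp
  · obtain ⟨m, rfl, h2⟩ := lg_spec h
    rw [h2, abs_of_nonneg (by positivity)]
    have := @Nat.lt_two_pow_self m
    exact_mod_cast this

theorem lg_zero : lg 0 = 0 := by
  have := lg_le 0
  simpa using this

/-- markers are sparse -/
theorem lg_sparse {L n x d : ℤ} (hn : 3 * L < |n|) (hx : |x| ≤ L) (hd : |d| ≤ L) (h1 : lg (n + x) ≠ 0)
    (h2 : lg (n + d) ≠ 0) : x = d := by
  obtain ⟨a, ha, -⟩ := lg_spec h1
  obtain ⟨b, hb, -⟩ := lg_spec h2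
  have pa : (0 : ℤ) < 2 ^ a := by positivity
  have pb : (0 : ℤ) < 2 ^ b := by positivity
  rw [Int.abs_eq_natAbs] at hn hx hd
  rcases lt_trichotomy a b with h | h | h
  · have : (2 : ℤ) ^ (a + 1) ≤ 2 ^ b := pow_le_pow_right₀ (by norm_num) h
    rw [pow_succ] at this; omega
  · rw [h] at ha; omega
  · have : (2 : ℤ) ^ (b + 1) ≤ 2 ^ a := pow_le_pow_right₀ (by norm_num) h
    rw [pow_succ] at this; omega

section compK
variable {α : Type*} [Primcodable α]
@[fun_prop] theorem C_lg {f : α → ℤ} (hf : Computable f) : Computable (fun a => lg (f a)) := by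
  unfold lg; fun_prop
end compK

/-- sign -/
def sgb (e : Bool) : ℤ := bif e then 1 else -1
/-- shift in the first coordinate -/
def dn (r : ℕ × Bool) : ℤ := bif decide (r.1 = 0) then sgb r.2 else 0
/-- shift in the second coordinate -/
def dj (r : ℕ × Bool) (n : ℤ) : ℤ :=
  bif (decide (r.1 = 1) && decide (n = 0)) || (decide (r.1 = 2) && decide (lg n % 2 = 1)) then sgb r.2 else 0
/-- code of a column -/
def cdn (n : ℤ) : ℕ × ℕ := Nat.unpair (lg n / 2 - 1)
/-- column test -/
def cdq (n : ℤ) : Bool := !decide (lg n = 0) && decide (lg n % 2 = 0)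
/-- is a multiplication performed? -/
def cd (i r : ℕ) (n j : ℤ) : Bool :=
  decide (r = 2) && (cdq n && (!decide (j < 0) && decide ((cdn n).1 = i)))
/-- symbolic step -/
def stp (i : ℕ) (r : ℕ × Bool) (p : ℤ × ℤ × Wd) : ℤ × ℤ × Wd :=
  (p.1 + dn r, p.2.1 + dj r p.1, bif cd i r.1 p.1 p.2.1 then ((cdn p.1).2, r.2) :: p.2.2 else p.2.2)
/-- symbolic run -/
def rn (i : ℕ) (w : Wd) (p : ℤ × ℤ × Wd) : ℤ × ℤ × Wd := w.foldr (fun r q => stp i r q) p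

section compK
variable {α : Type*} [Primcodable α]
@[fun_prop] theorem C_sgb {f : α → Bool} (hf : Computable f) : Computable (fun a => sgb (f a)) := by
  unfold sgb; fun_prop
@[fun_prop] theorem C_dn {f : α → ℕ × Bool} (hf : Computable f) : Computable (fun a => dn (f a)) := by
  unfold dn; fun_prop
@[fun_prop] theorem C_dj {f : α → ℕ × Bool} {g : α → ℤ} (hf : Computable f) (hg : Computable g) :
    Computable (fun a => dj (f a) (g a)) := by
  unfold dj; fun_prop
@[fun_prop] theorem C_cdn {f : α → ℤ} (hf : Computable f) : Computable (fun a => cdn (f a)) := by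
  unfold cdn; fun_prop
@[fun_prop] theorem C_cdq {f : α → ℤ} (hf : Computable f) : Computable (fun a => cdq (f a)) := by
  unfold cdq; fun_prop
@[fun_prop] theorem C_cd {i r : α → ℕ} {n j : α → ℤ} (hi : Computable i) (hr : Computable r) (hn : Computable n)
    (hj : Computable j) : Computable (fun a => cd (i a) (r a) (n a) (j a)) := by
  unfold cd
  have h1 : Computable (fun a => decide (r a = 2)) := by fun_prop
  have h2 : Computable (fun a => cdq (n a)) := by fun_prop
  have h3 : Computable (fun a => !decide (j a < 0)) := by fun_prop
  have h4 : Computable (fun a => decide ((cdn (n a)).1 = i a)) := C_eq (C_fst (C_cdn hn)) hi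
  exact C_and h1 (C_and h2 (C_and h3 h4))
theorem C_stp {i : α → ℕ} {r : α → ℕ × Bool} {p : α → ℤ × ℤ × Wd} (hi : Computable i) (hr : Computable r)
    (hp : Computable p) : Computable (fun a => stp (i a) (r a) (p a)) := by
  unfold stp
  have hn : Computable (fun a => (p a).1) := by fun_prop
  have hj : Computable (fun a => (p a).2.1) := by fun_prop
  have hv : Computable (fun a => (p a).2.2) := by fun_prop
  have h1 : Computable (fun a => cd (i a) (r a).1 (p a).1 (p a).2.1) := C_cd hi (C_fst hr) hn hj
  have h2 : Computable (fun a => (((cdn (p a).1).2, (r a).2) :: (p a).2.2 : Wd)) :=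
    C_cons (C_pair (C_snd (C_cdn hn)) (C_snd hr)) hv
  exact C_pair (by fun_prop) (C_pair (by fun_prop) (C_cond h1 h2 hv))
theorem C_rn {i : α → ℕ} {w : α → Wd} {p : α → ℤ × ℤ × Wd} (hi : Computable i) (hw : Computable w)
    (hp : Computable p) : Computable (fun a => rn (i a) (w a) (p a)) := by
  unfold rn
  exact C_foldr hw hp (C_stp (by fun_prop) (by fun_prop) (by fun_prop))
end compK

theorem rn_cons (i : ℕ) (r : ℕ × Bool) (w : Wd) (p : ℤ × ℤ × Wd) : rn i (r :: w) p = stp i r (rn i w p) := rfl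
theorem rn_nil (i : ℕ) (p : ℤ × ℤ × Wd) : rn i [] p = p := rfl

theorem dn_abs (r : ℕ × Bool) : |dn r| ≤ 1 := by
  unfold dn sgb; cases decide (r.1 = 0) <;> cases r.2 <;> simp
theorem dj_abs (r : ℕ × Bool) (n : ℤ) : |dj r n| ≤ 1 := by
  unfold dj sgb
  cases ((decide (r.1 = 1) && decide (n = 0)) || (decide (r.1 = 2) && decide (lg n % 2 = 1))) <;> cases r.2 <;> simp

theorem rn_bound (i : ℕ) (w : Wd) (n j : ℤ) (v : Wd) :
    |(rn i w (n, j, v)).1 - n| ≤ w.length ∧ |(rn i w (n, j, v)).2.1 - j| ≤ w.length := by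
  induction w with
  | nil => simp [rn_nil]
  | cons r w ih =>
    rw [rn_cons, stp]
    have h1 := dn_abs r
    have h2 := dj_abs r (rn i w (n, j, v)).1
    rw [Int.abs_eq_natAbs, Int.abs_eq_natAbs] at *
    simp only [List.length_cons]
    omega

/-- two runs with equal conditions -/
theorem rn_sim {i i' : ℕ} {n j j' : ℤ} (w : Wd)
    (h : ∀ x y : ℤ, |x| ≤ w.length → |y| ≤ w.length → cd i 2 (n + x) (j + y) = cd i' 2 (n + x) (j' + y)) :
    (rn i w (n, j, [])).1 = (rn i' w (n, j', [])).1 ∧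
    (rn i w (n, j, [])).2.1 - j = (rn i' w (n, j', [])).2.1 - j' ∧
    (rn i w (n, j, [])).2.2 = (rn i' w (n, j', [])).2.2 := by
  induction w with
  | nil => simp [rn_nil]
  | cons r w ih =>
    obtain ⟨h1, h2, h3⟩ := ih (fun x y hx hy => h x y
      (hx.trans (by simp)) (hy.trans (by simp)))
    obtain ⟨b1, b2⟩ := rn_bound i w n j []
    have hc := h ((rn i w (n, j, [])).1 - n) ((rn i w (n, j, [])).2.1 - j)
      (b1.trans (by simp)) (b2.trans (by simp))
    rw [show n + ((rn i w (n, j, [])).1 - n) = (rn i w (n, j, [])).1 by ring,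
      show j + ((rn i w (n, j, [])).2.1 - j) = (rn i w (n, j, [])).2.1 by ring,
      show j' + ((rn i w (n, j, [])).2.1 - j) = (rn i' w (n, j', [])).2.1 by rw [h2]; ring] at hc
    have hc' : cd i r.1 (rn i w (n, j, [])).1 (rn i w (n, j, [])).2.1 =
        cd i' r.1 (rn i' w (n, j', [])).1 (rn i' w (n, j', [])).2.1 := by
      rw [← h1]
      by_cases hr : r.1 = 2
      · rw [hr]; exact hc
      · simp [cd, hr]
    rw [rn_cons, rn_cons]
    unfold stp
    simp only [hc', h3, ← h1]
    refine ⟨trivial, by omega, trivial⟩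

/-- runs without multiplication -/
theorem rn_nov {i : ℕ} {n j : ℤ} (w : Wd)
    (h : ∀ x y : ℤ, |x| ≤ w.length → cd i 2 (n + x) y = false) : (rn i w (n, j, [])).2.2 = [] := by
  induction w with
  | nil => simp [rn_nil]
  | cons r w ih =>
    have h3 := ih (fun x y hx => h x y (hx.trans (by simp)))
    obtain ⟨b1, b2⟩ := rn_bound i w n j []
    have hc := h ((rn i w (n, j, [])).1 - n) (rn i w (n, j, [])).2.1 (b1.trans (by simp))
    rw [show n + ((rn i w (n, j, [])).1 - n) = (rn i w (n, j, [])).1 by ring] at hc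
    have hc' : cd i r.1 (rn i w (n, j, [])).1 (rn i w (n, j, [])).2.1 = false := by
      by_cases hr : r.1 = 2
      · rw [hr]; exact hc
      · simp [cd, hr]
    rw [rn_cons, stp, hc', h3]; rfl

/-- far run: shift and marker count -/
def fr (d : ℤ) (w : Wd) : ℤ × ℤ :=
  w.foldr (fun r q => (q.1 + dn r, bif decide (r.1 = 2) && decide (q.1 = d) then q.2 + sgb r.2 else q.2)) (0, 0)

theorem fr_cons (d : ℤ) (r : ℕ × Bool) (w : Wd) : fr d (r :: w) =
  ((fr d w).1 + dn r, bif decide (r.1 = 2) && decide ((fr d w).1 = d) then (fr d w).2 + sgb r.2 else (fr d w).2) := rfl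

variable {G : ℕ → Type} [∀ i, Group (G i)] (yG : ∀ i, ℕ → G i)

theorem rn_far {i : ℕ} {n j d : ℤ} (w : Wd) (h : ∀ x : ℤ, |x| ≤ w.length → n + x ≠ 0 ∧ (x ≠ d → lg (n + x) = 0)) :
    (rn i w (n, j, [])).1 = n + (fr d w).1 ∧
    (rn i w (n, j, [])).2.1 = j + (if lg (n + d) % 2 = 1 then (fr d w).2 else 0) ∧
    evalWord (yG i) (rn i w (n, j, [])).2.2 =
      (if cd i 2 (n + d) j = true then yG i (cdn (n + d)).2 else 1) ^ (fr d w).2 := by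
  induction w with
  | nil => simp [rn_nil, fr, evalWord]
  | cons r w ih =>
    obtain ⟨h1, h2, h3⟩ := ih (fun x hx => h x (hx.trans (by simp)))
    obtain ⟨b1, b2⟩ := rn_bound i w n j []
    obtain ⟨hz, hl⟩ := h (fr d w).1 (by
      rw [h1] at b1; rw [show n + (fr d w).1 - n = (fr d w).1 by ring] at b1; exact b1.trans (by simp))
    rw [rn_cons, fr_cons]
    unfold stp
    rw [h1, h2]
    have hz' : decide (n + (fr d w).1 = 0) = false := by simpa using hz
    by_cases hd : (fr d w).1 = d
    · by_cases hr : r.1 = 2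
      · rw [hd] at hz' ⊢
        by_cases hm : lg (n + d) % 2 = 1
        · have hc : ∀ y, cd i 2 (n + d) y = false := by intro y; simp [cd, cdq, hm]
          simp only [hr, hc, hm, dj, hz', decide_true, if_true, Bool.and_self, Bool.true_and, Bool.and_true,
            Bool.or_true, cond_true, cond_false]
          refine ⟨by ring, by ring, ?_⟩
          rw [h3]; simp [hc]
        · simp only [hr, hm, dj, hz', decide_true, if_false, Bool.and_false, decide_false, Bool.and_self, Bool.true_and, Bool.and_true,
            Bool.or_self, cond_true, cond_false, add_zero]
          refine ⟨by ring, trivial, ?_⟩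
          by_cases hc : cd i 2 (n + d) j = true
          · simp only [hc, if_true, cond_true] at h3 ⊢
            rw [evalWord_cons, h3]
            cases r.2 <;> simp only [sg, sgb, cond_true, cond_false, if_true, Bool.false_eq_true, if_false]
            · rw [add_comm (fr d w).2, zpow_add, zpow_neg_one]
            · rw [add_comm (fr d w).2, zpow_add, zpow_one]
          · have hc' : cd i 2 (n + d) j = false := by simpa using hc
            simp only [hc', cond_false, Bool.false_eq_true, if_false, one_zpow] at h3 ⊢
            exact h3
      · have hc : ∀ x y, cd i r.1 x y = false := by intro x y; simp [cd, hr]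
        simp only [hc, hr, dj, hz', decide_false, Bool.and_false, Bool.false_and, Bool.or_self, cond_false, add_zero, h3]
        refine ⟨by ring, trivial, trivial⟩
    · have hl' := hl hd
      have hc : ∀ y, cd i r.1 (n + (fr d w).1) y = false := by intro y; simp [cd, cdq, hl']
      simp only [hc, hd, hl', dj, hz', decide_false, Bool.and_false, Bool.false_and, Bool.or_self, cond_false, add_zero, h3,
        Nat.zero_mod, zero_ne_one]
      refine ⟨by ring, trivial, trivial⟩
end SimpEmb

set_option linter.unusedSectionVars false
set_option linter.unusedSimpArgs false
namespace SimpEmb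
section famK
variable (G : ℕ → Type)

/-- the ordered set on which the group acts -/
def O1 := ℤ × ℤ × (Σ i, G i)

variable {G}
/-- points -/
def p1 (n j : ℤ) (i : ℕ) (g : G i) : O1 G := (n, j, ⟨i, g⟩)
theorem p1_cases (p : O1 G) : ∃ n j i, ∃ g : G i, p = p1 n j i g := ⟨p.1, p.2.1, p.2.2.1, p.2.2.2, rfl⟩
theorem p1_inj {n j n' j' : ℤ} {i : ℕ} {g g' : G i} : p1 n j i g = p1 n' j' i g' ↔ n = n' ∧ j = j' ∧ g = g' := by
  unfold p1
  constructor
  · intro h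
    have h1 := congrArg (fun p : O1 G => p.1) h
    have h2 := congrArg (fun p : O1 G => p.2.1) h
    have h3 := congrArg (fun p : O1 G => p.2.2) h
    exact ⟨h1, h2, by simpa using h3⟩
  · rintro ⟨rfl, rfl, rfl⟩; rfl
theorem p1_inj' {n j n' j' : ℤ} {i i' : ℕ} {g : G i} {g' : G i'} (h : p1 n j i g = p1 n' j' i' g') :
    n = n' ∧ j = j' ∧ i = i' :=
  ⟨congrArg (fun p : O1 G => p.1) h, congrArg (fun p : O1 G => p.2.1) h, congrArg (fun p : O1 G => p.2.2.1) h⟩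

section ord
variable [∀ i, LinearOrder (G i)]
noncomputable instance : LinearOrder (O1 G) :=
  LinearOrder.lift' (fun p : O1 G => (toLex (p.1, toLex (p.2.1, toLex p.2.2)) : ℤ ×ₗ (ℤ ×ₗ (Σₗ i, G i)))) (by
    intro k k' h
    have h1 := congrArg (fun z : ℤ ×ₗ (ℤ ×ₗ (Σₗ i, G i)) => (ofLex z).1) h
    have h2 := congrArg (fun z : ℤ ×ₗ (ℤ ×ₗ (Σₗ i, G i)) => (ofLex (ofLex z).2).1) h
    have h3 := congrArg (fun z : ℤ ×ₗ (ℤ ×ₗ (Σₗ i, G i)) => ofLex (ofLex (ofLex z).2).2) h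
    exact Prod.ext h1 (Prod.ext h2 h3))

theorem p1_lt {n j n' j' : ℤ} {i i' : ℕ} {g : G i} {g' : G i'} :
    p1 n j i g < p1 n' j' i' g' ↔ n < n' ∨ n = n' ∧ (j < j' ∨ j = j' ∧ (i < i' ∨ ∃ h : i = i', h ▸ g < g')) := by
  change (toLex (n, toLex (j, toLex (⟨i, g⟩ : Σ i, G i))) : ℤ ×ₗ (ℤ ×ₗ (Σₗ i, G i))) <
    toLex (n', toLex (j', toLex (⟨i', g'⟩ : Σ i, G i))) ↔ _
  rw [Prod.Lex.lt_iff]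
  refine or_congr Iff.rfl (and_congr Iff.rfl ?_)
  change (toLex (j, toLex (⟨i, g⟩ : Σ i, G i)) : (ℤ ×ₗ (Σₗ i, G i))) <
    toLex (j', toLex (⟨i', g'⟩ : Σ i, G i)) ↔ _
  rw [Prod.Lex.lt_iff]
  refine or_congr Iff.rfl (and_congr Iff.rfl ?_)
  exact Sigma.lex_iff

theorem csg_p1 {n j n' j' : ℤ} {i : ℕ} {g g' : G i} :
    csg (p1 n j i g) (p1 n' j' i g') = lx (csg n n') (lx (csg j j') (csg g g')) := by
  have e : lx (csg j j') (csg g g') = csg (toLex (j, g) : ℤ ×ₗ G i) (toLex (j', g')) := by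
    refine (csg_lx ?_ ?_).symm
    · rw [Prod.Lex.lt_iff]; rfl
    · rw [toLex.injective.eq_iff, Prod.mk.injEq]
  rw [e]
  refine csg_lx ?_ ?_
  · rw [p1_lt, Prod.Lex.lt_iff]; simp
  · rw [p1_inj, toLex.injective.eq_iff, Prod.mk.injEq]
end ord

variable [∀ i, Group (G i)] (yG : ∀ i, ℕ → G i)

/-- action of a letter -/
def ac (r : ℕ × Bool) (p : O1 G) : O1 G :=
  p1 (p.1 + dn r) (p.2.1 + dj r p.1) p.2.2.1
    ((if cd p.2.2.1 r.1 p.1 p.2.1 = true then yb (yG p.2.2.1) ((cdn p.1).2, r.2) else 1) * p.2.2.2)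

theorem ac_p1 (r : ℕ × Bool) (n j : ℤ) (i : ℕ) (g : G i) : ac yG r (p1 n j i g) =
  p1 (n + dn r) (j + dj r n) i ((if cd i r.1 n j = true then yb (yG i) ((cdn n).2, r.2) else 1) * g) := rfl

theorem ac_inv (r : ℕ) (e : Bool) (p : O1 G) : ac yG (r, !e) (ac yG (r, e) p) = p := by
  obtain ⟨n, j, i, g, rfl⟩ := p1_cases p
  rw [ac_p1, ac_p1, p1_inj]
  have hs : sgb (!e) = - sgb e := by cases e <;> rfl
  by_cases h0 : r = 0
  · subst h0
    refine ⟨?_, ?_, ?_⟩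
    · simp [dn, hs]
    · simp [dj]
    · simp [cd]
  · have e1 : ∀ e, dn (r, e) = 0 := by intro e; simp [dn, h0]
    have e2 : dj (r, !e) n = - dj (r, e) n := by
      simp only [dj, hs]
      cases (decide (r = 1) && decide (n = 0) || decide (r = 2) && decide (lg n % 2 = 1)) <;> simp
    simp only [e1, e2, add_zero]
    refine ⟨trivial, by ring, ?_⟩
    by_cases hc : cd i r n j = true
    · have hm : lg n % 2 = 0 ∧ r = 2 := by
        simp only [cd, cdq, Bool.and_eq_true, decide_eq_true_eq] at hc
        exact ⟨hc.2.1.2, hc.1⟩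
      have e3 : dj (r, e) n = 0 := by simp [dj, hm]
      rw [e3, add_zero]
      rw [if_pos hc, if_pos hc, ← mul_assoc]
      cases e <;> simp [yb]
    · have e4 : cd i r n (j + dj (r, e) n) = true → False := by
        intro h
        have hm : lg n % 2 = 0 ∧ r = 2 := by
          simp only [cd, cdq, Bool.and_eq_true, decide_eq_true_eq] at h
          exact ⟨h.2.1.2, h.1⟩
        have e3 : dj (r, e) n = 0 := by simp [dj, hm]
        rw [e3, add_zero] at h
        exact hc h
      rw [if_neg hc, if_neg e4]; simp

/-- generating permutations -/
def yP (r : ℕ) : Equiv.Perm (O1 G) where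
  toFun := ac yG (r, true)
  invFun := ac yG (r, false)
  left_inv := ac_inv yG r true
  right_inv := ac_inv yG r false

theorem yP_sg (r : ℕ × Bool) (p : O1 G) : sg (yP yG r.1) r.2 p = ac yG r p := by
  obtain ⟨r, e⟩ := r
  cases e
  · change (yP yG r)⁻¹ p = _; rfl
  · rfl

theorem yP_one {r : ℕ} (h : 3 ≤ r) : yP yG r = 1 := by
  ext1 p
  obtain ⟨n, j, i, g, rfl⟩ := p1_cases p
  change ac yG (r, true) (p1 n j i g) = p1 n j i g
  rw [ac_p1, p1_inj]
  have h0 : r ≠ 0 := by omega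
  have h1 : r ≠ 1 := by omega
  have h2 : r ≠ 2 := by omega
  simp [dn, dj, cd, h0, h1, h2]

theorem yP_run (w : Wd) (n j : ℤ) (i : ℕ) (g : G i) : evalWord (yP yG) w (p1 n j i g) =
    p1 (rn i w (n, j, [])).1 (rn i w (n, j, [])).2.1 i (evalWord (yG i) (rn i w (n, j, [])).2.2 * g) := by
  induction w with
  | nil => simp [evalWord, rn_nil]
  | cons r w ih =>
    rw [evalWord_cons, Equiv.Perm.mul_apply, ih, yP_sg, ac_p1, rn_cons, stp, p1_inj]
    refine ⟨rfl, rfl, ?_⟩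
    simp only
    cases cd i r.1 (rn i w (n, j, [])).1 (rn i w (n, j, [])).2.1
    · simp
    · simp only [cond_true, if_true, evalWord_cons, mul_assoc]; rfl

/-- the group -/
def K1 : Subgroup (Equiv.Perm (O1 G)) := Subgroup.closure (Set.range (fun r : Fin 3 => yP yG r))

theorem yP_mem (r : ℕ) : yP yG r ∈ K1 yG := by
  by_cases h : r < 3
  · exact Subgroup.subset_closure ⟨⟨r, h⟩, rfl⟩
  · rw [yP_one yG (by omega)]; exact one_mem _

/-- the generators -/
def y1 (r : ℕ) : K1 yG := ⟨yP yG r, yP_mem yG r⟩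

theorem y1_one (r : ℕ) (h : 3 ≤ r) : y1 yG r = 1 := Subtype.ext (yP_one yG h)

theorem y1_word (w : Wd) : ((evalWord (y1 yG) w : K1 yG) : Equiv.Perm (O1 G)) = evalWord (yP yG) w :=
  evalWord_map (K1 yG).subtype (y1 yG) w

theorem y1_surj (k : K1 yG) : ∃ w, evalWord (y1 yG) w = k := by
  obtain ⟨w, -, h⟩ := exists_word (yP yG) 3 k k.2
  exact ⟨w, Subtype.ext (by rw [y1_word, h])⟩

theorem y1_gen : Subgroup.closure (y1 yG '' {n | n < 3}) = ⊤ := by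
  rw [eq_top_iff]
  rintro k -
  obtain ⟨w, rfl⟩ := y1_surj yG k
  induction w with
  | nil => exact one_mem _
  | cons r w ih =>
    rw [evalWord_cons]
    refine mul_mem ?_ ih
    have : y1 yG r.1 ∈ Subgroup.closure (y1 yG '' {n | n < 3}) := by
      by_cases h : r.1 < 3
      · exact Subgroup.subset_closure ⟨_, h, rfl⟩
      · rw [y1_one yG _ (by omega)]; exact one_mem _
    unfold sg
    split_ifs
    · exact this
    · exact inv_mem this

section ord
variable [∀ i, LinearOrder (G i)] [∀ i, MulLeftStrictMono (G i)]

theorem ac_mono (r : ℕ × Bool) : StrictMono (ac yG r) := by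
  intro p q h
  obtain ⟨n, j, i, g, rfl⟩ := p1_cases p
  obtain ⟨n', j', i', g', rfl⟩ := p1_cases q
  rw [p1_lt] at h
  rw [ac_p1, ac_p1, p1_lt]
  rcases h with h | ⟨rfl, h | ⟨rfl, h | ⟨rfl, h⟩⟩⟩
  · left; omega
  · right; exact ⟨rfl, Or.inl (by omega)⟩
  · right; exact ⟨rfl, Or.inr ⟨rfl, Or.inl h⟩⟩
  · right; exact ⟨rfl, Or.inr ⟨rfl, Or.inr ⟨rfl, mul_lt_mul_right h _⟩⟩⟩

theorem K1_mono (k : K1 yG) : StrictMono ((K1 yG).subtype k) := by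
  obtain ⟨w, rfl⟩ := y1_surj yG k
  rw [Subgroup.coe_subtype, y1_word]
  induction w with
  | nil => exact strictMono_id
  | cons r w ih =>
    have : ⇑(evalWord (yP yG) (r :: w)) = ac yG r ∘ ⇑(evalWord (yP yG) w) := by
      funext p
      rw [evalWord_cons, Equiv.Perm.mul_apply, yP_sg]; rfl
    rw [this]
    exact (ac_mono yG r).comp ih

/-- symbolic sign -/
def sS (sg1 : ℕ → Wd → ℤ) (w : Wd) (c : ℤ × ℤ × ℕ) : ℤ :=
  lx (cz (rn c.2.2 w (c.1, c.2.1, [])).1 c.1) (lx (cz (rn c.2.2 w (c.1, c.2.1, [])).2.1 c.2.1)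
    (sg1 c.2.2 (rn c.2.2 w (c.1, c.2.1, [])).2.2))

theorem C_sS {sg1 : ℕ → Wd → ℤ} (h : Computable (fun p : ℕ × Wd => sg1 p.1 p.2)) :
    Computable (fun p : Wd × (ℤ × ℤ × ℕ) => sS sg1 p.1 p.2) := by
  unfold sS
  have hr : Computable (fun p : Wd × (ℤ × ℤ × ℕ) => rn p.2.2.2 p.1 (p.2.1, p.2.2.1, [])) :=
    C_rn (by fun_prop) (by fun_prop) (by fun_prop)
  have hs : Computable (fun p : Wd × (ℤ × ℤ × ℕ) => sg1 p.2.2.2 (rn p.2.2.2 p.1 (p.2.1, p.2.2.1, [])).2.2) :=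
    h.comp (C_pair (f := fun p : Wd × (ℤ × ℤ × ℕ) => p.2.2.2) (by fun_prop) (C_snd (C_snd hr)))
  exact C_lx (C_cz (C_fst hr) (by fun_prop)) (C_lx (C_cz (C_fst (C_snd hr)) (by fun_prop)) hs)

/-- integers in an interval -/
def zr (N : ℕ) : List ℤ := (List.range (2 * N + 1)).map (fun x : ℕ => (x : ℤ) - (N : ℤ))
theorem mem_zr {N : ℕ} {x : ℤ} (h : |x| ≤ N) : x ∈ zr N := by
  unfold zr
  rw [List.mem_map]
  rw [Int.abs_eq_natAbs] at h
  exact ⟨(x + N).toNat, by rw [List.mem_range]; omega, by omega⟩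
theorem C_zr {α : Type*} [Primcodable α] {f : α → ℕ} (hf : Computable f) : Computable (fun a => zr (f a)) := by
  unfold zr; fun_prop

/-- test points -/
def ts (w : Wd) : List (ℤ × ℤ × ℕ) :=
  (zr (2 ^ (2 * w.length + 2) + w.length)).flatMap fun n =>
    (zr (w.length + 1)).flatMap fun j => (List.range (4 * w.length + 2)).map fun i => (n, j, i)
theorem C_ts : Computable ts := by
  unfold ts
  have h1 : Computable (fun w : Wd => 2 ^ (2 * w.length + 2) + w.length) := by fun_prop
  have h2 : Computable (fun p : Wd × ℤ => p.1.length + 1) := by fun_prop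
  have h3 : Computable (fun p : (Wd × ℤ) × ℤ => List.range (4 * p.1.1.length + 2)) :=
    C_range (C_nadd (C_nmul (C_const 4) (C_length (C_fst (C_fst C_id)))) (C_const 2))
  have h4 : Computable (fun q : ((Wd × ℤ) × ℤ) × ℕ => (q.1.1.2, q.1.2, q.2)) := by fun_prop
  exact C_flatMap (C_zr h1) (C_flatMap (f := fun p : Wd × ℤ => zr (p.1.length + 1))
    (h := fun p j => (List.range (4 * p.1.length + 2)).map fun i => (p.2, j, i)) (C_zr h2)
    (C_map (h := fun (p : (Wd × ℤ) × ℤ) (i : ℕ) => (p.1.2, p.2, i)) h3 h4))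
theorem mem_ts {w : Wd} {n j : ℤ} {i : ℕ} (hn : |n| ≤ 2 ^ (2 * w.length + 2) + w.length) (hj : |j| ≤ w.length + 1)
    (hi : i < 4 * w.length + 2) : (n, j, i) ∈ ts w := by
  unfold ts
  simp only [List.mem_flatMap, List.mem_map, List.mem_range]
  exact ⟨n, mem_zr (by push_cast; exact hn), j, mem_zr (by push_cast; exact hj), i, hi, rfl⟩

end ord
end famK
end SimpEmb

set_option linter.unusedSectionVars false
set_option linter.unusedSimpArgs false
namespace SimpEmb
section famK
variable {G : ℕ → Type} [∀ i, Group (G i)] (yG : ∀ i, ℕ → G i)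

/-- the word fixes the point -/
def gd (w : Wd) (n j : ℤ) (i : ℕ) : Prop :=
  (rn i w (n, j, [])).1 = n ∧ (rn i w (n, j, [])).2.1 = j ∧ evalWord (yG i) (rn i w (n, j, [])).2.2 = 1

theorem gd_iff (w : Wd) (n j : ℤ) (i : ℕ) (g : G i) :
    evalWord (yP yG) w (p1 n j i g) = p1 n j i g ↔ gd yG w n j i := by
  rw [yP_run, p1_inj, gd]; simp

theorem cd_big {i : ℕ} {n : ℤ} (h : |n| ≤ i) (r : ℕ) (j : ℤ) : cd i r n j = false := by
  by_contra hc
  have hc : cd i r n j = true := by simpa using hc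
  simp only [cd, cdq, cdn, Bool.and_eq_true, decide_eq_true_eq, Bool.not_eq_true', decide_eq_false_iff_not] at hc
  have h1 := lg_le n
  have h2 := Nat.unpair_left_le (lg n / 2 - 1)
  have h3 := hc.2.1.1
  have h4 : (Nat.unpair (lg n / 2 - 1)).1 = i := of_decide_eq_true hc.2.2.2
  omega

theorem cd_j {i : ℕ} {n j j' : ℤ} (h : 0 ≤ j ↔ 0 ≤ j') (r : ℕ) : cd i r n j = cd i r n j' := by
  have : decide (j < 0) = decide (j' < 0) := by
    rw [decide_eq_decide]; omega
  simp [cd, this]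

theorem wp_far {w : Wd} {n j d : ℤ} {i : ℕ} (hn : 3 * (w.length : ℤ) < |n|) (_hd : |d| ≤ w.length)
    (h : ∀ x : ℤ, |x| ≤ w.length → lg (n + x) ≠ 0 → x = d) (h1 : (fr d w).1 = 0) (h2 : (fr d w).2 = 0) :
    gd yG w n j i := by
  obtain ⟨e1, e2, e3⟩ := rn_far yG (i := i) (n := n) (j := j) (d := d) w (by
    intro x hx
    refine ⟨?_, fun hxd => ?_⟩
    · rw [Int.abs_eq_natAbs] at *; omega
    · by_contra hc; exact hxd (h x hx hc))
  rw [h2] at e2 e3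
  rw [h1] at e1
  exact ⟨by simpa using e1, by simpa using e2, by simpa using e3⟩

theorem wp (w : Wd) (H : ∀ n j i, (n, j, i) ∈ ts w → gd yG w n j i) (n j : ℤ) (i : ℕ) : gd yG w n j i := by
  set L : ℤ := (w.length : ℤ) with hL
  have hL0 : 0 ≤ L := by omega
  by_cases hn : |n| ≤ 3 * L
  · -- near
    obtain ⟨j', hj', hjj⟩ : ∃ j' : ℤ, |j'| ≤ L + 1 ∧ ∀ y : ℤ, |y| ≤ L → (0 ≤ j + y ↔ 0 ≤ j' + y) := by
      by_cases h1 : L + 1 < j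
      · refine ⟨L + 1, by rw [Int.abs_eq_natAbs]; omega, fun y hy => ?_⟩
        rw [Int.abs_eq_natAbs] at hy; omega
      · by_cases h2 : j < - (L + 1)
        · refine ⟨-(L + 1), by rw [Int.abs_eq_natAbs]; omega, fun y hy => ?_⟩
          rw [Int.abs_eq_natAbs] at hy; omega
        · exact ⟨j, by rw [Int.abs_eq_natAbs]; omega, fun y hy => Iff.rfl⟩
    have hN : |n| ≤ 2 ^ (2 * w.length + 2) + (w.length : ℤ) := by
      have h3 : (2 * w.length + 2 : ℕ) < 2 ^ (2 * w.length + 2) := Nat.lt_two_pow_self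
      have h4 : ((2 * w.length + 2 : ℕ) : ℤ) < 2 ^ (2 * w.length + 2) := by exact_mod_cast h3
      push_cast at h4
      omega
    by_cases hi : i < 4 * w.length + 2
    · obtain ⟨g1, g2, g3⟩ := H n j' i (mem_ts hN hj' hi)
      obtain ⟨e1, e2, e3⟩ := rn_sim (i := i) (i' := i) (n := n) (j := j) (j' := j') w
        (fun x y _ hy => cd_j (hjj y hy) 2)
      rw [← e1] at g1
      rw [← e3] at g3
      exact ⟨g1, by omega, g3⟩
    · obtain ⟨g1, g2, g3⟩ := H n j' (4 * w.length + 1) (mem_ts hN hj' (by omega))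
      have hb : ∀ i' : ℕ, 4 * w.length + 1 ≤ i' → ∀ x y : ℤ, |x| ≤ L → cd i' 2 (n + x) y = false := by
        intro i' hi' x y hx
        apply cd_big
        rw [Int.abs_eq_natAbs] at *; omega
      obtain ⟨e1, e2, e3⟩ := rn_sim (i := i) (i' := 4 * w.length + 1) (n := n) (j := j) (j' := j') w
        (fun x y hx hy => by rw [hb i (by omega) x _ hx, hb _ le_rfl x _ hx])
      have e4 := rn_nov (i := i) (n := n) (j := j) w (fun x y hx => hb i (by omega) x y hx)
      rw [← e1] at g1
      refine ⟨g1, by omega, ?_⟩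
      rw [e4]; rfl
  · -- far
    have key : ∀ d : ℤ, |d| ≤ L → (fr d w).1 = 0 ∧ (fr d w).2 = 0 := by
      intro d hd
      set N : ℤ := 2 ^ (2 * w.length + 2) with hNdef
      have h4 : 4 * L + 4 ≤ N := by
        have h3 : (2 * w.length + 1 : ℕ) < 2 ^ (2 * w.length + 1) := Nat.lt_two_pow_self
        have h4 : ((2 * w.length + 1 : ℕ) : ℤ) < 2 ^ (2 * w.length + 1) := by exact_mod_cast h3
        rw [hNdef, pow_succ]
        push_cast at h4
        omega
      have hlN : lg (N - d + d) = 2 * w.length + 3 := by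
        rw [sub_add_cancel, hNdef, lg_pow]
      have hbig : 3 * L < |N - d| := by rw [Int.abs_eq_natAbs] at *; omega
      obtain ⟨e1, e2, e3⟩ := rn_far yG (i := 0) (n := N - d) (j := 0) (d := d) w (by
        intro x hx
        refine ⟨?_, fun hxd => ?_⟩
        · rw [Int.abs_eq_natAbs] at *; omega
        · by_contra hc
          exact hxd (lg_sparse hbig hx hd hc (by rw [hlN]; omega)))
      obtain ⟨g1, g2, -⟩ := H (N - d) 0 0 (mem_ts (by
          rw [← hNdef]; rw [Int.abs_eq_natAbs] at *; omega) (by simp; omega) (by omega))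
      rw [hlN, if_pos (by omega)] at e2
      omega
    push Not at hn
    by_cases hex : ∃ d : ℤ, |d| ≤ L ∧ lg (n + d) ≠ 0
    · obtain ⟨d, hd, hd'⟩ := hex
      obtain ⟨k1, k2⟩ := key d hd
      exact wp_far yG hn hd (fun x hx hx' => lg_sparse hn hx hd hx' hd') k1 k2
    · push Not at hex
      obtain ⟨k1, k2⟩ := key 0 (by simpa using hL0)
      exact wp_far yG (d := 0) hn (by simp) (fun x hx hx' => absurd (hex x hx) hx') k1 k2

variable [∀ i, LinearOrder (G i)] [∀ i, MulLeftStrictMono (G i)]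

theorem K1_computable {sg1 : ℕ → Wd → ℤ} (h : Computable (fun p : ℕ × Wd => sg1 p.1 p.2))
    (hsg : ∀ i w, sg1 i w = csg (evalWord (yG i) w) 1) : ComputableLeftOrderWrt (y1 yG) := by
  have hv : ∀ w c, sS sg1 w c = csg ((K1 yG).subtype (evalWord (y1 yG) w) (p1 c.1 c.2.1 c.2.2 (1 : G c.2.2)))
      (p1 c.1 c.2.1 c.2.2 (1 : G c.2.2)) := by
    intro w c
    rw [Subgroup.coe_subtype, y1_word, yP_run, csg_p1, mul_one, sS, cz_eq, cz_eq, hsg]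
  refine gl (K1 yG).subtype (fun c : ℤ × ℤ × ℕ => p1 c.1 c.2.1 c.2.2 (1 : G c.2.2)) (K1_mono yG) (y1 yG)
    (y1_surj yG) (sS sg1) (C_sS h) hv ts C_ts ?_
  intro w hw
  have := wp yG w (fun n j i hc => by
    have h0 := hw _ hc
    rw [hv, csg_eq_zero, Subgroup.coe_subtype, y1_word, gd_iff] at h0
    exact h0)
  refine Subtype.ext (Equiv.ext fun p => ?_)
  obtain ⟨n, j, i, g, rfl⟩ := p1_cases p
  rw [y1_word, (gd_iff yG w n j i g).2 (this n j i)]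
  rfl

end famK
end SimpEmb

set_option linter.unusedSectionVars false
set_option linter.unusedSimpArgs false
namespace SimpEmb
section famK
open scoped commutatorElement
variable {G : ℕ → Type} [∀ i, Group (G i)] (yG : ∀ i, ℕ → G i)

open Classical in
/-- local action -/
noncomputable def lcA (i : ℕ) (a : G i) (p : O1 G) : O1 G :=
  if h : p.2.2.1 = i ∧ p.1 = 0 ∧ p.2.1 = 0 then p1 0 0 i (a * (h.1 ▸ p.2.2.2)) else p

theorem lcA_in (i : ℕ) (a g : G i) : lcA i a (p1 0 0 i g) = p1 0 0 i (a * g) := by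
  unfold lcA
  rw [dif_pos (by exact ⟨rfl, rfl, rfl⟩)]; rfl

theorem lcA_out (i : ℕ) (a : G i) {n j : ℤ} {i' : ℕ} (g : G i') (h : ¬ (i' = i ∧ n = 0 ∧ j = 0)) :
    lcA i a (p1 n j i' g) = p1 n j i' g := by
  unfold lcA
  rw [dif_neg (by exact h)]

theorem lcA_mul (i : ℕ) (a b : G i) (p : O1 G) : lcA i a (lcA i b p) = lcA i (a * b) p := by
  obtain ⟨n, j, i', g, rfl⟩ := p1_cases p
  by_cases h : i' = i ∧ n = 0 ∧ j = 0
  · obtain ⟨rfl, rfl, rfl⟩ := h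
    rw [lcA_in, lcA_in, lcA_in, mul_assoc]
  · rw [lcA_out i b g h, lcA_out i a g h, lcA_out i _ g h]

theorem lcA_one (i : ℕ) (p : O1 G) : lcA i (1 : G i) p = p := by
  obtain ⟨n, j, i', g, rfl⟩ := p1_cases p
  by_cases h : i' = i ∧ n = 0 ∧ j = 0
  · obtain ⟨rfl, rfl, rfl⟩ := h
    rw [lcA_in, one_mul]
  · rw [lcA_out i _ g h]

/-- local action as a homomorphism -/
noncomputable def Ph (i : ℕ) : G i →* Equiv.Perm (O1 G) where
  toFun a := ⟨lcA i a, lcA i a⁻¹, fun p => by rw [lcA_mul, inv_mul_cancel, lcA_one],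
    fun p => by rw [lcA_mul, mul_inv_cancel, lcA_one]⟩
  map_one' := Equiv.ext fun p => lcA_one i p
  map_mul' a b := Equiv.ext fun p => (lcA_mul i a b p).symm

theorem Ph_apply (i : ℕ) (a : G i) (p : O1 G) : Ph i a p = lcA i a p := rfl

theorem yP0 (n j : ℤ) (i : ℕ) (g : G i) : yP yG 0 (p1 n j i g) = p1 (n + 1) j i g := by
  change ac yG (0, true) _ = _
  rw [ac_p1, p1_inj]; simp [dn, dj, cd, sgb]

theorem yP0_pow (k : ℕ) (n j : ℤ) (i : ℕ) (g : G i) : (yP yG 0 ^ k) (p1 n j i g) = p1 (n + k) j i g := by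
  induction k with
  | zero => simp
  | succ k ih =>
    rw [pow_succ', Equiv.Perm.mul_apply, ih, yP0]
    congr 1; push_cast; ring

theorem yP1 (n j : ℤ) (i : ℕ) (g : G i) : yP yG 1 (p1 n j i g) = p1 n (if n = 0 then j + 1 else j) i g := by
  change ac yG (1, true) _ = _
  rw [ac_p1, p1_inj]
  by_cases h : n = 0 <;> simp [dn, dj, cd, sgb, h]

theorem yP2 (m : ℕ) (hm : m % 2 = 1) (j : ℤ) (i : ℕ) (g : G i) : yP yG 2 (p1 (2 ^ m) j i g) =
    p1 (2 ^ m) j i ((if 0 ≤ j ∧ (Nat.unpair (m / 2)).1 = i then yG i (Nat.unpair (m / 2)).2 else 1) * g) := by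
  change ac yG (2, true) _ = _
  have e : (m + 1) / 2 - 1 = m / 2 := by omega
  have e2 : (m + 1) % 2 = 0 := by omega
  rw [ac_p1, p1_inj]
  simp [dn, dj, cd, cdq, cdn, lg_pow, e, e2, yb]

theorem yP2_fst (p : O1 G) : (yP yG 2 p).1 = p.1 := by
  change (ac yG (2, true) p).1 = _
  obtain ⟨n, j, i', g, rfl⟩ := p1_cases p
  rw [ac_p1]; simp [dn, p1]

/-- conjugate -/
def gk (m : ℕ) : Equiv.Perm (O1 G) := (yP yG 0 ^ (2 ^ m : ℕ))⁻¹ * yP yG 2 * yP yG 0 ^ (2 ^ m : ℕ)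

theorem gk_mem (m : ℕ) : gk yG m ∈ K1 yG :=
  mul_mem (mul_mem (inv_mem (pow_mem (yP_mem yG 0) _)) (yP_mem yG 2)) (pow_mem (yP_mem yG 0) _)

theorem gk_zero (m : ℕ) (hm : m % 2 = 1) (j : ℤ) (i : ℕ) (g : G i) : gk yG m (p1 0 j i g) =
    p1 0 j i ((if 0 ≤ j ∧ (Nat.unpair (m / 2)).1 = i then yG i (Nat.unpair (m / 2)).2 else 1) * g) := by
  unfold gk
  rw [Equiv.Perm.mul_apply, Equiv.Perm.mul_apply, yP0_pow, Equiv.Perm.inv_eq_iff_eq, yP0_pow]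
  have : (0 : ℤ) + ((2 ^ m : ℕ) : ℤ) = 2 ^ m := by push_cast; ring
  rw [this, yP2 yG m hm]

theorem gk_fst (m : ℕ) (p : O1 G) : (gk yG m p).1 = p.1 := by
  obtain ⟨n, j, i, g, rfl⟩ := p1_cases p
  obtain ⟨n', j', i', g', e⟩ := p1_cases (gk yG m (p1 n j i g))
  have e2 := e
  unfold gk at e2
  rw [Equiv.Perm.mul_apply, Equiv.Perm.mul_apply, yP0_pow, Equiv.Perm.inv_eq_iff_eq, yP0_pow] at e2
  have := yP2_fst yG (p1 (n + (2 ^ m : ℕ)) j i g)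
  rw [e2] at this
  rw [e]
  simp only [p1] at this ⊢
  omega

theorem Ph_gen (i r : ℕ) : Ph i (yG i r) = ⁅gk yG (2 * Nat.pair i r + 1), yP yG 1⁆ := by
  set m := 2 * Nat.pair i r + 1 with hm
  have hm1 : m % 2 = 1 := by omega
  have hm2 : Nat.unpair (m / 2) = (i, r) := by
    rw [show m / 2 = Nat.pair i r by omega, Nat.unpair_pair]
  rw [commutatorElement_def, eq_mul_inv_iff_mul_eq, eq_mul_inv_iff_mul_eq]
  ext1 p
  obtain ⟨n, j, i', g, rfl⟩ := p1_cases p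
  simp only [Equiv.Perm.mul_apply, Ph_apply]
  by_cases hn : n = 0
  · subst hn
    rw [gk_zero yG m hm1, yP1, yP1, if_pos rfl, gk_zero yG m hm1, hm2]
    simp only [if_true]
    by_cases hi : i = i'
    · subst hi
      by_cases hj : j + 1 = 0
      · rw [hj, lcA_in, p1_inj]
        have : ¬ (0 ≤ j) := by omega
        simp [this]
      · rw [lcA_out _ _ _ (by simp [hj]), p1_inj]
        have : 0 ≤ j ↔ 0 ≤ j + 1 := by omega
        simp [this]
    · rw [lcA_out _ _ _ (by simp [Ne.symm hi]), p1_inj]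
      simp [hi]
  · rw [yP1, if_neg hn]
    have hf := gk_fst yG m (p1 n j i' g)
    obtain ⟨n', j', i'', g', e⟩ := p1_cases (gk yG m (p1 n j i' g))
    rw [e] at hf ⊢
    have hf' : n' = n := hf
    rw [yP1, if_neg (by omega), lcA_out _ _ _ (by rw [hf']; simp [hn])]

variable (hG : ∀ i, Subgroup.closure (Set.range (yG i)) = ⊤)
include hG

theorem Ph_mem (i : ℕ) (a : G i) : Ph i a ∈ (commutator (K1 yG)).map (K1 yG).subtype := by
  have ha : a ∈ Subgroup.closure (Set.range (yG i)) := by rw [hG]; trivial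
  induction ha using Subgroup.closure_induction with
  | mem a ha =>
    obtain ⟨r, rfl⟩ := ha
    refine ⟨⁅(⟨gk yG (2 * Nat.pair i r + 1), gk_mem yG _⟩ : K1 yG), y1 yG 1⁆, ?_, ?_⟩
    · exact Subgroup.commutator_mem_commutator (Subgroup.mem_top _) (Subgroup.mem_top _)
    · rw [Ph_gen]; rfl
  | one => rw [map_one]; exact one_mem _
  | mul a b _ _ ha hb => rw [map_mul]; exact mul_mem ha hb
  | inv a _ ha => rw [map_inv]; exact inv_mem ha

/-- the embedding -/
noncomputable def ph (i : ℕ) : G i →* K1 yG :=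
  (Ph i).codRestrict (K1 yG) (fun a => by
    obtain ⟨k, -, h⟩ := Ph_mem yG hG i a
    rw [← h]; exact k.2)

theorem ph_coe (i : ℕ) (a : G i) : ((ph yG hG i a : K1 yG) : Equiv.Perm (O1 G)) = Ph i a := rfl

theorem ph_comm (i : ℕ) (a : G i) : ph yG hG i a ∈ commutator (K1 yG) := by
  obtain ⟨k, hk, h⟩ := Ph_mem yG hG i a
  have : k = ph yG hG i a := Subtype.ext h
  rwa [← this]

theorem ph_inj (i : ℕ) : Function.Injective (ph yG hG i) := by
  intro a b h
  have h1 : Ph i a = Ph i b := congrArg Subtype.val h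
  have h2 := congrArg (fun f : Equiv.Perm (O1 G) => f (p1 0 0 i 1)) h1
  simp only [Ph_apply, lcA_in] at h2
  simpa using (p1_inj.1 h2).2.2

theorem ph_frattini (i : ℕ) (a b : G i) (h : IsConj (ph yG hG i a) (ph yG hG i b)) : IsConj a b := by
  obtain ⟨k, hk⟩ := isConj_iff.1 h
  rw [mul_inv_eq_iff_eq_mul] at hk
  obtain ⟨w, rfl⟩ := y1_surj yG k
  have hk : evalWord (yP yG) w * Ph i a = Ph i b * evalWord (yP yG) w := by
    have := congrArg (fun k : K1 yG => (k : Equiv.Perm (O1 G))) hk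
    simpa only [Subgroup.coe_mul, y1_word, ph_coe] using this
  have h2 := congrArg (fun f : Equiv.Perm (O1 G) => f (p1 0 0 i 1)) hk
  simp only [Equiv.Perm.mul_apply, Ph_apply, lcA_in, yP_run, mul_one] at h2
  set n := (rn i w (0, 0, [])).1
  set j := (rn i w (0, 0, [])).2.1
  set c := evalWord (yG i) (rn i w (0, 0, [])).2.2
  by_cases h0 : n = 0 ∧ j = 0
  · rw [h0.1, h0.2, lcA_in] at h2
    have := (p1_inj.1 h2).2.2
    exact isConj_iff.2 ⟨c, by rw [this]; group⟩
  · rw [lcA_out _ _ _ (by tauto)] at h2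
    have ha : a = 1 := by simpa using (p1_inj.1 h2).2.2
    have hb : b = 1 := by
      apply ph_inj yG hG i
      rw [map_one]
      rw [ha, map_one] at h
      exact isConj_one_right.1 h |>.symm ▸ rfl
    rw [ha, hb]

theorem ph_len (i : ℕ) (a : G i) (w : Wd) (h : evalWord (y1 yG) w = ph yG hG i a) :
    ∃ v : Wd, v.length ≤ w.length ∧ evalWord (yG i) v = a := by
  have h1 : evalWord (yP yG) w = Ph i a := by rw [← y1_word, h, ph_coe]
  have h2 := congrArg (fun f : Equiv.Perm (O1 G) => f (p1 0 0 i 1)) h1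
  simp only [Ph_apply, lcA_in, yP_run, mul_one] at h2
  refine ⟨_, ?_, (p1_inj.1 h2).2.2⟩
  clear h h1 h2
  generalize (0 : ℤ) = x
  induction w with
  | nil => simp [rn_nil]
  | cons r w ih =>
    rw [rn_cons, stp]
    cases cd i r.1 (rn i w (x, x, [])).1 (rn i w (x, x, [])).2.1 <;> simp <;> omega
end famK
end SimpEmb

set_option linter.unusedSectionVars false
set_option linter.unusedSimpArgs false
namespace SimpEmb
section finA

open Classical in
/-- the finite generating set -/
noncomputable def gset {H : Type*} [Group H] (x : ℕ → H) (m : ℕ) : Finset H := (Finset.range m).image x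

variable {H : Type*} [Group H] {x : ℕ → H} {m : ℕ}

theorem mem_gset {a : H} : a ∈ gset x m ↔ ∃ r, r < m ∧ x r = a := by
  classical
  simp [gset]

theorem word_filter (hx : ∀ n, m ≤ n → x n = 1) (w : Wd) :
    ∃ v : Wd, v.length ≤ w.length ∧ (∀ p ∈ v, p.1 < m) ∧ evalWord x v = evalWord x w := by
  induction w with
  | nil => exact ⟨[], le_rfl, by simp, rfl⟩
  | cons p w ih =>
    obtain ⟨v, h1, h2, h3⟩ := ih
    by_cases hp : p.1 < m
    · refine ⟨p :: v, by simpa using h1, ?_, by rw [evalWord_cons, evalWord_cons, h3]⟩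
      intro q hq
      rcases List.mem_cons.1 hq with rfl | hq
      · exact hp
      · exact h2 q hq
    · refine ⟨v, by simp; omega, h2, ?_⟩
      rw [evalWord_cons, h3, hx p.1 (by omega)]
      cases p.2 <;> simp [sg]

theorem wl_le (hx : ∀ n, m ≤ n → x n = 1) (w : Wd) : wordLength (gset x m) (evalWord x w) ≤ w.length := by
  obtain ⟨v, h1, h2, h3⟩ := word_filter hx w
  refine le_trans (Nat.sInf_le ?_) h1
  refine ⟨v.map (fun p : ℕ × Bool => if p.2 then x p.1 else (x p.1)⁻¹), by simp, ?_, h3⟩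
  intro a ha
  obtain ⟨p, hp, rfl⟩ := List.mem_map.1 ha
  have : x p.1 ∈ gset x m := by
    exact mem_gset.2 ⟨p.1, h2 p hp, rfl⟩
  split_ifs
  · exact Or.inl this
  · exact Or.inr (by rwa [inv_inv])

theorem wl_ex (hx : ∀ n, m ≤ n → x n = 1) (h : H) (hw : ∃ w, evalWord x w = h) :
    ∃ w : Wd, w.length = wordLength (gset x m) h ∧ evalWord x w = h := by
  have hne : {n | ∃ w : List H, w.length = n ∧ (∀ a ∈ w, a ∈ gset x m ∨ a⁻¹ ∈ gset x m) ∧ w.prod = h}.Nonempty := by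
    obtain ⟨w, rfl⟩ := hw
    obtain ⟨v, h1, h2, h3⟩ := word_filter hx w
    refine ⟨_, v.map (fun p : ℕ × Bool => if p.2 then x p.1 else (x p.1)⁻¹), rfl, ?_, h3⟩
    intro a ha
    obtain ⟨p, hp, rfl⟩ := List.mem_map.1 ha
    have : x p.1 ∈ gset x m := by
      exact mem_gset.2 ⟨p.1, h2 p hp, rfl⟩
    split_ifs
    · exact Or.inl this
    · exact Or.inr (by rwa [inv_inv])
  obtain ⟨l, h1, h2, h3⟩ := Nat.sInf_mem hne
  have h4 : l.length = wordLength (gset x m) h := h1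
  rw [← h4, ← h3]
  clear h4 h1 h3 hne hw
  induction l with
  | nil => exact ⟨[], rfl, rfl⟩
  | cons a l ih =>
    obtain ⟨w, e1, e2⟩ := ih (fun b hb => h2 b (List.mem_cons_of_mem _ hb))
    rcases h2 a List.mem_cons_self with ha | ha
    · obtain ⟨r, -, rfl⟩ := mem_gset.1 ha
      exact ⟨(r, true) :: w, by simp [e1], by rw [evalWord_cons, e2]; simp [sg]⟩
    · obtain ⟨r, -, hr⟩ := mem_gset.1 ha
      exact ⟨(r, false) :: w, by simp [e1], by rw [evalWord_cons, e2]; simp [sg, hr]⟩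

theorem gset_gen (hx : ∀ n, m ≤ n → x n = 1) (hw : ∀ h : H, ∃ w, evalWord x w = h) : Generates (gset x m) := by
  unfold Generates
  rw [eq_top_iff]
  rintro h -
  obtain ⟨w, rfl⟩ := hw h
  induction w with
  | nil => exact one_mem _
  | cons r w ih =>
    rw [evalWord_cons]
    refine mul_mem ?_ ih
    have : x r.1 ∈ Subgroup.closure (gset x m : Set H) := by
      by_cases hr : r.1 < m
      · apply Subgroup.subset_closure
        exact mem_gset.2 ⟨r.1, hr, rfl⟩
      · rw [hx r.1 (by omega)]; exact one_mem _
    unfold sg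
    split_ifs
    · exact this
    · exact inv_mem this

/-- the upper bound for the word length -/
theorem wl_upper {G : Type*} [Group G] {y : ℕ → G} {k : ℕ} (hy : ∀ n, k ≤ n → y n = 1) (hyw : ∀ g : G, ∃ w, evalWord y w = g)
    (hx : ∀ n, m ≤ n → x n = 1) (hxw : ∀ h : H, ∃ w, evalWord x w = h) (φ : G →* H) :
    ∃ C : ℕ, ∀ g, wordLength (gset x m) (φ g) ≤ C * wordLength (gset y k) g := by
  choose W hW using fun r => hxw (φ (y r))
  let C := ∑ r ∈ Finset.range k, (W r).length
  refine ⟨C, fun g => ?_⟩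
  obtain ⟨w, h1, h2⟩ := wl_ex hy g (hyw g)
  obtain ⟨v, h3, h4, h5⟩ := word_filter hy w
  rw [← h1, ← h2, ← h5]
  have key : ∀ v : Wd, (∀ p ∈ v, p.1 < k) → ∃ u : Wd, u.length ≤ C * v.length ∧ evalWord x u = φ (evalWord y v) := by
    intro v hv
    induction v with
    | nil => exact ⟨[], by simp, by simp [evalWord]⟩
    | cons p v ih =>
      obtain ⟨u, e1, e2⟩ := ih (fun q hq => hv q (List.mem_cons_of_mem _ hq))
      have hC : (W p.1).length ≤ C :=
        Finset.single_le_sum (f := fun r => (W r).length) (fun _ _ => Nat.zero_le _)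
          (Finset.mem_range.2 (hv p List.mem_cons_self))
      refine ⟨(if p.2 then W p.1 else invW (W p.1)) ++ u, ?_, ?_⟩
      · have : (if p.2 then W p.1 else invW (W p.1)).length = (W p.1).length := by
          split_ifs <;> simp [invW]
        rw [List.length_append, this, List.length_cons, Nat.mul_succ]; omega
      · rw [evalWord_append, evalWord_cons, map_mul, e2]
        congr 1
        unfold sg
        split_ifs
        · exact hW _
        · rw [evalWord_invW, hW, map_inv]
  obtain ⟨u, e1, e2⟩ := key v h4
  rw [← e2]
  exact (wl_le hx u).trans (e1.trans (Nat.mul_le_mul_left _ h3))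

theorem orderSign_csg (l : LinearOrder H) (h : H) : orderSign l h = @csg H l h 1 := by
  unfold orderSign csg
  split_ifs <;> rfl

theorem msm (l : LinearOrder H) (hl : ∀ a b c : H, l.le b c → l.le (a * b) (a * c)) :
    @MulLeftStrictMono H _ l.toLT := by
  refine @CovariantClass.mk _ _ _ _ ?_
  intro c a b h
  refine lt_of_le_of_ne (hl c a b h.le) ?_
  intro e
  exact h.ne (mul_left_cancel e)

theorem wrt_via (h : ComputableLeftOrderWrt x) (hxw : ∀ h : H, ∃ w : Wd, (∀ p ∈ w, p.1 < m) ∧ evalWord x w = h) :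
    ∃ (m : ℕ) (ρ : FreeGroup (Fin m) →* H), Function.Surjective ρ ∧ ComputableLeftOrderVia ρ := by
  have e : ∀ w : List (Fin m × Bool), FreeGroup.lift (fun i : Fin m => x i) (FreeGroup.mk w) =
      evalWord x (w.map (fun p => ((p.1 : ℕ), p.2))) := by
    intro w
    rw [FreeGroup.lift_mk, evalWord, List.map_map]
    congr 1
    apply List.map_congr_left
    intro p _
    cases hp : p.2 <;> simp [hp]
  refine ⟨m, FreeGroup.lift (fun i : Fin m => x i), ?_, ?_⟩
  · intro h
    obtain ⟨w, hw, rfl⟩ := hxw h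
    refine ⟨FreeGroup.mk (w.pmap (fun p hp => (⟨p.1, hp⟩, p.2)) hw), ?_⟩
    rw [e, List.map_pmap]
    congr 1
    simp
  · obtain ⟨l, hl, hc⟩ := h
    refine ⟨l, hl, ?_⟩
    have h1 : Computable (fun w : List (Fin m × Bool) => w.map (fun p => ((p.1 : ℕ), p.2))) := by
      refine C_map C_id (C_pair (C_prim₁ Primrec.fin_val ?_) ?_) <;> fun_prop
    refine (hc.comp h1).of_eq (fun w => ?_)
    rw [e]
end finA
end SimpEmb

set_option linter.unusedSectionVars false
set_option linter.unusedSimpArgs false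
namespace SimpEmb

theorem iz_comm {K1 : Type} [Group K1] (a : K1) (ha : a ∈ commutator K1) : iz a ∈ commutator (KZ K1) := by
  have key : commutator K1 ≤ (commutator (KZ K1)).comap iz := by
    rw [commutator_def, Subgroup.commutator_le]
    intro a _ c _
    rw [Subgroup.mem_comap, map_commutatorElement, commutator_def]
    exact Subgroup.commutator_mem_commutator (Subgroup.mem_top _) (Subgroup.mem_top _)
  exact key ha

theorem stepH {K1 : Type} [Group K1] (y1 : ℕ → K1) (hR : ∀ n, 3 ≤ n → y1 n = 1)
    (hgen : Subgroup.closure (y1 '' {n | n < 3}) = ⊤) (hc : ComputableLeftOrderWrt y1) :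
    ∃ (H : Type) (_ : Group H) (x : ℕ → H), IsSimpleGroup H ∧ ComputableLeftOrderWrt x ∧ (∀ n, 9 ≤ n → x n = 1) ∧
      (∀ h, ∃ w : Wd, (∀ p ∈ w, p.1 < 9) ∧ evalWord x w = h) ∧
      ∃ τ : commutator K1 →* H, Function.Injective τ ∧
        (∀ a b, IsConj (τ a) (τ b) → IsConj (a : K1) (b : K1)) ∧
        ∀ a w, evalWord x w = τ a → ∃ v : Wd, v.length ≤ w.length ∧ evalWord y1 v = a := by
  obtain ⟨l1, hl1, hc1⟩ := hc
  letI : LinearOrder K1 := l1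
  haveI : MulLeftStrictMono K1 := msm l1 hl1
  have hR4 : ∀ n, 4 ≤ n → yz y1 n = 1 := fun n hn => yz_one hR n hn
  have hy4 : Subgroup.closure (yz y1 '' {n | n < 4}) = ⊤ := yz_gen hgen
  have hfin : (Set.range (yz y1)).Finite := by
    refine ((Set.finite_lt_nat 5).image (yz y1)).subset ?_
    rintro _ ⟨n, rfl⟩
    by_cases h : n < 5
    · exact ⟨n, h, rfl⟩
    · exact ⟨4, by simp, by rw [hR4 n (by omega), hR4 4 le_rfl]⟩
  refine ⟨HH Ap (yz y1) 4, inferInstance, xH (yz y1) 4, HH_simple hy4, ?_, ?_, ?_, ?_⟩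
  · refine HH_computable (C_sgz hc1) (sgz_eq (fun w => orderSign_csg l1 _)) 4 hR4
      (Y := fun L m => L + (m + 1) * (4 * L + 4)) (by fun_prop) (fun L m S hS => hgenZ hR L m S hS)
  · intro n hn
    unfold xH
    rw [dif_neg (by omega)]
  · exact fun h => xH_surj hR4 h
  · have hmem : ∀ a : commutator K1, tau true (iz (a : K1)) ∈ HH Ap (yz y1) 4 :=
      fun a => tau_mem hy4 _ (iz_comm _ a.2)
    let τ : commutator K1 →* HH Ap (yz y1) 4 :=
      (((tau true).comp iz).comp (commutator K1).subtype).codRestrict _ hmem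
    have hτ : ∀ a, ((τ a : HH Ap (yz y1) 4) : Equiv.Perm _) = tau true (iz (a : K1)) := fun a => rfl
    refine ⟨τ, ?_, ?_, ?_⟩
    · intro a b h
      have h2 := tau_injective (by rw [← hτ, ← hτ, h] : tau true (iz (a : K1)) = tau true (iz (b : K1)))
      rw [iz_eq, iz_eq, mz_inj] at h2
      exact Subtype.ext h2.1
    · intro a b h
      obtain ⟨c, hc⟩ := isConj_iff.1 h
      obtain ⟨w, -, hw⟩ := xH_surj hR4 c
      have h3 : c * τ a = τ b * c := by rw [← hc]; group
      have h4 := congrArg (HH Ap (yz y1) 4).subtype h3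
      simp only [Subgroup.coe_subtype] at h4
      simp only [Subgroup.coe_mul, hτ] at h4
      rw [← hw, xH_word hR4] at h4
      obtain ⟨d, hd⟩ := isConj_iff.1 (tau_frattini hfin _ _ w h4)
      obtain ⟨e, m, rfl⟩ := mz_cases d
      rw [iz_eq, iz_eq, mz_inv, mz_mul, mz_mul, mz_inj] at hd
      exact isConj_iff.2 ⟨e, hd.1⟩
    · intro a w h
      have h1 : evalWord (genN Ap (yz y1)) w = tau true (iz (a : K1)) := by
        rw [← hτ, ← h, xH_word hR4]
      have h2 := tau_undistorted hfin _ w h1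
      rw [iz_eq] at h2
      exact Bl_word (Bl_yz h2).1

section fam
variable (n : ℕ → ℕ) (G : ℕ → Type) [∀ i, Group (G i)] (π : ∀ i, FreeGroup (Fin (n i)) →* G i)

/-- the generators of the groups -/
noncomputable def yF (i r : ℕ) : G i := if h : r < n i then π i (FreeGroup.of ⟨r, h⟩) else 1
/-- removing superfluous letters -/
def fltW (i : ℕ) (w : Wd) : Wd := w.flatMap (fun p => bif decide (p.1 < n i) then [p] else [])

theorem yF_one (i r : ℕ) (h : n i ≤ r) : yF n G π i r = 1 := by
  unfold yF; rw [dif_neg (by omega)]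

theorem yF_word (i : ℕ) (w : Wd) : ∃ u : List (Fin (n i) × Bool), u.map (fun p => ((p.1 : ℕ), p.2)) = fltW n i w ∧
    π i (FreeGroup.mk u) = evalWord (yF n G π i) w := by
  induction w with
  | nil => exact ⟨[], rfl, by rw [← FreeGroup.one_eq_mk, map_one]; rfl⟩
  | cons p w ih =>
    obtain ⟨u, h1, h2⟩ := ih
    by_cases hp : p.1 < n i
    · refine ⟨(⟨p.1, hp⟩, p.2) :: u, ?_, ?_⟩
      · simp only [List.map_cons, h1]; simp [fltW, hp]
      · have : FreeGroup.mk ((⟨p.1, hp⟩, p.2) :: u) = FreeGroup.mk [((⟨p.1, hp⟩ : Fin (n i)), p.2)] * FreeGroup.mk u := by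
          rw [FreeGroup.mul_mk]; rfl
        rw [this, map_mul, h2, evalWord_cons]
        congr 1
        unfold sg yF
        rw [dif_pos hp]
        cases p.2
        · simp only [Bool.false_eq_true, if_false]
          rw [← map_inv, FreeGroup.of, FreeGroup.inv_mk]; rfl
        · rfl
    · refine ⟨u, ?_, ?_⟩
      · rw [h1]; simp [fltW, hp]
      · rw [h2, evalWord_cons, yF_one n G π i p.1 (by omega)]
        cases p.2 <;> simp [sg]

theorem yF_surj (hπ : ∀ i, Function.Surjective (π i)) (i : ℕ) (g : G i) : ∃ w, evalWord (yF n G π i) w = g := by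
  obtain ⟨f, rfl⟩ := hπ i g
  induction f using FreeGroup.induction_on with
  | C1 => exact ⟨[], by rw [map_one]; rfl⟩
  | of r => exact ⟨[(r.1, true)], by simp [evalWord, yF]⟩
  | inv_of r _ => exact ⟨[(r.1, false)], by simp [evalWord, yF]⟩
  | mul a b ha hb =>
    obtain ⟨u, hu⟩ := ha
    obtain ⟨v, hv⟩ := hb
    exact ⟨u ++ v, by rw [evalWord_append, hu, hv, map_mul]⟩

theorem yF_clos (hπ : ∀ i, Function.Surjective (π i)) (i : ℕ) :
    Subgroup.closure (Set.range (yF n G π i)) = ⊤ := by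
  rw [eq_top_iff]
  rintro g -
  obtain ⟨w, rfl⟩ := yF_surj n G π hπ i g
  induction w with
  | nil => exact one_mem _
  | cons r w ih =>
    rw [evalWord_cons]
    refine mul_mem ?_ ih
    have : yF n G π i r.1 ∈ Subgroup.closure (Set.range (yF n G π i)) := Subgroup.subset_closure ⟨_, rfl⟩
    unfold sg
    split_ifs
    · exact this
    · exact inv_mem this

theorem final (hn : Computable n) (hπ : ∀ i, Function.Surjective (π i))
    (l : ∀ i, LinearOrder (G i))
    (hl : ∀ i, ∀ a b c : G i, (l i).le b c → (l i).le (a * b) (a * c))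
    (F : ℕ × List (ℕ × Bool) → ℤ) (hF : Computable F)
    (hFc : ∀ i (w : List (Fin (n i) × Bool)),
      F (i, w.map (fun p => ((p.1 : ℕ), p.2))) = orderSign (l i) (π i (FreeGroup.mk w))) :
    ∃ (H : Type) (_ : Group H), Group.FG H ∧ IsSimpleGroup H ∧
      (∃ (m : ℕ) (ρ : FreeGroup (Fin m) →* H),
        Function.Surjective ρ ∧ ComputableLeftOrderVia ρ) ∧
      ∀ i, ∃ (X : Finset (G i)) (Y : Finset H) (φ : G i →* H),
        Generates X ∧ Generates Y ∧ IsQIEmbedding X Y φ ∧ IsFrattini φ := by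
  letI : ∀ i, LinearOrder (G i) := l
  haveI : ∀ i, MulLeftStrictMono (G i) := fun i => msm (l i) (hl i)
  set yG := yF n G π with hyG
  have hG := yF_clos n G π hπ
  have hGw := yF_surj n G π hπ
  have hcK : ComputableLeftOrderWrt (y1 yG) := by
    refine K1_computable yG (sg1 := fun i w => F (i, fltW n i w)) ?_ ?_
    · have h0 : Computable (fun p : ℕ × Wd => fltW n p.1 p.2) := by
        refine C_flatMap Computable.snd ?_
        have h1 : Computable (fun q : (ℕ × Wd) × (ℕ × Bool) => n q.1.1) := hn.comp (by fun_prop)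
        have h2 : Computable (fun q : (ℕ × Wd) × (ℕ × Bool) => decide (q.2.1 < n q.1.1)) :=
          C_nlt (by fun_prop) h1
        exact Computable.cond h2 (by fun_prop) (by fun_prop)
      exact hF.comp (Computable.pair Computable.fst h0)
    · intro i w
      obtain ⟨u, h1, h2⟩ := yF_word n G π i w
      rw [← h1, hFc, h2, orderSign_csg]
  obtain ⟨H, _, x, hs, hc, hx1, hxw, τ, t1, t2, t3⟩ := stepH (y1 yG) (y1_one yG) (y1_gen yG) hcK
  have hxw' : ∀ h : H, ∃ w, evalWord x w = h := fun h => by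
    obtain ⟨w, -, e⟩ := hxw h
    exact ⟨w, e⟩
  have hYg : Generates (gset x 9) := gset_gen hx1 hxw'
  refine ⟨H, inferInstance, ⟨⟨gset x 9, hYg⟩⟩, hs, wrt_via hc hxw, fun i => ?_⟩
  let φ : G i →* H := τ.comp ((ph yG hG i).codRestrict _ (ph_comm yG hG i))
  have hφ : ∀ a, φ a = τ ⟨ph yG hG i a, ph_comm yG hG i a⟩ := fun a => rfl
  have hinj : Function.Injective φ := by
    intro a b h
    exact ph_inj yG hG i (congrArg Subtype.val (t1 h))
  have hy1 := yF_one n G π i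
  refine ⟨gset (yG i) (n i), gset x 9, φ, gset_gen hy1 (hGw i), hYg, ⟨hinj, ?_⟩, hinj, ?_⟩
  · obtain ⟨C, hC⟩ := wl_upper hy1 (hGw i) hx1 hxw' φ
    refine ⟨(C : ℝ) + 1, 1, by positivity, by norm_num, fun g => ⟨?_, ?_⟩⟩
    · have hlow : wordLength (gset (yG i) (n i)) g ≤ wordLength (gset x 9) (φ g) := by
        obtain ⟨w, e1, e2⟩ := wl_ex hx1 (φ g) (hxw' _)
        obtain ⟨v, e3, e4⟩ := t3 _ w (e2.trans (hφ g))
        obtain ⟨u, e5, e6⟩ := ph_len yG hG i g v e4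
        have := wl_le hy1 u
        rw [← hyG, e6] at this
        omega
      have h1 : (wordLength (gset (yG i) (n i)) g : ℝ) ≤ wordLength (gset x 9) (φ g) := by exact_mod_cast hlow
      have h2 : 1 / ((C : ℝ) + 1) ≤ 1 := by
        rw [div_le_one (by positivity)]
        have : (0 : ℝ) ≤ C := by positivity
        linarith
      have h3 : 1 / ((C : ℝ) + 1) * (wordLength (gset (yG i) (n i)) g : ℝ) ≤ wordLength (gset (yG i) (n i)) g :=
        mul_le_of_le_one_left (by positivity) h2
      linarith
    · have h1 : (wordLength (gset x 9) (φ g) : ℝ) ≤ C * wordLength (gset (yG i) (n i)) g := by exact_mod_cast hC g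
      have h2 : (0 : ℝ) ≤ wordLength (gset (yG i) (n i)) g := by positivity
      linarith
  · intro a b
    constructor
    · exact fun h => φ.map_isConj h
    · intro h
      exact ph_frattini yG hG i a b (t2 _ _ h)
end fam
end SimpEmb

theorem family_computable_left_order_embedding_into_fg_simple
    (n : ℕ → ℕ) (hn : Computable n)
    (G : ℕ → Type) [∀ i, Group (G i)]
    (π : ∀ i, FreeGroup (Fin (n i)) →* G i) (hπ : ∀ i, Function.Surjective (π i))
    (l : ∀ i, LinearOrder (G i))
    (hl : ∀ i, ∀ a b c : G i, (l i).le b c → (l i).le (a * b) (a * c))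
    (F : ℕ × List (ℕ × Bool) → ℤ) (hF : Computable F)
    (hFc : ∀ i (w : List (Fin (n i) × Bool)),
      F (i, w.map (fun p => ((p.1 : ℕ), p.2))) = orderSign (l i) (π i (FreeGroup.mk w))) :
    ∃ (H : Type) (_ : Group H), Group.FG H ∧ IsSimpleGroup H ∧
      (∃ (m : ℕ) (ρ : FreeGroup (Fin m) →* H),
        Function.Surjective ρ ∧ ComputableLeftOrderVia ρ) ∧
      ∀ i, ∃ (X : Finset (G i)) (Y : Finset H) (φ : G i →* H),
        Generates X ∧ Generates Y ∧ IsQIEmbedding X Y φ ∧ IsFrattini φ := by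
  exact SimpEmb.final n G π hn hπ l hl F hF hFc
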